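/- Let φ_ε be a solution of the nonlinear eigenvalue problem (EV_ε) in the perforated domain with holes of radius a_ε satisfying c₀ a*_ε ≤ a_ε ≤ C₀ a*_ε, and suppose r₀ = lim_{ε→0} a_ε / a*_ε exists. Then: (1) there is a continuous function φ such that φ_ε → φ in Ω with respect to the L^q-norm for every q > 0, and for any δ > 0 there exist a subset D_δ ⊂ Ω and ε₀ > 0 with |Ω \ D_δ| < δ such that φ_ε → φ uniformly on D_δ as ε → 0; and (2) the limit φ is a viscosity solution of the homogenized problem Δφ − κ_{B_{r₀}} φ + φ^p = 0 in Ω, φ = 0 on ∂Ω, φ > 0 in Ω, where κ_{B_{r₀}} is the harmonic capacity of the ball B_{r₀}. -/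

import Mathlib

open Set Filter Metric MeasureTheory Topology Asymptotics

noncomputable section

/-- Euclidean space ℝⁿ. -/
abbrev Eucl (n : ℕ) := EuclideanSpace ℝ (Fin n)

/-- The points of the lattice `εℤⁿ`. -/
def latticePts (n : ℕ) (ε : ℝ) : Set (Eucl n) :=
  {m | ∀ i, ∃ z : ℤ, m i = ε * (z : ℝ)}

/-- The union of closed balls of radius `a` centered at the lattice points `εℤⁿ`
(the periodic holes `T_{a_ε}`). -/
def holes (n : ℕ) (ε a : ℝ) : Set (Eucl n) :=
  ⋃ m ∈ latticePts n ε, closedBall m a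

/-- The Laplacian of a function on ℝⁿ (sum of its second partial derivatives). -/
def lap {n : ℕ} (u : Eucl n → ℝ) (x : Eucl n) : ℝ :=
  ∑ i, fderiv ℝ (fun y => fderiv ℝ u y (EuclideanSpace.single i 1)) x
    (EuclideanSpace.single i 1)

/-- The harmonic capacity of a compact set, via the Dirichlet energy characterization
(which agrees with the flux of the capacitary potential through the boundary). -/
def capacity (n : ℕ) (K : Set (Eucl n)) : ℝ :=
  sInf {c | ∃ v : Eucl n → ℝ, ContDiff ℝ (⊤ : ℕ∞) v ∧ HasCompactSupport v ∧
    (∀ x ∈ K, 1 ≤ v x) ∧ c = ∫ x, ‖fderiv ℝ v x‖ ^ 2}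

/-- The critical scale `a*_ε = ε^(n/(n-2))` (for `n ≥ 3`). -/
def aStar (n : ℕ) (ε : ℝ) : ℝ := ε ^ ((n : ℝ) / ((n : ℝ) - 2))

/-- A set has smooth boundary: it is the strict sublevel set of a smooth function with
nonvanishing differential on the boundary. -/
def HasSmoothBoundary {n : ℕ} (Ω : Set (Eucl n)) : Prop :=
  ∃ f : Eucl n → ℝ, ContDiff ℝ (⊤ : ℕ∞) f ∧ Ω = {x | f x < 0} ∧
    ∀ x ∈ frontier Ω, fderiv ℝ f x ≠ 0

/-- The heat operator `H[ψ] = Δψ - ∂_t ψ` applied to a space-time function. -/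
def heatOp {n : ℕ} (ψ : Eucl n → ℝ → ℝ) (x : Eucl n) (t : ℝ) : ℝ :=
  lap (fun y => ψ y t) x - deriv (fun s => ψ x s) t

/-- `u` is a viscosity supersolution of `F[u] = 0` on `Q`: whenever a smooth test
function touches `u` from below at a point of `Q`, the operator evaluated on the test
function is `≤ 0` there. -/
def ViscSupersol {n : ℕ} (F : (Eucl n → ℝ → ℝ) → Eucl n → ℝ → ℝ)
    (Q : Set (Eucl n × ℝ)) (u : Eucl n → ℝ → ℝ) : Prop :=
  ∀ ψ : Eucl n → ℝ → ℝ, ContDiff ℝ (⊤ : ℕ∞) (fun p : Eucl n × ℝ => ψ p.1 p.2) →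
    ∀ p ∈ Q, ψ p.1 p.2 = u p.1 p.2 → (∀ᶠ q in 𝓝[Q] p, ψ q.1 q.2 ≤ u q.1 q.2) →
      F ψ p.1 p.2 ≤ 0

/-- `u` is a viscosity subsolution of `F[u] = 0` on `Q`. -/
def ViscSubsol {n : ℕ} (F : (Eucl n → ℝ → ℝ) → Eucl n → ℝ → ℝ)
    (Q : Set (Eucl n × ℝ)) (u : Eucl n → ℝ → ℝ) : Prop :=
  ∀ ψ : Eucl n → ℝ → ℝ, ContDiff ℝ (⊤ : ℕ∞) (fun p : Eucl n × ℝ => ψ p.1 p.2) →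
    ∀ p ∈ Q, ψ p.1 p.2 = u p.1 p.2 → (∀ᶠ q in 𝓝[Q] p, u q.1 q.2 ≤ ψ q.1 q.2) →
      0 ≤ F ψ p.1 p.2

/-- The highly oscillating obstacle `φ_ε = φ · χ_{T_{a_ε}}`. -/
def oscObstacle (n : ℕ) (ε a : ℝ) (φ : Eucl n → ℝ → ℝ) : Eucl n → ℝ → ℝ :=
  fun x t => (holes n ε a).indicator (fun y => φ y t) x

/-- `u` is a viscosity supersolution of the heat equation on `Q_T = Ω × (0,T]`, above the
obstacle `obst`, vanishing on the lateral boundary, with initial data `g`. -/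
def IsSupersolHeatObstacle {n : ℕ} (Ω : Set (Eucl n)) (T : ℝ)
    (obst : Eucl n → ℝ → ℝ) (g : Eucl n → ℝ) (u : Eucl n → ℝ → ℝ) : Prop :=
  ViscSupersol heatOp (Ω ×ˢ Ioc 0 T) u ∧
  (∀ x ∈ frontier Ω, ∀ t ∈ Ioc (0:ℝ) T, u x t = 0) ∧
  (∀ x ∈ Ω, ∀ t ∈ Ioc (0:ℝ) T, obst x t ≤ u x t) ∧
  (∀ x ∈ Ω, u x 0 = g x)

/-- `u` is the least viscosity supersolution of the obstacle problem. -/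
def IsLeastSupersolHeatObstacle {n : ℕ} (Ω : Set (Eucl n)) (T : ℝ)
    (obst : Eucl n → ℝ → ℝ) (g : Eucl n → ℝ) (u : Eucl n → ℝ → ℝ) : Prop :=
  IsSupersolHeatObstacle Ω T obst g u ∧
  ∀ v, IsSupersolHeatObstacle Ω T obst g v →
    ∀ x ∈ Ω, ∀ t ∈ Ioc (0:ℝ) T, u x t ≤ v x t

/-- Difference quotient of size `ε` in direction `e`. -/
def dquot {n : ℕ} (ε : ℝ) (e : Eucl n) (f : Eucl n → ℝ) (x : Eucl n) : ℝ :=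
  (f (x + ε • e) - f x) / ε

/-- Norm of the discrete gradient `‖Δ^ε_e f(x)‖ = (Σ_i |Δ^ε_{e_i} f(x)|²)^{1/2}`. -/
def dgradNorm {n : ℕ} (ε : ℝ) (f : Eucl n → ℝ) (x : Eucl n) : ℝ :=
  Real.sqrt (∑ i, (dquot ε (EuclideanSpace.single i 1) f x) ^ 2)

/-- A unit lattice direction `e ∈ ℤⁿ`, `|e| = 1`. -/
def UnitLatticeDir (n : ℕ) (e : Eucl n) : Prop :=
  e ∈ latticePts n 1 ∧ ‖e‖ = 1

/-- The `ε`-periodic corrector : `Δw = k` outside the holes of radius `a`,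
`w = 1` on the holes. -/
def IsCorrector (n : ℕ) (ε a k : ℝ) (w : Eucl n → ℝ) : Prop :=
  Continuous w ∧ ContDiffOn ℝ 2 w (holes n ε a)ᶜ ∧
  (∀ x ∉ holes n ε a, lap w x = k) ∧
  (∀ x ∈ holes n ε a, w x = 1) ∧
  (∀ m ∈ latticePts n ε, ∀ x, w (x + m) = w x)

/-- `liminf_{ε→0} inf_{x} w_ε(x)`, computed in the extended reals. -/
def liminfInf (n : ℕ) (w : ℝ → Eucl n → ℝ) : EReal :=
  Filter.liminf (fun ε => ⨅ x, ((w ε x : ℝ) : EReal)) (𝓝[>] (0:ℝ))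

/-- Solution of the nonlinear eigenvalue problem (EV_ε) in the perforated domain
with holes of radius `a`, extended by zero outside `Ω_{a}`. -/
def IsEVSol (n : ℕ) (Ω : Set (Eucl n)) (ε a p : ℝ) (φ : Eucl n → ℝ) : Prop :=
  ContinuousOn φ (closure Ω) ∧
  ContDiffOn ℝ 2 φ (Ω \ holes n ε a) ∧
  (∀ x ∈ Ω \ holes n ε a, lap φ x + φ x ^ p = 0) ∧
  (∀ x ∈ Ω \ holes n ε a, 0 < φ x) ∧
  (∀ x, x ∉ Ω \ holes n ε a → φ x = 0)

/-- Elliptic viscosity supersolution of `F[u] = 0` on `D`. -/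
def ViscSupersolE {n : ℕ} (F : (Eucl n → ℝ) → Eucl n → ℝ) (D : Set (Eucl n))
    (u : Eucl n → ℝ) : Prop :=
  ∀ ψ : Eucl n → ℝ, ContDiff ℝ (⊤ : ℕ∞) ψ → ∀ x ∈ D, ψ x = u x →
    (∀ᶠ y in 𝓝[D] x, ψ y ≤ u y) → F ψ x ≤ 0

/-- Elliptic viscosity subsolution of `F[u] = 0` on `D`. -/
def ViscSubsolE {n : ℕ} (F : (Eucl n → ℝ) → Eucl n → ℝ) (D : Set (Eucl n))
    (u : Eucl n → ℝ) : Prop :=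
  ∀ ψ : Eucl n → ℝ, ContDiff ℝ (⊤ : ℕ∞) ψ → ∀ x ∈ D, ψ x = u x →
    (∀ᶠ y in 𝓝[D] x, u y ≤ ψ y) → 0 ≤ F ψ x

/-- The ε-periodic smooth cutoff `ξ` used for the initial data of (PME_ε). -/
def PMECutoff (n : ℕ) (ε : ℝ) (ξ : Eucl n → ℝ) : Prop :=
  ContDiff ℝ (⊤ : ℕ∞) ξ ∧ (∀ x, 0 ≤ ξ x ∧ ξ x ≤ 1) ∧
  (∀ x ∈ holes n ε (aStar n ε), ξ x = 0) ∧
  (∀ x ∉ holes n ε (ε ^ (((n : ℝ) - 1) / ((n : ℝ) - 2))), ξ x = 1) ∧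
  (∀ x ∈ holes n ε (ε ^ (((n : ℝ) - 1) / ((n : ℝ) - 2))) \ holes n ε (aStar n ε),
    lap ξ x = 0) ∧
  (∀ x, lap ξ x ≤ 0) ∧
  (∀ i : Fin n, ∀ x, ξ (x + ε • EuclideanSpace.single i 1) = ξ x)

/-- The smooth initial data `g` for (PME_ε): vanishing outside `Ω` and with
nondegenerate gradient on `∂Ω`. -/
def PMEData (n : ℕ) (Ω : Set (Eucl n)) (δ₀ C : ℝ) (g : Eucl n → ℝ) : Prop :=
  ContDiff ℝ (⊤ : ℕ∞) g ∧ HasCompactSupport g ∧ tsupport g ⊆ closure Ω ∧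
  ∀ x ∈ frontier Ω, δ₀ < ‖fderiv ℝ g x‖ ∧ ‖fderiv ℝ g x‖ < C

/-- `u` solves the porous medium problem (PME_ε) in the perforated domain
`Q_{T,a*_ε} = Ω_{a*_ε} × (0,T]`, with lateral boundary value 0 and initial data `gε`. -/
def IsPMESol (n : ℕ) (Ω : Set (Eucl n)) (T ε m : ℝ) (gε : Eucl n → ℝ)
    (u : Eucl n → ℝ → ℝ) : Prop :=
  ContinuousOn (fun pr : Eucl n × ℝ => u pr.1 pr.2)
    (closure (Ω \ holes n ε (aStar n ε)) ×ˢ Icc 0 T) ∧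
  (∀ x ∈ Ω \ holes n ε (aStar n ε), ∀ t ∈ Ioc (0:ℝ) T,
    lap (fun y => u y t ^ m) x - deriv (fun s => u x s) t = 0) ∧
  (∀ x ∈ frontier (Ω \ holes n ε (aStar n ε)), ∀ t ∈ Ioc (0:ℝ) T, u x t = 0) ∧
  (∀ x ∈ Ω \ holes n ε (aStar n ε), u x 0 = gε x)

set_option linter.unusedVariables false

section
/-- Partial derivative. -/
def pd {n : ℕ} (i : Fin n) (u : Eucl n → ℝ) (x : Eucl n) : ℝ :=
  fderiv ℝ u x (EuclideanSpace.single i 1)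

lemma lap_eq_pd {n : ℕ} (u : Eucl n → ℝ) (x : Eucl n) :
    lap u x = ∑ i, pd i (pd i u) x := rfl

/-- Squared gradient. -/
def gsq {n : ℕ} (u : Eucl n → ℝ) (x : Eucl n) : ℝ := ∑ i, (pd i u x) ^ 2

/-- Scalar product of gradients. -/
def gdot {n : ℕ} (u v : Eucl n → ℝ) (x : Eucl n) : ℝ := ∑ i, pd i u x * pd i v x

lemma gsq_nonneg {n : ℕ} (u : Eucl n → ℝ) (x : Eucl n) : 0 ≤ gsq u x :=
  Finset.sum_nonneg fun _ _ => sq_nonneg _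

section calculus
variable {n : ℕ} {u v : Eucl n → ℝ} {x : Eucl n} {i : Fin n}

lemma pd_congr (h : u =ᶠ[𝓝 x] v) : pd i u x = pd i v x := by
  unfold pd; rw [h.fderiv_eq]

lemma pd_congr_ev (h : u =ᶠ[𝓝 x] v) : pd i u =ᶠ[𝓝 x] pd i v := by
  filter_upwards [h.eventuallyEq_nhds] with y hy using pd_congr hy

lemma lap_congr (h : u =ᶠ[𝓝 x] v) : lap u x = lap v x := by
  rw [lap_eq_pd, lap_eq_pd]
  exact Finset.sum_congr rfl fun i _ => pd_congr (pd_congr_ev h)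

lemma gsq_congr (h : u =ᶠ[𝓝 x] v) : gsq u x = gsq v x :=
  Finset.sum_congr rfl fun i _ => by rw [pd_congr h]

lemma diff_of_c2 (h : ContDiffAt ℝ 2 u x) : DifferentiableAt ℝ u x :=
  h.differentiableAt (by norm_num)

lemma ev_c2 (h : ContDiffAt ℝ 2 u x) : ∀ᶠ y in 𝓝 x, ContDiffAt ℝ 2 u y :=
  h.eventually (by simp)

lemma pd_c1 (h : ContDiffAt ℝ 2 u x) : ContDiffAt ℝ 1 (pd i u) x := by
  have := h.fderiv_right (m := 1) (by norm_num)
  exact this.clm_apply contDiffAt_const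

lemma pd_smooth (h : ContDiff ℝ (⊤ : ℕ∞) u) : ContDiff ℝ (⊤ : ℕ∞) (pd i u) := by
  have := h.fderiv_right (m := (⊤ : ℕ∞)) (by simp)
  exact this.clm_apply contDiff_const

lemma pd_diff (h : ContDiffAt ℝ 2 u x) : DifferentiableAt ℝ (pd i u) x :=
  (pd_c1 h).differentiableAt (by norm_num)

lemma pd_add' (hu : DifferentiableAt ℝ u x) (hv : DifferentiableAt ℝ v x) :
    pd i (fun y => u y + v y) x = pd i u x + pd i v x := by
  unfold pd; rw [fderiv_fun_add hu hv]; rfl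

lemma pd_const_mul (c : ℝ) (hu : DifferentiableAt ℝ u x) :
    pd i (fun y => c * u y) x = c * pd i u x := by
  unfold pd; rw [fderiv_const_mul hu]; rfl

lemma pd_mul' (hu : DifferentiableAt ℝ u x) (hv : DifferentiableAt ℝ v x) :
    pd i (fun y => u y * v y) x = u x * pd i v x + v x * pd i u x := by
  unfold pd; rw [fderiv_fun_mul hu hv]; simp

lemma pd_const (c : ℝ) : pd i (fun _ : Eucl n => c) x = 0 := by
  unfold pd; simp

lemma pd_comp {g : ℝ → ℝ} (hg : DifferentiableAt ℝ g (u x)) (hu : DifferentiableAt ℝ u x) :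
    pd i (fun y => g (u y)) x = deriv g (u x) * pd i u x := by
  unfold pd
  have := (hg.hasDerivAt.comp_hasFDerivAt x hu.hasFDerivAt).fderiv
  rw [show (fun y => g (u y)) = g ∘ u from rfl, this]; simp

lemma lap_const (c : ℝ) : lap (fun _ : Eucl n => c) x = 0 := by
  rw [lap_eq_pd]
  refine Finset.sum_eq_zero fun i _ => ?_
  have : pd i (fun _ : Eucl n => c) = fun _ => 0 := by ext y; exact pd_const c
  rw [this]; exact pd_const 0

lemma lap_add (hu : ContDiffAt ℝ 2 u x) (hv : ContDiffAt ℝ 2 v x) :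
    lap (fun y => u y + v y) x = lap u x + lap v x := by
  simp only [lap_eq_pd, ← Finset.sum_add_distrib]
  refine Finset.sum_congr rfl fun i _ => ?_
  rw [← pd_add' (pd_diff hu) (pd_diff hv)]
  apply pd_congr
  filter_upwards [ev_c2 hu, ev_c2 hv] with y h1 h2
  exact pd_add' (diff_of_c2 h1) (diff_of_c2 h2)

lemma lap_const_mul (c : ℝ) (hu : ContDiffAt ℝ 2 u x) :
    lap (fun y => c * u y) x = c * lap u x := by
  simp only [lap_eq_pd, Finset.mul_sum]
  refine Finset.sum_congr rfl fun i _ => ?_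
  rw [← pd_const_mul c (pd_diff hu)]
  apply pd_congr
  filter_upwards [ev_c2 hu] with y h1
  exact pd_const_mul c (diff_of_c2 h1)

lemma lap_neg (hu : ContDiffAt ℝ 2 u x) : lap (fun y => - u y) x = - lap u x := by
  have := lap_const_mul (-1) hu
  simpa using this

lemma lap_sub (hu : ContDiffAt ℝ 2 u x) (hv : ContDiffAt ℝ 2 v x) :
    lap (fun y => u y - v y) x = lap u x - lap v x := by
  simp only [sub_eq_add_neg]
  rw [lap_add hu hv.neg, lap_neg hv]

lemma lap_sum {ι : Type*} (s : Finset ι) (f : ι → Eucl n → ℝ)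
    (h : ∀ j ∈ s, ContDiffAt ℝ 2 (f j) x) :
    lap (fun y => ∑ j ∈ s, f j y) x = ∑ j ∈ s, lap (f j) x := by
  classical
  induction s using Finset.induction_on with
  | empty => simpa using lap_const (x := x) 0
  | insert a s ha ih =>
    simp only [Finset.sum_insert ha]
    rw [lap_add (h a (by simp)), ih fun j hj => h j (by simp [hj])]
    exact ContDiffAt.sum fun j hj => h j (by simp [hj])

lemma pd_sum {ι : Type*} (s : Finset ι) (f : ι → Eucl n → ℝ)
    (h : ∀ j ∈ s, DifferentiableAt ℝ (f j) x) :
    pd i (fun y => ∑ j ∈ s, f j y) x = ∑ j ∈ s, pd i (f j) x := by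
  unfold pd; rw [fderiv_fun_sum h]; simp

lemma lap_mul (hu : ContDiffAt ℝ 2 u x) (hv : ContDiffAt ℝ 2 v x) :
    lap (fun y => u y * v y) x = u x * lap v x + v x * lap u x + 2 * gdot u v x := by
  simp only [lap_eq_pd, gdot, Finset.mul_sum, ← Finset.sum_add_distrib]
  refine Finset.sum_congr rfl fun i _ => ?_
  have : pd i (fun y => u y * v y) =ᶠ[𝓝 x] fun y => u y * pd i v y + v y * pd i u y := by
    filter_upwards [ev_c2 hu, ev_c2 hv] with y h1 h2
    exact pd_mul' (diff_of_c2 h1) (diff_of_c2 h2)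
  have h1 : DifferentiableAt ℝ (fun y => u y * pd i v y) x := (diff_of_c2 hu).mul (pd_diff hv)
  have h2 : DifferentiableAt ℝ (fun y => v y * pd i u y) x := (diff_of_c2 hv).mul (pd_diff hu)
  rw [pd_congr this, pd_add' h1 h2,
    pd_mul' (diff_of_c2 hu) (pd_diff hv), pd_mul' (diff_of_c2 hv) (pd_diff hu)]
  ring

lemma lap_comp {g : ℝ → ℝ} (hg : ContDiffAt ℝ 2 g (u x)) (hu : ContDiffAt ℝ 2 u x) :
    lap (fun y => g (u y)) x = deriv g (u x) * lap u x + deriv (deriv g) (u x) * gsq u x := by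
  simp only [lap_eq_pd, gsq, Finset.mul_sum, ← Finset.sum_add_distrib]
  refine Finset.sum_congr rfl fun i _ => ?_
  have h1 : ∀ᶠ t in 𝓝 (u x), ContDiffAt ℝ 2 g t := hg.eventually (by simp)
  have h2 : ∀ᶠ y in 𝓝 x, ContDiffAt ℝ 2 g (u y) := hu.continuousAt.eventually h1
  have : pd i (fun y => g (u y)) =ᶠ[𝓝 x] fun y => deriv g (u y) * pd i u y := by
    filter_upwards [ev_c2 hu, h2] with y h3 h4
    exact pd_comp (h4.differentiableAt (by norm_num)) (diff_of_c2 h3)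
  have hd : DifferentiableAt ℝ (deriv g) (u x) := by
    have := (hg.fderiv_right (m := 1) (by norm_num)).clm_apply
      (contDiffAt_const (c := (1:ℝ)))
    exact this.differentiableAt (by norm_num)
  have hd2 : DifferentiableAt ℝ (fun y => deriv g (u y)) x := hd.comp x (diff_of_c2 hu)
  rw [pd_congr this, pd_mul' hd2 (pd_diff hu), pd_comp hd (diff_of_c2 hu)]
  ring

lemma gsq_comp {g : ℝ → ℝ} (hg : DifferentiableAt ℝ g (u x)) (hu : DifferentiableAt ℝ u x) :
    gsq (fun y => g (u y)) x = deriv g (u x) ^ 2 * gsq u x := by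
  simp only [gsq, Finset.mul_sum]
  refine Finset.sum_congr rfl fun i _ => ?_
  rw [pd_comp hg hu]; ring

lemma pd_comp_sub (u : Eucl n → ℝ) (c x : Eucl n) :
    pd i (fun y => u (y - c)) x = pd i u (x - c) := by
  unfold pd
  simp only [sub_eq_add_neg]
  rw [fderiv_comp_add_right]

lemma lap_comp_sub (u : Eucl n → ℝ) (c x : Eucl n) :
    lap (fun y => u (y - c)) x = lap u (x - c) := by
  simp only [lap_eq_pd]
  refine Finset.sum_congr rfl fun i _ => ?_
  have : pd i (fun y => u (y - c)) = fun y => pd i u (y - c) := by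
    ext y; exact pd_comp_sub u c y
  rw [this]; exact pd_comp_sub _ c x

lemma gsq_comp_sub (u : Eucl n → ℝ) (c x : Eucl n) :
    gsq (fun y => u (y - c)) x = gsq u (x - c) := by
  simp only [gsq, pd_comp_sub]

lemma pd_local_max (h : IsLocalMax u x) : pd i u x = 0 := by
  unfold pd; rw [h.fderiv_eq_zero]; simp

/-- At a local maximum the Laplacian is nonpositive. -/
lemma lap_local_max (h : IsLocalMax u x) (hu : ContDiffAt ℝ 2 u x) : lap u x ≤ 0 := by
  rw [lap_eq_pd]
  refine Finset.sum_nonpos fun i _ => ?_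
  set e : Eucl n := EuclideanSpace.single i 1
  set L : ℝ → Eucl n := fun t => x + t • e
  have hL : ∀ t, HasDerivAt L e t := fun t => by
    have := ((hasDerivAt_id t).smul_const e).const_add x
    rw [one_smul] at this
    exact this
  have hL0 : L 0 = x := by simp [L]
  have hLc : Tendsto L (𝓝 0) (𝓝 x) := by
    have := (hL 0).continuousAt.tendsto; rwa [hL0] at this
  set f : ℝ → ℝ := fun t => u (L t)
  have hf1 : deriv f =ᶠ[𝓝 0] fun t => pd i u (L t) := by
    filter_upwards [hLc.eventually (ev_c2 hu)] with t ht
    exact ((diff_of_c2 ht).hasFDerivAt.comp_hasDerivAt t (hL t)).deriv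
  have hf2 : deriv (deriv f) 0 = pd i (pd i u) x := by
    rw [hf1.deriv_eq]
    have h1 : DifferentiableAt ℝ (pd i u) (L 0) := by rw [hL0]; exact pd_diff hu
    change deriv (pd i u ∘ L) 0 = _
    rw [(h1.hasFDerivAt.comp_hasDerivAt 0 (hL 0)).deriv, hL0]; rfl
  by_contra hc
  push Not at hc
  have hm : IsLocalMax f 0 := by
    have : ∀ᶠ t in 𝓝 (0:ℝ), u (L t) ≤ u x := hLc.eventually h
    filter_upwards [this] with t ht
    simpa [f, hL0] using ht
  have hcont : ContinuousAt f 0 := by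
    have : ContinuousAt u (L 0) := by rw [hL0]; exact hu.continuousAt
    exact this.comp (hL 0).continuousAt
  have hmin := isLocalMin_of_deriv_deriv_pos (f := f) (x₀ := 0) (by rw [hf2]; exact hc)
    hm.deriv_eq_zero hcont
  have heq : f =ᶠ[𝓝 0] fun _ => f 0 := by
    filter_upwards [hm, hmin] with t h1 h2 using le_antisymm h1 h2
  have h0 : deriv (deriv f) 0 = 0 := by
    have h3 : deriv f =ᶠ[𝓝 0] fun _ => 0 := by
      filter_upwards [heq.eventuallyEq_nhds] with t ht
      rw [ht.deriv_eq]; simp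
    rw [h3.deriv_eq]; simp
  rw [h0] at hf2; linarith

/-- squared distance -/
lemma sqd_smooth (c : Eucl n) : ContDiff ℝ (⊤ : ℕ∞) (fun y : Eucl n => ‖y - c‖ ^ 2) :=
  (contDiff_id.sub contDiff_const).norm_sq ℝ

lemma pd_sqd (c x : Eucl n) : pd i (fun y => ‖y - c‖ ^ 2) x = 2 * (x i - c i) := by
  rw [pd_comp_sub (fun y => ‖y‖ ^ 2) c x]
  unfold pd
  have := (hasStrictFDerivAt_norm_sq (x - c)).hasFDerivAt.fderiv
  rw [this]
  simp [EuclideanSpace.inner_single_right]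

lemma lap_sqd (c x : Eucl n) : lap (fun y => ‖y - c‖ ^ 2) x = 2 * n := by
  rw [lap_eq_pd]
  have : ∀ i : Fin n, pd i (pd i (fun y => ‖y - c‖ ^ 2)) x = 2 := by
    intro i
    have h : pd i (fun y => ‖y - c‖ ^ 2) = fun y => 2 * (y i - c i) := by
      ext y; exact pd_sqd c y
    rw [h]
    have h2 : HasFDerivAt (fun y : Eucl n => 2 * (y i - c i))
        ((2:ℝ) • (EuclideanSpace.proj i : Eucl n →L[ℝ] ℝ)) x := by
      exact ((EuclideanSpace.proj i : Eucl n →L[ℝ] ℝ).hasFDerivAt.sub_const (c i)).const_mul 2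
    unfold pd; rw [h2.fderiv]; simp
  simp [this, mul_comm]

lemma gsq_sqd (c x : Eucl n) : gsq (fun y => ‖y - c‖ ^ 2) x = 4 * ‖x - c‖ ^ 2 := by
  simp only [gsq, pd_sqd]
  rw [EuclideanSpace.norm_sq_eq, Finset.mul_sum]
  refine Finset.sum_congr rfl fun i _ => ?_
  simp; ring

lemma norm_fderiv_sq (u : Eucl n → ℝ) (x : Eucl n) : ‖fderiv ℝ u x‖ ^ 2 = gsq u x := by
  set f := fderiv ℝ u x
  set w := (InnerProductSpace.toDual ℝ (Eucl n)).symm f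
  have h1 : ‖f‖ = ‖w‖ := by simp [w]
  rw [h1, EuclideanSpace.norm_sq_eq]
  refine Finset.sum_congr rfl fun i _ => ?_
  have : f (EuclideanSpace.single i 1) = w i := by
    have := InnerProductSpace.toDual_symm_apply (x := EuclideanSpace.single i (1:ℝ)) (y := f)
    rw [← this]
    change inner ℝ w (EuclideanSpace.single i 1) = _
    rw [EuclideanSpace.inner_single_right]; simp
  simp only [pd]
  rw [this]; simp

lemma gdot_le (u v : Eucl n → ℝ) (x : Eucl n) (t : ℝ) :
    2 * t * gdot u v x - t ^ 2 * gsq v x ≤ gsq u x := by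
  simp only [gdot, gsq, Finset.mul_sum, ← Finset.sum_sub_distrib]
  refine Finset.sum_le_sum fun i _ => ?_
  nlinarith [sq_nonneg (pd i u x - t * pd i v x)]

end calculus
end

section
section green
variable {n : ℕ} {u v w : Eucl n → ℝ}

lemma cont_mul_supp {X : Type*} [TopologicalSpace X] {f g : X → ℝ} (hg : Continuous g)
    (hf : ∀ x ∈ tsupport g, ContinuousAt f x) : Continuous (fun x => f x * g x) := by
  rw [continuous_iff_continuousAt]
  intro x
  by_cases hx : x ∈ tsupport g
  · exact (hf x hx).mul hg.continuousAt
  · have h0 : g =ᶠ[𝓝 x] 0 := notMem_tsupport_iff_eventuallyEq.1 hx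
    have : (fun x => f x * g x) =ᶠ[𝓝 x] fun _ => 0 := by
      filter_upwards [h0] with y hy; simp [hy]
    exact continuousAt_const.congr this.symm

lemma int_mul_supp {f g : Eucl n → ℝ} (hg : Continuous g) (hc : HasCompactSupport g)
    (hf : ∀ x ∈ tsupport g, ContinuousAt f x) : Integrable (fun x => f x * g x) :=
  (cont_mul_supp hg hf).integrable_of_hasCompactSupport hc.mul_left

lemma tsupport_pd (i : Fin n) : tsupport (pd i v) ⊆ tsupport v := by
  intro x hx
  by_contra h
  have h0 : v =ᶠ[𝓝 x] fun _ => 0 := notMem_tsupport_iff_eventuallyEq.1 h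
  have : pd i v =ᶠ[𝓝 x] 0 := by
    filter_upwards [pd_congr_ev (i := i) h0] with y hy
    rw [hy]; exact pd_const 0
  exact notMem_tsupport_iff_eventuallyEq.2 this hx

lemma hcs_pd (i : Fin n) (hc : HasCompactSupport v) : HasCompactSupport (pd i v) :=
  hc.of_isClosed_subset (isClosed_tsupport _) (tsupport_pd i)

lemma tsupport_lap : tsupport (lap v) ⊆ tsupport v := by
  intro x hx
  by_contra h
  have h0 : v =ᶠ[𝓝 x] fun _ => 0 := notMem_tsupport_iff_eventuallyEq.1 h
  have : lap v =ᶠ[𝓝 x] 0 := by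
    filter_upwards [h0.eventuallyEq_nhds] with y hy
    rw [lap_congr hy]; exact lap_const 0
  exact notMem_tsupport_iff_eventuallyEq.2 this hx

lemma hcs_lap (hc : HasCompactSupport v) : HasCompactSupport (lap v) :=
  hc.of_isClosed_subset (isClosed_tsupport _) tsupport_lap

lemma pd_contDiff1 (i : Fin n) (hv : ContDiff ℝ 2 v) : ContDiff ℝ 1 (pd i v) :=
  contDiff_iff_contDiffAt.2 fun _ => pd_c1 hv.contDiffAt

lemma pdpd_contAt (i j : Fin n) {x} (hv : ContDiffAt ℝ 2 v x) :
    ContinuousAt (pd j (pd i v)) x := by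
  have := (pd_c1 (i := i) hv).fderiv_right (m := 0) (by norm_num)
  exact (this.clm_apply contDiffAt_const).continuousAt

lemma lap_contAt {x} (hv : ContDiffAt ℝ 2 v x) : ContinuousAt (lap v) x := by
  have : lap v = fun x => ∑ i, pd i (pd i v) x := rfl
  rw [this]
  exact tendsto_finsetSum _ fun i _ => pdpd_contAt i i hv

lemma lap_cont (hv : ContDiff ℝ 2 v) : Continuous (lap v) :=
  continuous_iff_continuousAt.2 fun _ => lap_contAt hv.contDiffAt

lemma ibp (i : Fin n) (hw : ContDiff ℝ 1 w) (hc : HasCompactSupport w)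
    (hu : ∀ x ∈ tsupport w, ContDiffAt ℝ 1 u x) :
    ∫ x, u x * pd i w x = - ∫ x, pd i u x * w x := by
  have hpw : Continuous (pd i w) :=
    (hw.continuous_fderiv (by norm_num)).clm_apply continuous_const
  refine integral_mul_fderiv_eq_neg_fderiv_mul_of_integrable ?_ ?_ ?_ ?_ ?_
  · refine int_mul_supp hw.continuous hc fun x hx => ?_
    have := (hu x hx).fderiv_right (m := 0) (by norm_num)
    exact (this.clm_apply contDiffAt_const).continuousAt
  · exact int_mul_supp hpw (hcs_pd i hc)
      fun x hx => (hu x (tsupport_pd i hx)).continuousAt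
  · exact int_mul_supp hw.continuous hc fun x hx => (hu x hx).continuousAt
  · exact fun x hx => (hu x hx).differentiableAt (by norm_num)
  · exact fun x _ => (hw.differentiable (by norm_num)) x

lemma green1 (hv : ContDiff ℝ 2 v) (hc : HasCompactSupport v)
    (hu : ∀ x ∈ tsupport v, ContDiffAt ℝ 2 u x) :
    ∫ x, u x * lap v x = - ∫ x, gdot u v x := by
  have e1 : (fun x => u x * lap v x) = fun x => ∑ i, u x * pd i (pd i v) x := by
    ext x; rw [lap_eq_pd, Finset.mul_sum]
  have e2 : (fun x => gdot u v x) = fun x => ∑ i, pd i u x * pd i v x := rfl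
  rw [e1, e2, integral_finsetSum, integral_finsetSum, ← Finset.sum_neg_distrib]
  · refine Finset.sum_congr rfl fun i _ => ?_
    exact ibp i (pd_contDiff1 i hv) (hcs_pd i hc)
      fun x hx => (hu x (tsupport_pd i hx)).of_le (by norm_num)
  · intro i _
    refine int_mul_supp (pd_contDiff1 i hv).continuous (hcs_pd i hc) fun x hx => ?_
    exact (pd_diff (hu x (tsupport_pd i hx))).continuousAt
  · intro i _
    refine int_mul_supp (continuous_iff_continuousAt.2 fun x => pdpd_contAt i i hv.contDiffAt)
      (hcs_pd i (hcs_pd i hc)) fun x hx => ?_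
    exact (hu x (tsupport_pd i (tsupport_pd i hx))).continuousAt

lemma green2 (hv : ContDiff ℝ 2 v) (hc : HasCompactSupport v)
    (hu : ∀ x ∈ tsupport v, ContDiffAt ℝ 2 u x) :
    ∫ x, lap u x * v x = - ∫ x, gdot u v x := by
  have e1 : (fun x => lap u x * v x) = fun x => ∑ i, pd i (pd i u) x * v x := by
    ext x; rw [lap_eq_pd, Finset.sum_mul]
  have e2 : (fun x => gdot u v x) = fun x => ∑ i, pd i u x * pd i v x := rfl
  rw [e1, e2, integral_finsetSum, integral_finsetSum, ← Finset.sum_neg_distrib]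
  · refine Finset.sum_congr rfl fun i _ => ?_
    have := ibp (u := pd i u) i (hv.of_le (by norm_num)) hc fun x hx => pd_c1 (hu x hx)
    rw [this, neg_neg]
  · intro i _
    refine int_mul_supp (pd_contDiff1 i hv).continuous (hcs_pd i hc) fun x hx => ?_
    exact (pd_diff (hu x (tsupport_pd i hx))).continuousAt
  · intro i _
    exact int_mul_supp hv.continuous hc fun x hx => pdpd_contAt i i (hu x hx)

lemma green (hv : ContDiff ℝ 2 v) (hc : HasCompactSupport v)
    (hu : ∀ x ∈ tsupport v, ContDiffAt ℝ 2 u x) :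
    ∫ x, u x * lap v x = ∫ x, lap u x * v x := by
  rw [green1 hv hc hu, green2 hv hc hu]

end green

/-! ### one dimensional profiles -/

/-- Smooth convex approximation of the positive part: `0` below `α`, slope `1` above `β`. -/
def Gf (α β t : ℝ) : ℝ := ∫ s in α..t, Real.smoothTransition ((s - α) / (β - α))

section Gf
variable {α β : ℝ}

lemma Gf_integrand_cont : Continuous fun s => Real.smoothTransition ((s - α) / (β - α)) :=
  Real.smoothTransition.continuous.comp (by fun_prop)

lemma Gf_hasDeriv (t : ℝ) :
    HasDerivAt (Gf α β) (Real.smoothTransition ((t - α) / (β - α))) t :=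
  intervalIntegral.integral_hasDerivAt_right (Gf_integrand_cont.intervalIntegrable _ _)
    Gf_integrand_cont.stronglyMeasurable.stronglyMeasurableAtFilter
    Gf_integrand_cont.continuousAt

lemma Gf_deriv : deriv (Gf α β) = fun t => Real.smoothTransition ((t - α) / (β - α)) :=
  funext fun t => (Gf_hasDeriv t).deriv

lemma Gf_smooth : ContDiff ℝ (⊤ : ℕ∞) (Gf α β) := by
  rw [contDiff_infty_iff_deriv]
  refine ⟨fun t => (Gf_hasDeriv t).differentiableAt, ?_⟩
  rw [Gf_deriv]
  exact Real.smoothTransition.contDiff.comp (by fun_prop)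

lemma Gf_deriv_nonneg (t : ℝ) : 0 ≤ deriv (Gf α β) t := by
  rw [Gf_deriv]; exact Real.smoothTransition.nonneg _

lemma Gf_deriv_le_one (t : ℝ) : deriv (Gf α β) t ≤ 1 := by
  rw [Gf_deriv]; exact Real.smoothTransition.le_one _

lemma Gf_mono : Monotone (Gf α β) :=
  monotone_of_deriv_nonneg (Gf_smooth.differentiable (by simp)) Gf_deriv_nonneg

lemma Gf_deriv_mono (h : α < β) : Monotone (deriv (Gf α β)) := by
  rw [Gf_deriv]
  intro s t hst
  apply Real.smoothTransition.monotone
  have : 0 < β - α := by linarith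
  gcongr

lemma Gf_deriv2_nonneg (h : α < β) (t : ℝ) : 0 ≤ deriv (deriv (Gf α β)) t :=
  (Gf_deriv_mono h).deriv_nonneg

lemma Gf_deriv_zero (h : α < β) {t : ℝ} (ht : t ≤ α) : deriv (Gf α β) t = 0 := by
  rw [Gf_deriv]
  exact Real.smoothTransition.zero_of_nonpos (div_nonpos_of_nonpos_of_nonneg (by linarith) (by linarith))

lemma Gf_deriv_one (h : α < β) {t : ℝ} (ht : β ≤ t) : deriv (Gf α β) t = 1 := by
  rw [Gf_deriv]
  exact Real.smoothTransition.one_of_one_le ((one_le_div (by linarith)).2 (by linarith))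

lemma Gf_zero (h : α < β) {t : ℝ} (ht : t ≤ α) : Gf α β t = 0 := by
  unfold Gf
  rw [intervalIntegral.integral_congr (g := fun _ => (0:ℝ))]
  · simp
  · intro s hs
    rw [uIcc_of_ge ht] at hs
    exact Real.smoothTransition.zero_of_nonpos
      (div_nonpos_of_nonpos_of_nonneg (by linarith [hs.2]) (by linarith))

lemma Gf_nonneg (h : α < β) (t : ℝ) : 0 ≤ Gf α β t := by
  rcases le_total t α with h1 | h1
  · rw [Gf_zero h h1]
  · rw [← Gf_zero h (le_refl α)]; exact Gf_mono h1

/-- 1-Lipschitz monotone -/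
lemma Gf_sub_le {s t : ℝ} (hst : s ≤ t) : Gf α β t - Gf α β s ≤ t - s := by
  have := image_sub_le_mul_sub_of_deriv_le (f := Gf α β) (C := 1)
    (Gf_smooth.differentiable (by simp)) Gf_deriv_le_one hst
  linarith

lemma Gf_le (h : α < β) {t : ℝ} (ht : α ≤ t) : Gf α β t ≤ t - α := by
  have := Gf_sub_le (α := α) (β := β) ht
  rw [Gf_zero h (le_refl α)] at this; linarith

lemma Gf_le_pos (h : α < β) (hα : 0 ≤ α) (t : ℝ) : Gf α β t ≤ max t 0 := by
  rcases le_total t α with h1 | h1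
  · rw [Gf_zero h h1]; exact le_max_right _ _
  · exact (Gf_le h h1).trans ((by linarith : t - α ≤ t).trans (le_max_left _ _))

lemma Gf_affine (h : α < β) {t : ℝ} (ht : β ≤ t) : Gf α β t = Gf α β β + (t - β) := by
  unfold Gf
  rw [← intervalIntegral.integral_add_adjacent_intervals (b := β)
    (Gf_integrand_cont.intervalIntegrable _ _) (Gf_integrand_cont.intervalIntegrable _ _)]
  congr 1
  rw [intervalIntegral.integral_congr (g := fun _ => (1:ℝ))]
  · simp
  · intro s hs
    rw [uIcc_of_le ht] at hs
    exact Real.smoothTransition.one_of_one_le ((one_le_div (by linarith)).2 (by linarith [hs.1]))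

lemma Gf_ge (h : α < β) (t : ℝ) : t - β ≤ Gf α β t := by
  rcases le_total t β with h1 | h1
  · linarith [Gf_nonneg h t]
  · rw [Gf_affine h h1]; linarith [Gf_nonneg h β]

lemma Gf_deriv2_zero_low (h : α < β) {t : ℝ} (ht : t < α) : deriv (deriv (Gf α β)) t = 0 := by
  have : deriv (Gf α β) =ᶠ[𝓝 t] fun _ => 0 := by
    filter_upwards [Iio_mem_nhds ht] with s hs using Gf_deriv_zero h (le_of_lt hs)
  rw [this.deriv_eq]; simp

lemma Gf_deriv2_zero_high (h : α < β) {t : ℝ} (ht : β < t) : deriv (deriv (Gf α β)) t = 0 := by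
  have : deriv (Gf α β) =ᶠ[𝓝 t] fun _ => 1 := by
    filter_upwards [Ioi_mem_nhds ht] with s hs using Gf_deriv_one h (le_of_lt hs)
  rw [this.deriv_eq]; simp

lemma Gf_deriv_smooth : ContDiff ℝ (⊤ : ℕ∞) (deriv (Gf α β)) :=
  (contDiff_infty_iff_deriv.1 Gf_smooth).2

lemma Gf_deriv2_cont : Continuous (deriv (deriv (Gf α β))) :=
  ((contDiff_infty_iff_deriv.1 (Gf_deriv_smooth (α := α) (β := β))).2).continuous

lemma Gf_deriv2_integral (hα : 0 < α) (h : α < β) :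
    ∫ t in Ioi (0:ℝ), deriv (deriv (Gf α β)) t = 1 := by
  have h1 : ∫ t in Ioi (0:ℝ), deriv (deriv (Gf α β)) t
      = ∫ t in Ioc 0 (β + 1), deriv (deriv (Gf α β)) t := by
    refine setIntegral_eq_of_subset_of_forall_sdiff_eq_zero measurableSet_Ioi
      Ioc_subset_Ioi_self ?_ 
    rintro t ⟨h1, h2⟩
    refine Gf_deriv2_zero_high h ?_
    by_contra h3
    exact h2 ⟨h1, by linarith⟩
  rw [h1, ← intervalIntegral.integral_of_le (by linarith),
    intervalIntegral.integral_deriv_eq_sub (fun t _ => (Gf_deriv_smooth.differentiable (by simp)) t)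
      (Gf_deriv2_cont.intervalIntegrable _ _),
    Gf_deriv_one h (by linarith), Gf_deriv_zero h (by linarith)]
  simp

end Gf
end

section
lemma two_le_inf : (2 : WithTop ℕ∞) ≤ ((⊤ : ℕ∞) : WithTop ℕ∞) := by
  change ((2 : ℕ∞) : WithTop ℕ∞) ≤ _
  exact WithTop.coe_le_coe.2 le_top

/-- The fundamental solution `|x|^{-k}` in dimension `k+2`. -/
def tau {k : ℕ} (x : Eucl (k+2)) : ℝ := (‖x‖⁻¹) ^ k

/-- Squared gradient of tau. -/
def gt {k : ℕ} (x : Eucl (k+2)) : ℝ := (k:ℝ)^2 * (‖x‖⁻¹) ^ (2*k+2)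

/-- radial function with profile `J` in the variable tau -/
def rad {k : ℕ} (c : ℝ) (J : ℝ → ℝ) (x : Eucl (k+2)) : ℝ := if x = 0 then c else J (tau x)

section tau
variable {k : ℕ} {x : Eucl (k+2)}

lemma gt_nonneg (x : Eucl (k+2)) : 0 ≤ gt x := by unfold gt; positivity
lemma tau_nonneg (x : Eucl (k+2)) : 0 ≤ tau x := by unfold tau; positivity
lemma tau_pos (hx : x ≠ 0) : 0 < tau x := by
  unfold tau; have := norm_pos_iff.2 hx; positivity

lemma tau_eq (x : Eucl (k+2)) (hx : x ≠ 0) : tau x = (‖x - 0‖ ^ 2) ^ (-(k:ℝ)/2) := by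
  have := norm_pos_iff.2 hx
  unfold tau
  rw [sub_zero, ← Real.rpow_natCast (‖x‖) 2, ← Real.rpow_mul this.le, ← Real.rpow_natCast,
    Real.inv_rpow this.le, ← Real.rpow_neg this.le]
  congr 1; push_cast; ring

lemma tau_ev (hx : x ≠ 0) :
    (tau : Eucl (k+2) → ℝ) =ᶠ[𝓝 x] fun y => (fun t : ℝ => t ^ (-(k:ℝ)/2)) (‖y - 0‖ ^ 2) := by
  filter_upwards [isOpen_ne.mem_nhds hx] with y hy using tau_eq y hy

lemma sq_ne (hx : x ≠ 0) : ‖x - 0‖ ^ 2 ≠ 0 := by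
  rw [sub_zero]; have := norm_pos_iff.2 hx; positivity

lemma tau_smooth (hx : x ≠ 0) : ContDiffAt ℝ (⊤ : ℕ∞) (tau : Eucl (k+2) → ℝ) x := by
  refine ContDiffAt.congr_of_eventuallyEq ?_ (tau_ev hx)
  exact (Real.contDiffAt_rpow_const_of_ne (sq_ne hx)).comp x (sqd_smooth 0).contDiffAt

lemma deriv_rpow_ev {q t : ℝ} (ht : t ≠ 0) :
    deriv (fun t : ℝ => t ^ q) =ᶠ[𝓝 t] fun t => q * t ^ (q - 1) := by
  filter_upwards [isOpen_ne.mem_nhds ht] with s hs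
  exact (Real.hasDerivAt_rpow_const (Or.inl hs)).deriv

lemma deriv2_rpow {q t : ℝ} (ht : t ≠ 0) :
    deriv (deriv (fun t : ℝ => t ^ q)) t = q * ((q - 1) * t ^ (q - 1 - 1)) := by
  rw [(deriv_rpow_ev ht).deriv_eq]
  exact ((Real.hasDerivAt_rpow_const (Or.inl ht)).const_mul q).deriv

lemma lap_tau (hx : x ≠ 0) : lap (tau : Eucl (k+2) → ℝ) x = 0 := by
  rw [lap_congr (tau_ev hx), lap_comp (u := fun y : Eucl (k+2) => ‖y - 0‖ ^ 2)
    (g := fun t : ℝ => t ^ (-(k:ℝ)/2))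
    (Real.contDiffAt_rpow_const_of_ne (sq_ne hx))
    ((sqd_smooth 0).contDiffAt.of_le two_le_inf), lap_sqd, gsq_sqd,
    (deriv_rpow_ev (sq_ne hx)).eq_of_nhds, deriv2_rpow (sq_ne hx)]
  set t := ‖x - 0‖ ^ 2
  have ht : 0 < t := lt_of_le_of_ne (by positivity) (sq_ne hx).symm
  have : t ^ (-(k:ℝ)/2 - 1) = t ^ (-(k:ℝ)/2 - 1 - 1) * t := by
    rw [← Real.rpow_add_one ht.ne']; congr 1; ring
  rw [this]; push_cast; ring

lemma gsq_tau (hx : x ≠ 0) : gsq (tau : Eucl (k+2) → ℝ) x = gt x := by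
  rw [gsq_congr (tau_ev hx), gsq_comp (u := fun y : Eucl (k+2) => ‖y - 0‖ ^ 2)
    (g := fun t : ℝ => t ^ (-(k:ℝ)/2))
    ((Real.hasDerivAt_rpow_const (Or.inl (sq_ne hx))).differentiableAt)
    ((sqd_smooth 0).contDiffAt.differentiableAt (by simp)), gsq_sqd,
    (deriv_rpow_ev (sq_ne hx)).eq_of_nhds]
  have h := norm_pos_iff.2 hx
  rw [sub_zero]
  have : (‖x‖^2) ^ (-(k:ℝ)/2 - 1) = (‖x‖⁻¹) ^ (k+2) := by
    rw [← Real.rpow_natCast (‖x‖) 2, ← Real.rpow_mul h.le, ← Real.rpow_natCast (‖x‖⁻¹),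
      Real.inv_rpow h.le, ← Real.rpow_neg h.le]
    congr 1; push_cast; ring
  rw [this]; unfold gt
  have e : (‖x‖⁻¹) ^ (2*k+2) = ((‖x‖⁻¹) ^ (k+2))^2 * ‖x‖^2 := by
    rw [← pow_mul, show (k+2)*2 = (2*k+2) + 2 by ring, pow_add _ (2*k+2), mul_assoc, ← mul_pow,
      inv_mul_cancel₀ h.ne', one_pow, mul_one]
  rw [e]; ring

lemma tau_ge_iff {r : ℝ} (hr : 0 < r) (hk : 1 ≤ k) (hx : x ≠ 0) :
    (r⁻¹)^k ≤ tau x ↔ ‖x‖ ≤ r := by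
  have h := norm_pos_iff.2 hx
  unfold tau
  rw [pow_le_pow_iff_left₀ (by positivity) (by positivity) (by omega), inv_le_inv₀ hr h]

lemma tau_le_iff {r : ℝ} (hr : 0 < r) (hk : 1 ≤ k) (hx : x ≠ 0) :
    tau x ≤ (r⁻¹)^k ↔ r ≤ ‖x‖ := by
  have h := norm_pos_iff.2 hx
  unfold tau
  rw [pow_le_pow_iff_left₀ (by positivity) (by positivity) (by omega), inv_le_inv₀ h hr]

lemma tau_tendsto (hk : 1 ≤ k) (B : ℝ) : ∀ᶠ x in 𝓝 (0 : Eucl (k+2)), x ≠ 0 → B ≤ tau x := by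
  set B' := max B 1
  have : 0 < (B' )⁻¹ := by positivity
  filter_upwards [ball_mem_nhds (0:Eucl (k+2)) this] with x hx hx0
  rw [mem_ball_zero_iff] at hx
  have h := norm_pos_iff.2 hx0
  have h1 : B' ≤ ‖x‖⁻¹ := by rw [le_inv_comm₀ (by positivity) h]; exact hx.le
  calc B ≤ B' := le_max_left _ _
    _ = B' ^ 1 := (pow_one _).symm
    _ ≤ B' ^ k := pow_le_pow_right₀ (le_max_right _ _) hk
    _ ≤ _ := pow_le_pow_left₀ (by positivity) h1 k

variable {c B : ℝ} {J : ℝ → ℝ}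

lemma rad_ne (hx : x ≠ 0) : rad c J x = J (tau x) := by simp [rad, hx]

lemma rad_ev_ne (hx : x ≠ 0) : rad c J =ᶠ[𝓝 x] fun y => J (tau y) := by
  filter_upwards [isOpen_ne.mem_nhds hx] with y hy using rad_ne hy

lemma rad_ev_zero (hk : 1 ≤ k) (hJ : ∀ t ≥ B, J t = c) :
    (rad c J : Eucl (k+2) → ℝ) =ᶠ[𝓝 0] fun _ => c := by
  filter_upwards [tau_tendsto hk B] with y hy
  by_cases h : y = 0
  · simp [rad, h]
  · rw [rad_ne h, hJ _ (hy h)]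

lemma rad_smooth (hk : 1 ≤ k) (hs : ContDiff ℝ (⊤ : ℕ∞) J) (hJ : ∀ t ≥ B, J t = c) :
    ContDiff ℝ (⊤ : ℕ∞) (rad c J : Eucl (k+2) → ℝ) := by
  rw [contDiff_iff_contDiffAt]
  intro x
  by_cases hx : x = 0
  · rw [hx]; exact contDiffAt_const.congr_of_eventuallyEq (rad_ev_zero hk hJ)
  · exact (hs.contDiffAt.comp x (tau_smooth hx)).congr_of_eventuallyEq (rad_ev_ne hx)

lemma lap_rad (hk : 1 ≤ k) (hs : ContDiff ℝ (⊤ : ℕ∞) J) (hJ : ∀ t ≥ B, J t = c)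
    (x : Eucl (k+2)) : lap (rad c J) x = deriv (deriv J) (tau x) * gt x := by
  by_cases hx : x = 0
  · rw [hx, lap_congr (rad_ev_zero hk hJ), lap_const]; simp [gt]
  · rw [lap_congr (rad_ev_ne hx), lap_comp (u := tau) (hs.contDiffAt.of_le two_le_inf)
      ((tau_smooth hx).of_le two_le_inf), lap_tau hx, gsq_tau hx]
    ring

lemma gsq_rad (hk : 1 ≤ k) (hs : ContDiff ℝ (⊤ : ℕ∞) J) (hJ : ∀ t ≥ B, J t = c)
    (x : Eucl (k+2)) : gsq (rad c J) x = deriv J (tau x) ^ 2 * gt x := by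
  by_cases hx : x = 0
  · rw [hx, gsq_congr (rad_ev_zero hk hJ)]; simp [gt, gsq, pd_const]
  · rw [gsq_congr (rad_ev_ne hx), gsq_comp (u := tau) (hs.contDiffAt.differentiableAt (by simp))
      ((tau_smooth hx).differentiableAt (by simp)), gsq_tau hx]

lemma rad_eq_zero (hk : 1 ≤ k) {r : ℝ} (hr : 0 < r) (hJ0 : ∀ t ≤ (r⁻¹)^k, J t = 0) (hx : r ≤ ‖x‖) :
    rad c J x = 0 := by
  have hx0 : x ≠ 0 := norm_pos_iff.1 (hr.trans_le hx)
  rw [rad_ne hx0, hJ0 _ ((tau_le_iff hr hk hx0).2 hx)]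

lemma rad_tsupport (hk : 1 ≤ k) {r : ℝ} (hr : 0 < r) (hJ0 : ∀ t ≤ (r⁻¹)^k, J t = 0) :
    tsupport (rad c J : Eucl (k+2) → ℝ) ⊆ closedBall 0 r := by
  refine closure_minimal ?_ isClosed_closedBall
  intro x hx
  rw [mem_closedBall_zero_iff]
  by_contra h
  exact hx (rad_eq_zero hk hr hJ0 (not_le.1 h).le)

lemma rad_hcs (hk : 1 ≤ k) {r : ℝ} (hr : 0 < r) (hJ0 : ∀ t ≤ (r⁻¹)^k, J t = 0) :
    HasCompactSupport (rad c J : Eucl (k+2) → ℝ) :=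
  (isCompact_closedBall _ _).of_isClosed_subset (isClosed_tsupport _) (rad_tsupport hk hr hJ0)

/-- The normalising constant: `n |B_1| (n-2)`. -/
def kap (k : ℕ) : ℝ := (k+2 : ℝ) * volume.real (ball (0:Eucl (k+2)) 1) * k

lemma kap_pos (hk : 1 ≤ k) : 0 < kap k := by
  have : 0 < volume.real (ball (0:Eucl (k+2)) 1) :=
    ENNReal.toReal_pos (measure_ball_pos _ _ one_pos).ne' measure_ball_lt_top.ne
  have hk' : (0:ℝ) < k := by exact_mod_cast hk
  unfold kap; positivity

lemma polar_tau (hk : 1 ≤ k) (s : ℝ → ℝ) :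
    ∫ x : Eucl (k+2), s (tau x) * gt x = kap k * ∫ t in Ioi (0:ℝ), s t := by
  have hk' : (0:ℝ) < k := by exact_mod_cast hk
  have h := integral_fun_norm_addHaar (E := Eucl (k+2)) volume
    (fun r : ℝ => s ((r⁻¹)^k) * ((k:ℝ)^2 * (r⁻¹) ^ (2*k+2)))
  change ∫ x : Eucl (k+2), s (tau x) * gt x = _ at h
  rw [h, ← integral_comp_rpow_Ioi s (p := -(k:ℝ)) (by linarith)]
  simp only [finrank_euclideanSpace, Fintype.card_fin, smul_eq_mul, nsmul_eq_mul]
  have : ∫ y in Ioi (0:ℝ), y ^ (k + 2 - 1) * (s ((y⁻¹)^k) * ((k:ℝ)^2 * (y⁻¹) ^ (2*k+2)))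
      = k * ∫ x in Ioi (0:ℝ), |-(k:ℝ)| * x ^ (-(k:ℝ) - 1) * s (x ^ (-(k:ℝ))) := by
    rw [← integral_const_mul]
    refine setIntegral_congr_fun measurableSet_Ioi fun y hy => ?_
    have hy : 0 < y := hy
    have e1 : y ^ (-(k:ℝ)) = (y⁻¹)^k := by
      rw [Real.rpow_neg hy.le, Real.rpow_natCast, inv_pow]
    have e2 : y ^ (-(k:ℝ) - 1) = (y⁻¹)^(k+1) := by
      rw [show -(k:ℝ) - 1 = -((k+1 : ℕ):ℝ) by push_cast; ring, Real.rpow_neg hy.le,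
        Real.rpow_natCast, inv_pow]
    have e3 : y ^ (k + 2 - 1) * (y⁻¹) ^ (2*k+2) = (y⁻¹)^(k+1) := by
      rw [show k + 2 - 1 = k + 1 by omega, show 2*k+2 = (k+1) + (k+1) by ring, pow_add (y⁻¹),
        ← mul_assoc, ← mul_pow, mul_inv_cancel₀ hy.ne', one_pow, one_mul]
    rw [e1, e2, abs_neg, abs_of_pos hk', ← e3]; ring
  rw [this]; unfold kap; push_cast; ring

/-- integrals of powers of the norm over balls -/
lemma polar_ball (j : ℕ) (hj : j ≤ k+1) {R : ℝ} (hR : 0 ≤ R) :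
    IntegrableOn (fun x : Eucl (k+2) => (‖x‖⁻¹)^j) (ball 0 R) ∧
    ∫ x in ball (0:Eucl (k+2)) R, (‖x‖⁻¹)^j
      ≤ (k+2) * volume.real (ball (0:Eucl (k+2)) 1) * R^(k+2-j) := by
  have key : ∀ y ∈ Ioi (0:ℝ), y ^ (k+2-1) • (Iio R).indicator (fun r : ℝ => (r⁻¹)^j) y
      = (Ioo 0 R).indicator (fun r => r^(k+1-j)) y := by
    intro y hy
    have hy : 0 < y := hy
    by_cases h : y < R
    · rw [indicator_of_mem (show y ∈ Iio R from h), indicator_of_mem (show y ∈ Ioo 0 R from ⟨hy, h⟩)]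
      rw [show k+2-1 = (k+1-j) + j by omega, pow_add, smul_eq_mul, mul_assoc, ← mul_pow,
        mul_inv_cancel₀ hy.ne', one_pow, mul_one]
    · rw [indicator_of_notMem (show y ∉ Iio R from h), indicator_of_notMem (fun h' => h h'.2)]
      simp
  have eind : (fun x : Eucl (k+2) => (Iio R).indicator (fun r : ℝ => (r⁻¹)^j) ‖x‖)
      = (ball 0 R).indicator (fun x : Eucl (k+2) => (‖x‖⁻¹)^j) := by
    ext x; simp [indicator]
  have hintg : IntegrableOn ((Ioo 0 R).indicator (fun r => r^(k+1-j))) (Ioi 0) := by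
    rw [integrableOn_indicator_iff measurableSet_Ioo]
    have : IntegrableOn (fun r:ℝ => r^(k+1-j)) (Icc 0 R) :=
      (continuous_pow _).continuousOn.integrableOn_Icc
    exact this.mono_set (fun x hx => ⟨hx.1.1.le, hx.1.2.le⟩)
  constructor
  · rw [← integrable_indicator_iff measurableSet_ball, ← eind, integrable_fun_norm_addHaar]
    simp only [finrank_euclideanSpace, Fintype.card_fin]
    exact (integrableOn_congr_fun key measurableSet_Ioi).2 hintg
  · rw [← integral_indicator measurableSet_ball, ← eind, integral_fun_norm_addHaar]
    simp only [finrank_euclideanSpace, Fintype.card_fin]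
    rw [setIntegral_congr_fun measurableSet_Ioi key, setIntegral_indicator measurableSet_Ioo,
      show Ioi (0:ℝ) ∩ Ioo 0 R = Ioo 0 R from inter_eq_right.2 (fun x hx => hx.1),
      nsmul_eq_mul, smul_eq_mul, mul_assoc]
    push_cast
    gcongr
    calc ∫ r in Ioo 0 R, r^(k+1-j) ≤ ∫ r in Ioo 0 R, R^(k+1-j) := by
          refine setIntegral_mono_on ?_ (by simp) measurableSet_Ioo
            fun r hr => pow_le_pow_left₀ hr.1.le hr.2.le _
          exact ((continuous_pow _).continuousOn.integrableOn_Icc).mono_set Ioo_subset_Icc_self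
      _ = R^(k+2-j) := by
          rw [show k+2-j = (k+1-j)+1 by omega]
          simp [hR, pow_succ, mul_comm]

end tau
end

section
/-- Trapezoidal profile. -/
def Jt (α β γ δ t : ℝ) : ℝ := Gf α β t - Gf γ δ t

section Jt
variable {α β γ δ t : ℝ}

lemma Jt_smooth : ContDiff ℝ (⊤ : ℕ∞) (Jt α β γ δ) := Gf_smooth.sub Gf_smooth

lemma Jt_deriv (t : ℝ) : deriv (Jt α β γ δ) t = deriv (Gf α β) t - deriv (Gf γ δ) t := by
  unfold Jt
  exact deriv_fun_sub (Gf_smooth.differentiable (by simp) t) (Gf_smooth.differentiable (by simp) t)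

lemma Jt_deriv2 (t : ℝ) : deriv (deriv (Jt α β γ δ)) t
    = deriv (deriv (Gf α β)) t - deriv (deriv (Gf γ δ)) t := by
  rw [show deriv (Jt α β γ δ) = fun t => deriv (Gf α β) t - deriv (Gf γ δ) t from funext Jt_deriv]
  exact deriv_fun_sub (Gf_deriv_smooth.differentiable (by simp) t)
    (Gf_deriv_smooth.differentiable (by simp) t)

lemma Jt_deriv_cont : Continuous (deriv (Jt α β γ δ)) :=
  ((contDiff_infty_iff_deriv.1 (Jt_smooth (α := α) (β := β) (γ := γ) (δ := δ))).2).continuous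

lemma Jt_zero (h1 : α < β) (h2 : β ≤ γ) (h3 : γ < δ) (ht : t ≤ α) : Jt α β γ δ t = 0 := by
  unfold Jt; rw [Gf_zero h1 ht, Gf_zero h3 (by linarith)]; simp

lemma Jt_const (h1 : α < β) (h2 : β ≤ γ) (h3 : γ < δ) (ht : δ ≤ t) :
    Jt α β γ δ t = Jt α β γ δ δ := by
  unfold Jt; rw [Gf_affine h1 (by linarith : β ≤ t), Gf_affine h1 (by linarith : β ≤ δ),
    Gf_affine h3 ht]; ring

lemma Jt_deriv_nonneg (h1 : α < β) (h2 : β ≤ γ) (h3 : γ < δ) (t : ℝ) :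
    0 ≤ deriv (Jt α β γ δ) t := by
  rw [Jt_deriv]
  rcases le_total t γ with h | h
  · rw [Gf_deriv_zero h3 h]; linarith [Gf_deriv_nonneg (α := α) (β := β) t]
  · rw [Gf_deriv_one h1 (h2.trans h)]; linarith [Gf_deriv_le_one (α := γ) (β := δ) t]

lemma Jt_deriv_le_one (t : ℝ) : deriv (Jt α β γ δ) t ≤ 1 := by
  rw [Jt_deriv]
  linarith [Gf_deriv_nonneg (α := γ) (β := δ) t, Gf_deriv_le_one (α := α) (β := β) t]

lemma Jt_deriv_zero (h1 : α < β) (h2 : β ≤ γ) (h3 : γ < δ) (ht : t ∉ Icc α δ) :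
    deriv (Jt α β γ δ) t = 0 := by
  rw [Jt_deriv]
  rcases lt_or_ge t α with h | h
  · rw [Gf_deriv_zero h1 h.le, Gf_deriv_zero h3 (by linarith)]; simp
  · have : δ < t := by by_contra h'; exact ht ⟨h, not_lt.1 h'⟩
    rw [Gf_deriv_one h1 (by linarith), Gf_deriv_one h3 this.le]; simp

lemma Jt_mono (h1 : α < β) (h2 : β ≤ γ) (h3 : γ < δ) : Monotone (Jt α β γ δ) :=
  monotone_of_deriv_nonneg (Jt_smooth.differentiable (by simp)) (Jt_deriv_nonneg h1 h2 h3)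

lemma Jt_nonneg (h1 : α < β) (h2 : β ≤ γ) (h3 : γ < δ) (t : ℝ) : 0 ≤ Jt α β γ δ t := by
  rcases le_total t α with h | h
  · rw [Jt_zero h1 h2 h3 h]
  · rw [← Jt_zero h1 h2 h3 (le_refl α)]; exact Jt_mono h1 h2 h3 h

lemma Jt_le (h1 : α < β) (h2 : β ≤ γ) (h3 : γ < δ) (t : ℝ) : Jt α β γ δ t ≤ Jt α β γ δ δ := by
  rcases le_total t δ with h | h
  · exact Jt_mono h1 h2 h3 h
  · rw [Jt_const h1 h2 h3 h]

lemma Jt_top_ge (h1 : α < β) (h2 : β ≤ γ) (h3 : γ < δ) : γ - β ≤ Jt α β γ δ δ := by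
  unfold Jt
  have := Gf_ge h1 δ
  have := Gf_le h3 h3.le
  linarith

lemma Jt_top_le (h1 : α < β) (h2 : β ≤ γ) (h3 : γ < δ) : Jt α β γ δ δ ≤ δ - α := by
  unfold Jt
  have := Gf_le h1 (by linarith : α ≤ δ)
  have := Gf_nonneg h3 δ
  linarith

lemma Jt_le_self (h1 : α < β) (h2 : β ≤ γ) (h3 : γ < δ) (hα : 0 ≤ α) (ht : 0 ≤ t) :
    Jt α β γ δ t ≤ t := by
  unfold Jt
  have := Gf_le_pos h1 hα t
  rw [max_eq_left ht] at this
  linarith [Gf_nonneg h3 t]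

lemma Jt_sq_integral (h1 : α < β) (h2 : β ≤ γ) (h3 : γ < δ) (hα : 0 < α) :
    ∫ t in Ioi (0:ℝ), deriv (Jt α β γ δ) t ^ 2 ≤ δ - α := by
  have e : ∫ t in Ioi (0:ℝ), deriv (Jt α β γ δ) t ^ 2
      = ∫ t in Icc α δ, deriv (Jt α β γ δ) t ^ 2 := by
    refine setIntegral_eq_of_subset_of_forall_sdiff_eq_zero measurableSet_Ioi
      (fun t ht => hα.trans_le ht.1) ?_
    rintro t ⟨_, ht⟩
    rw [Jt_deriv_zero h1 h2 h3 ht]; simp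
  rw [e]
  calc ∫ t in Icc α δ, deriv (Jt α β γ δ) t ^ 2 ≤ ∫ t in Icc α δ, (1:ℝ) := by
        refine setIntegral_mono_on ?_ (by simp) measurableSet_Icc fun t _ => ?_
        · exact (Jt_deriv_cont.pow 2).continuousOn.integrableOn_Icc
        · have a := Jt_deriv_nonneg h1 h2 h3 t
          have b := Jt_deriv_le_one (α := α) (β := β) (γ := γ) (δ := δ) t
          nlinarith
    _ = δ - α := by
        simp; linarith

end Jt

lemma gsq_cont {n : ℕ} {v : Eucl n → ℝ} (hv : ContDiff ℝ 2 v) : Continuous (gsq v) := by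
  unfold gsq
  exact continuous_finsetSum _ fun i _ => (pd_contDiff1 i hv).continuous.pow 2

lemma gsq_hcs {n : ℕ} {v : Eucl n → ℝ} (hc : HasCompactSupport v) : HasCompactSupport (gsq v) := by
  refine hc.mono' ?_
  intro x hx
  by_contra h
  apply hx
  simp only [gsq]
  refine Finset.sum_eq_zero fun i _ => ?_
  have := image_eq_zero_of_notMem_tsupport (fun h' => h (tsupport_pd i h'))
  rw [this]; simp

lemma gdot_cont {n : ℕ} {u v : Eucl n → ℝ} (hu : ContDiff ℝ 2 u) (hv : ContDiff ℝ 2 v) :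
    Continuous (gdot u v) := by
  unfold gdot
  exact continuous_finsetSum _ fun i _ =>
    (pd_contDiff1 i hu).continuous.mul (pd_contDiff1 i hv).continuous

lemma gdot_hcs {n : ℕ} {u v : Eucl n → ℝ} (hc : HasCompactSupport v) :
    HasCompactSupport (gdot u v) := by
  refine hc.mono' ?_
  intro x hx
  by_contra h
  apply hx
  simp only [gdot]
  refine Finset.sum_eq_zero fun i _ => ?_
  have := image_eq_zero_of_notMem_tsupport (fun h' => h (tsupport_pd i h'))
  rw [this]; simp

section cap
variable {k : ℕ}

lemma cap_lower (hk : 1 ≤ k) {r : ℝ} (hr : 0 < r) {v : Eucl (k+2) → ℝ}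
    (hv : ContDiff ℝ (⊤ : ℕ∞) v) (hc : HasCompactSupport v)
    (h1 : ∀ x ∈ closedBall 0 r, 1 ≤ v x) {s : ℝ} (hs : 0 < s) :
    kap k * r^k / (1+s) ≤ ∫ x, ‖fderiv ℝ v x‖^2 := by
  have hkp := kap_pos hk
  obtain ⟨R, hRr, hR⟩ : ∃ R, r ≤ R ∧ ∀ x : Eucl (k+2), R ≤ ‖x‖ → v x = 0 := by
    obtain ⟨R, hR⟩ := hc.isCompact.isBounded.subset_ball (0 : Eucl (k+2))
    refine ⟨max r R, le_max_left _ _, fun x hx => ?_⟩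
    refine image_eq_zero_of_notMem_tsupport fun h => ?_
    have := mem_ball_zero_iff.1 (hR h)
    linarith [le_max_right r R]
  have hR0 : 0 < R := hr.trans_le hRr
  set b := (r⁻¹)^k
  have hb : 0 < b := by positivity
  set α := (R⁻¹)^k/2
  have hα : 0 < α := by positivity
  have hab : 2 * α ≤ b := by
    have : 2 * α = (R⁻¹)^k := by simp only [α]; ring
    rw [this]; simp only [b]; gcongr
  have l1 : α < 2 * α := by linarith
  have l3 : b < (1+s)*b := by nlinarith
  set J := Jt α (2*α) b ((1+s)*b)
  set h : Eucl (k+2) → ℝ := rad (J ((1+s)*b)) J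
  have hJc : ∀ t ≥ (1+s)*b, J t = J ((1+s)*b) := fun t ht => Jt_const l1 hab l3 ht
  have hh : ContDiff ℝ (⊤ : ℕ∞) h := rad_smooth hk Jt_smooth hJc
  have hhc : HasCompactSupport h := by
    refine rad_hcs hk (r := 2 * R) (by linarith) fun t ht => Jt_zero l1 hab l3 (ht.trans ?_)
    simp only [α]
    rw [mul_inv, mul_pow, div_eq_inv_mul]
    gcongr
    calc ((2:ℝ)⁻¹)^k ≤ (2⁻¹)^1 := pow_le_pow_of_le_one (by norm_num) (by norm_num) hk
      _ = 2⁻¹ := by norm_num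
  have g1 := green1 (u := v) (hh.of_le two_le_inf) hhc fun x _ => hv.contDiffAt.of_le two_le_inf
  have hd : kap k ≤ ∫ x, gdot v h x := by
    have e : ∫ x, gdot v h x = ∫ x, - (v x * lap h x) := by
      rw [integral_neg, g1]; simp
    rw [e, ← mul_one (kap k), ← Gf_deriv2_integral hb l3, ← polar_tau hk]
    refine integral_mono_of_nonneg ?_ ?_ ?_
    · exact Eventually.of_forall fun x => mul_nonneg (Gf_deriv2_nonneg l3 _) (gt_nonneg x)
    · refine (Continuous.mul hv.continuous (lap_cont (hh.of_le two_le_inf))).neg.integrable_of_hasCompactSupport ?_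
      exact ((hcs_lap hhc).mul_left).neg
    · refine Eventually.of_forall fun x => ?_
      change _ ≤ - (v x * lap h x)
      rw [lap_rad hk Jt_smooth hJc, Jt_deriv2]
      by_cases hx : x = 0
      · simp [hx, gt]
      have p1 : v x * deriv (deriv (Gf α (2*α))) (tau x) = 0 := by
        rcases lt_or_ge (2*α) (tau x) with h2 | h2
        · rw [Gf_deriv2_zero_high l1 h2]; simp
        · have : 2 * α = (R⁻¹)^k := by simp only [α]; ring
          rw [this, tau_le_iff hR0 hk hx] at h2
          rw [hR x h2]; simp
      have p2 : deriv (deriv (Gf b ((1+s)*b))) (tau x) ≤ v x * deriv (deriv (Gf b ((1+s)*b))) (tau x) := by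
        rcases lt_or_ge (tau x) b with h2 | h2
        · rw [Gf_deriv2_zero_low l3 h2]; simp
        · have := h1 x (mem_closedBall_zero_iff.2 ((tau_ge_iff hr hk hx).1 h2))
          nlinarith [Gf_deriv2_nonneg l3 (tau x)]
      have : -(v x * ((deriv (deriv (Gf α (2*α))) (tau x) - deriv (deriv (Gf b ((1+s)*b))) (tau x)) * gt x))
        = v x * deriv (deriv (Gf b ((1+s)*b))) (tau x) * gt x := by
        linear_combination (- gt x) * p1
      rw [this]
      exact mul_le_mul_of_nonneg_right p2 (gt_nonneg x)
  have hq : ∫ x, gsq h x ≤ kap k * ((1+s)*b) := by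
    have : (fun x => gsq h x) = fun x => (fun t => deriv J t ^ 2) (tau x) * gt x := by
      ext x; exact gsq_rad hk Jt_smooth hJc x
    rw [this, polar_tau hk (fun t => deriv J t ^ 2)]
    have := Jt_sq_integral l1 hab l3 hα
    gcongr
    change ∫ t in Ioi (0:ℝ), deriv J t ^ 2 ≤ _
    linarith
  set t := ((1+s)*b)⁻¹
  have ht : 0 < t := by positivity
  have hi1 : Integrable (gdot v h) :=
    (gdot_cont (hv.of_le two_le_inf) (hh.of_le two_le_inf)).integrable_of_hasCompactSupport
      (gdot_hcs hhc)
  have hi2 : Integrable (gsq h) :=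
    (gsq_cont (hh.of_le two_le_inf)).integrable_of_hasCompactSupport (gsq_hcs hhc)
  have hi3 : Integrable (gsq v) :=
    (gsq_cont (hv.of_le two_le_inf)).integrable_of_hasCompactSupport (gsq_hcs hc)
  have key : ∫ x, (2 * t * gdot v h x - t^2 * gsq h x) ≤ ∫ x, gsq v x :=
    integral_mono ((hi1.const_mul _).sub (hi2.const_mul _)) hi3 fun x => gdot_le v h x t
  rw [integral_sub (hi1.const_mul _) (hi2.const_mul _), integral_const_mul, integral_const_mul] at key
  simp only [norm_fderiv_sq]
  refine le_trans ?_ key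
  have e1 : kap k * r^k / (1+s) = kap k * t := by
    simp only [t, b, inv_pow]
    field_simp
  have e2 : t^2 * (kap k * ((1+s)*b)) = kap k * t := by
    simp only [t]; field_simp
  have m1 := mul_le_mul_of_nonneg_left hd (by positivity : 0 ≤ 2 * t)
  have m2 := mul_le_mul_of_nonneg_left hq (by positivity : 0 ≤ t^2)
  rw [e1]; rw [e2] at m2
  linarith

lemma cap_upper (hk : 1 ≤ k) {r : ℝ} (hr : 0 < r) {s : ℝ} (hs : 0 < s) (hs1 : s < 1/4) :
    ∃ v : Eucl (k+2) → ℝ, ContDiff ℝ (⊤ : ℕ∞) v ∧ HasCompactSupport v ∧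
      (∀ x ∈ closedBall 0 r, 1 ≤ v x) ∧
      ∫ x, ‖fderiv ℝ v x‖^2 ≤ kap k * r^k / (1-3*s)^2 := by
  have hkp := kap_pos hk
  set b := (r⁻¹)^k
  have hb : 0 < b := by positivity
  have l1 : s*b < 2*s*b := by nlinarith
  have l2 : 2*s*b ≤ (1-s)*b := by nlinarith
  have l3 : (1-s)*b < b := by nlinarith
  set J := Jt (s*b) (2*s*b) ((1-s)*b) b
  set c := J b
  have hc : (1-3*s)*b ≤ c := by
    have : (1-s)*b - 2*s*b ≤ c := Jt_top_ge l1 l2 l3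
    linarith
  have h3 : 0 < (1-3*s)*b := by apply mul_pos _ hb; linarith
  have hc0 : 0 < c := by linarith
  have hJc : ∀ t ≥ b, J t = c := fun t ht => Jt_const l1 l2 l3 ht
  set h : Eucl (k+2) → ℝ := rad c J
  have hh : ContDiff ℝ (⊤ : ℕ∞) h := rad_smooth hk Jt_smooth hJc
  have hhc : HasCompactSupport h := by
    refine rad_hcs hk (r := r / s) (by positivity) fun t ht => Jt_zero l1 l2 l3 (ht.trans ?_)
    simp only [b]
    rw [inv_div, div_eq_mul_inv, mul_pow]
    gcongr
    calc s^k ≤ s^1 := pow_le_pow_of_le_one hs.le (by linarith) hk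
      _ = s := by norm_num
  refine ⟨fun x => c⁻¹ * h x, contDiff_const.mul hh, hhc.mul_left, ?_, ?_⟩
  · intro x hx
    have : h x = c := by
      by_cases hx0 : x = 0
      · simp [h, rad, hx0]
      · simp only [h]
        rw [rad_ne hx0]
        exact hJc _ ((tau_ge_iff hr hk hx0).2 (mem_closedBall_zero_iff.1 hx))
    change 1 ≤ c⁻¹ * h x
    rw [this, inv_mul_cancel₀ hc0.ne']
  · simp only [norm_fderiv_sq]
    have e : ∀ x, gsq (fun x => c⁻¹ * h x) x = (c⁻¹)^2 * gsq h x := by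
      intro x
      simp only [gsq, Finset.mul_sum]
      refine Finset.sum_congr rfl fun i _ => ?_
      rw [pd_const_mul _ (hh.differentiable (by simp) x)]; ring
    simp only [e]
    rw [integral_const_mul]
    have hq : ∫ x, gsq h x ≤ kap k * b := by
      have : (fun x => gsq h x) = fun x => (fun t => deriv J t ^ 2) (tau x) * gt x := by
        ext x; exact gsq_rad hk Jt_smooth hJc x
      rw [this, polar_tau hk (fun t => deriv J t ^ 2)]
      have := Jt_sq_integral l1 l2 l3 (by positivity)
      gcongr
      change ∫ t in Ioi (0:ℝ), deriv J t ^ 2 ≤ _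
      nlinarith
    calc (c⁻¹)^2 * ∫ x, gsq h x ≤ (((1-3*s)*b)⁻¹)^2 * (kap k * b) := by
          gcongr
          exact integral_nonneg fun x => gsq_nonneg _ _
      _ = kap k * r^k / (1-3*s)^2 := by
          have : 0 < 1 - 3*s := by linarith
          simp only [b, inv_pow]; field_simp

lemma capacity_eq (hk : 1 ≤ k) {r : ℝ} (hr : 0 < r) :
    capacity (k+2) (closedBall 0 r) = kap k * r^k := by
  unfold capacity
  set S := {c : ℝ | ∃ v : Eucl (k+2) → ℝ, ContDiff ℝ (⊤ : ℕ∞) v ∧ HasCompactSupport v ∧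
    (∀ x ∈ closedBall 0 r, 1 ≤ v x) ∧ c = ∫ x, ‖fderiv ℝ v x‖ ^ 2}
  have hlow : ∀ c ∈ S, kap k * r^k ≤ c := by
    rintro c ⟨v, h1, h2, h3, rfl⟩
    have hl : Tendsto (fun s : ℝ => kap k * r^k / (1+s)) (𝓝[>] 0) (𝓝 (kap k * r^k / (1+0))) := by
      apply tendsto_nhdsWithin_of_tendsto_nhds
      exact (ContinuousAt.div continuousAt_const (by fun_prop) (by norm_num) : ContinuousAt (fun s : ℝ => kap k * r^k / (1+s)) 0)
    rw [add_zero, div_one] at hl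
    refine le_of_tendsto hl ?_
    filter_upwards [self_mem_nhdsWithin] with s hs
    exact cap_lower hk hr h1 h2 h3 hs
  have hup : ∀ s : ℝ, 0 < s → s < 1/4 → sInf S ≤ kap k * r^k / (1-3*s)^2 := by
    intro s h1 h2
    obtain ⟨v, a1, a2, a3, a4⟩ := cap_upper (k := k) hk hr h1 h2
    exact (csInf_le ⟨_, hlow⟩ ⟨v, a1, a2, a3, rfl⟩).trans a4
  apply le_antisymm
  · have hl : Tendsto (fun s : ℝ => kap k * r^k / (1-3*s)^2) (𝓝[>] 0) (𝓝 (kap k * r^k / (1-3*0)^2)) := by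
      apply tendsto_nhdsWithin_of_tendsto_nhds
      exact (ContinuousAt.div continuousAt_const (by fun_prop) (by norm_num) : ContinuousAt (fun s : ℝ => kap k * r^k / (1-3*s)^2) 0)
    norm_num at hl
    refine ge_of_tendsto hl ?_
    filter_upwards [Ioo_mem_nhdsGT (by norm_num : (0:ℝ) < 1/4)] with s hs
    exact hup s hs.1 hs.2
  · refine le_csInf ?_ hlow
    obtain ⟨v, a1, a2, a3, a4⟩ := cap_upper (k := k) hk hr (s := 1/8) (by norm_num) (by norm_num)
    exact ⟨_, v, a1, a2, a3, rfl⟩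

end cap
end

section
/-- averaging kernel of radius `r` -/
def kern {k : ℕ} (r : ℝ) (x : Eucl (k+2)) : ℝ :=
  deriv (deriv (Gf ((r⁻¹)^k) (2*(r⁻¹)^k))) (tau x) * gt x

/-- geometric constant -/
def Cb (k : ℕ) : ℝ := (k+2) * volume.real (ball (0:Eucl (k+2)) 1)

section smv
variable {k : ℕ}

lemma Cb_nonneg : 0 ≤ Cb k := by unfold Cb; positivity

lemma rk_lt {r : ℝ} (hr : 0 < r) : (r⁻¹)^k < 2*(r⁻¹)^k := by
  have : 0 < (r⁻¹)^k := by positivity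
  linarith

lemma ker_nonneg {r : ℝ} (hr : 0 < r) (x : Eucl (k+2)) : 0 ≤ kern r x :=
  mul_nonneg (Gf_deriv2_nonneg (rk_lt hr) _) (gt_nonneg x)

lemma ker_zero (hk : 1 ≤ k) {r : ℝ} (hr : 0 < r) {x : Eucl (k+2)} (hx : r < ‖x‖) :
    kern r x = 0 := by
  have hx0 : x ≠ 0 := norm_pos_iff.1 (hr.trans hx)
  unfold kern
  rw [Gf_deriv2_zero_low (rk_lt hr), zero_mul]
  by_contra h
  exact absurd ((tau_ge_iff hr hk hx0).1 (not_lt.1 h)) (not_le.2 hx)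

lemma gt_contAt {x : Eucl (k+2)} (hx : x ≠ 0) : ContinuousAt (gt : Eucl (k+2) → ℝ) x := by
  unfold gt
  exact continuousAt_const.mul ((continuous_norm.continuousAt.inv₀ (norm_ne_zero_iff.2 hx)).pow _)

lemma tau_gt_cont (hk : 1 ≤ k) {s : ℝ → ℝ} (hs : Continuous s) {B : ℝ} (hB : ∀ t ≥ B, s t = 0) :
    Continuous (fun x : Eucl (k+2) => s (tau x) * gt x) := by
  rw [continuous_iff_continuousAt]
  intro x
  by_cases hx : x = 0
  · have : (fun x : Eucl (k+2) => s (tau x) * gt x) =ᶠ[𝓝 x] fun _ => 0 := by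
      rw [hx]
      filter_upwards [tau_tendsto hk B] with y hy
      by_cases h : y = 0
      · simp [h, gt]
      · rw [hB _ (hy h), zero_mul]
    exact continuousAt_const.congr this.symm
  · exact (hs.continuousAt.comp (tau_smooth hx).continuousAt).mul (gt_contAt hx)

lemma ker_cont (hk : 1 ≤ k) {r : ℝ} (hr : 0 < r) : Continuous (kern r : Eucl (k+2) → ℝ) :=
  tau_gt_cont hk Gf_deriv2_cont (B := 2*(r⁻¹)^k + 1) fun t ht =>
    Gf_deriv2_zero_high (rk_lt hr) (by linarith)

lemma ker_tsupport (hk : 1 ≤ k) {r : ℝ} (hr : 0 < r) (x : Eucl (k+2)) :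
    tsupport (fun y => kern r (y - x)) ⊆ closedBall x r := by
  refine closure_minimal ?_ isClosed_closedBall
  intro y hy
  rw [mem_closedBall, dist_eq_norm]
  by_contra h
  exact hy (ker_zero hk hr (not_le.1 h))

lemma ker_hcs (hk : 1 ≤ k) {r : ℝ} (hr : 0 < r) (x : Eucl (k+2)) :
    HasCompactSupport (fun y => kern r (y - x)) :=
  (isCompact_closedBall _ _).of_isClosed_subset (isClosed_tsupport _) (ker_tsupport hk hr x)

lemma ker_sub_cont (hk : 1 ≤ k) {r : ℝ} (hr : 0 < r) (x : Eucl (k+2)) :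
    Continuous (fun y => kern r (y - x)) := (ker_cont hk hr).comp (by fun_prop)

lemma ker_integral (hk : 1 ≤ k) {r : ℝ} (hr : 0 < r) (x : Eucl (k+2)) :
    ∫ y, kern r (y - x) = kap k := by
  rw [integral_sub_right_eq_self (fun y => kern r y) x]
  unfold kern
  rw [polar_tau hk (deriv (deriv (Gf ((r⁻¹)^k) (2*(r⁻¹)^k)))),
    Gf_deriv2_integral (by positivity) (rk_lt hr), mul_one]

lemma smv (hk : 1 ≤ k) {r K : ℝ} (hr : 0 < r) (hK : 0 ≤ K) {v : Eucl (k+2) → ℝ} {x : Eucl (k+2)}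
    (hc : ∀ y ∈ closedBall x r, ContinuousAt v y)
    (hv : ∀ y ∈ closedBall x r, 0 < v y → ContDiffAt ℝ 2 v y ∧ -K ≤ lap v y) :
    kap k * max (v x) 0 ≤ (∫ y, max (v y) 0 * kern r (y - x)) + K * (Cb k * r^2) := by
  have hkp := kap_pos hk
  have hposc : ∀ y ∈ closedBall x r, ContinuousAt (fun y => max (v y) 0) y :=
    fun y hy => (hc y hy).max continuousAt_const
  have hmain : ∀ η > 0, kap k * (max (v x) 0 - 3*η) ≤
      (∫ y, max (v y) 0 * kern r (y - x)) + K * (Cb k * r^2) := by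
    intro η hη
    have hη2 : η < 2*η := by linarith
    set w : Eucl (k+2) → ℝ := fun y => Gf η (2*η) (v y)
    have hwc : ∀ y ∈ closedBall x r, ContDiffAt ℝ 2 w y ∧ -K ≤ lap w y := by
      intro y hy
      by_cases hvy : 0 < v y
      · obtain ⟨h1, h2⟩ := hv y hy hvy
        have hg : ContDiffAt ℝ 2 (Gf η (2*η)) (v y) := Gf_smooth.contDiffAt.of_le two_le_inf
        refine ⟨hg.comp y h1, ?_⟩
        rw [lap_comp hg h1]
        have a1 := Gf_deriv_nonneg (α := η) (β := 2*η) (v y)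
        have a2 := Gf_deriv_le_one (α := η) (β := 2*η) (v y)
        have a3 := mul_nonneg (Gf_deriv2_nonneg hη2 (v y)) (gsq_nonneg v y)
        nlinarith
      · have : w =ᶠ[𝓝 y] fun _ => 0 := by
          have : ∀ᶠ z in 𝓝 y, v z < η := (hc y hy).eventually_lt_const (by linarith)
          filter_upwards [this] with z hz using Gf_zero hη2 hz.le
        refine ⟨contDiffAt_const.congr_of_eventuallyEq this, ?_⟩
        rw [lap_congr this, lap_const]; linarith
    have hwle : ∀ y, w y ≤ max (v y) 0 := fun y => Gf_le_pos hη2 hη.le _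
    have hw0 : ∀ y, 0 ≤ w y := fun y => Gf_nonneg hη2 _
    have hwx : max (v x) 0 - 2*η ≤ w x := by
      rcases le_total (v x) 0 with h | h
      · rw [max_eq_right h]; linarith [hw0 x]
      · rw [max_eq_left h]; exact Gf_ge hη2 _
    have hxx : x ∈ closedBall x r := mem_closedBall_self hr.le
    obtain ⟨d, hd0, hd⟩ : ∃ d > 0, ∀ y ∈ closedBall x d, w x - η ≤ w y := by
      have h1 : ∀ᶠ y in 𝓝 x, w x - η < w y :=
        (hwc x hxx).1.continuousAt.eventually_const_lt (by linarith)
      obtain ⟨d, hd, h2⟩ := Metric.nhds_basis_closedBall.eventually_iff.1 h1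
      exact ⟨d, hd, fun y hy => (h2 hy).le⟩
    set δ := min d (r/2)
    have hδ : 0 < δ := lt_min hd0 (by linarith)
    set α := (r⁻¹)^k
    set γ := (δ⁻¹)^k
    have hα : 0 < α := by positivity
    have hγ : 0 < γ := by positivity
    have l1 : α < 2*α := rk_lt hr
    have l3 : γ < 2*γ := rk_lt hδ
    have l2 : 2*α ≤ γ := by
      have : δ ≤ r/2 := min_le_right _ _
      calc 2*α = 2^1 * α := by norm_num
        _ ≤ 2^k * α := by gcongr; norm_num
        _ = ((r/2)⁻¹)^k := by rw [inv_div, div_eq_mul_inv, mul_pow]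
        _ ≤ γ := by simp only [γ]; gcongr
    set J := Jt α (2*α) γ (2*γ)
    have hJc : ∀ t ≥ 2*γ, J t = J (2*γ) := fun t ht => Jt_const l1 l2 l3 ht
    set h0 : Eucl (k+2) → ℝ := rad (J (2*γ)) J
    have hh0 : ContDiff ℝ (⊤ : ℕ∞) h0 := rad_smooth hk Jt_smooth hJc
    set h : Eucl (k+2) → ℝ := fun y => h0 (y - x)
    have hh : ContDiff ℝ 2 h := (hh0.comp (contDiff_id.sub contDiff_const)).of_le two_le_inf
    have hzero : ∀ y, r ≤ ‖y - x‖ → h y = 0 := fun y hy =>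
      rad_eq_zero hk hr (fun t ht => Jt_zero l1 l2 l3 ht) hy
    have hts : tsupport h ⊆ closedBall x r := by
      refine closure_minimal ?_ isClosed_closedBall
      intro y hy
      rw [mem_closedBall, dist_eq_norm]
      by_contra h'
      exact hy (hzero y (not_le.1 h').le)
    have hhc : HasCompactSupport h :=
      (isCompact_closedBall _ _).of_isClosed_subset (isClosed_tsupport _) hts
    have hh_nonneg : ∀ y, 0 ≤ h y := by
      intro y
      simp only [h, h0, rad]
      split_ifs
      · exact Jt_nonneg l1 l2 l3 _
      · exact Jt_nonneg l1 l2 l3 _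
    have hlap : ∀ y, lap h y = kern r (y - x) - kern δ (y - x) := by
      intro y
      simp only [h]
      rw [lap_comp_sub, lap_rad hk Jt_smooth hJc, Jt_deriv2, sub_mul]
      rfl
    have g := green (u := w) hh hhc fun y hy => (hwc y (hts hy)).1
    -- left side
    have hi1 : Integrable fun y => w y * kern r (y - x) :=
      int_mul_supp (ker_sub_cont hk hr x) (ker_hcs hk hr x)
        fun y hy => (hwc y (ker_tsupport hk hr x hy)).1.continuousAt
    have hδr : δ ≤ r := (min_le_right _ _).trans (by linarith)
    have hi2 : Integrable fun y => w y * kern δ (y - x) :=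
      int_mul_supp (ker_sub_cont hk hδ x) (ker_hcs hk hδ x)
        fun y hy => (hwc y (closedBall_subset_closedBall hδr (ker_tsupport hk hδ x hy))).1.continuousAt
    have hi3 : Integrable fun y => max (v y) 0 * kern r (y - x) :=
      int_mul_supp (ker_sub_cont hk hr x) (ker_hcs hk hr x)
        fun y hy => hposc y (ker_tsupport hk hr x hy)
    have eL : ∫ y, w y * lap h y = (∫ y, w y * kern r (y - x)) - ∫ y, w y * kern δ (y - x) := by
      rw [← integral_sub hi1 hi2]
      refine integral_congr_ae (Eventually.of_forall fun y => ?_)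
      simp only [hlap]; ring
    have b1 : ∫ y, w y * kern r (y - x) ≤ ∫ y, max (v y) 0 * kern r (y - x) :=
      integral_mono hi1 hi3 fun y => mul_le_mul_of_nonneg_right (hwle y) (ker_nonneg hr _)
    have b2 : kap k * (w x - η) ≤ ∫ y, w y * kern δ (y - x) := by
      have e : kap k * (w x - η) = ∫ y, (w x - η) * kern δ (y - x) := by
        rw [integral_const_mul, ker_integral hk hδ]; ring
      rw [e]
      refine integral_mono (((ker_sub_cont hk hδ x).integrable_of_hasCompactSupport
        (ker_hcs hk hδ x)).const_mul _) hi2 fun y => ?_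
      by_cases hy : ‖y - x‖ ≤ δ
      · refine mul_le_mul_of_nonneg_right (hd y ?_) (ker_nonneg hδ _)
        rw [mem_closedBall, dist_eq_norm]
        exact hy.trans (min_le_left _ _)
      · simp [ker_zero hk hδ (not_le.1 hy)]
    have b3 : - (K * (Cb k * r^2)) ≤ ∫ y, lap w y * h y := by
      have hball := polar_ball (k := k) k (by omega) hr.le
      have hintg : Integrable (fun y : Eucl (k+2) => (ball (0:Eucl (k+2)) r).indicator tau (y - x)) := by
        have : Integrable ((ball (0:Eucl (k+2)) r).indicator tau) :=
          (integrable_indicator_iff measurableSet_ball).2 hball.1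
        exact this.comp_sub_right x
      have hb : ∫ y, (ball (0:Eucl (k+2)) r).indicator tau (y - x) ≤ Cb k * r^2 := by
        rw [integral_sub_right_eq_self (fun y => (ball (0:Eucl (k+2)) r).indicator tau y) x,
          integral_indicator measurableSet_ball]
        have := hball.2
        rw [show k + 2 - k = 2 by omega] at this
        exact this
      calc - (K * (Cb k * r^2)) ≤ - (K * ∫ y, (ball (0:Eucl (k+2)) r).indicator tau (y - x)) := by
            have := mul_le_mul_of_nonneg_left hb hK
            linarith
        _ = ∫ y, - (K * (ball (0:Eucl (k+2)) r).indicator tau (y - x)) := by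
            rw [integral_neg, integral_const_mul]
        _ ≤ ∫ y, lap w y * h y := by
            refine integral_mono_ae ((hintg.const_mul K).neg) ?_ ?_
            · exact int_mul_supp hh.continuous hhc fun y hy => lap_contAt (hwc y (hts hy)).1
            · have : ∀ᵐ y : Eucl (k+2), y ≠ x := by
                simp [ae_iff, measure_singleton]
              filter_upwards [this] with y hyx
              have hyx' : y - x ≠ 0 := sub_ne_zero.2 hyx
              by_cases hy : ‖y - x‖ < r
              · rw [indicator_of_mem (mem_ball_zero_iff.2 hy)]
                have a1 := (hwc y (mem_closedBall.2 (by rw [dist_eq_norm]; exact hy.le))).2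
                have a2 : h y ≤ tau (y - x) := by
                  simp only [h, h0]
                  rw [rad_ne hyx']
                  exact Jt_le_self l1 l2 l3 hα.le (tau_nonneg _)
                have a3 := hh_nonneg y
                nlinarith
              · rw [indicator_of_notMem (fun h' => hy (mem_ball_zero_iff.1 h')), hzero y (not_lt.1 hy)]
                simp
    have b4 : kap k * (max (v x) 0 - 3*η) ≤ kap k * (w x - η) := by
      apply mul_le_mul_of_nonneg_left _ hkp.le; linarith
    linarith
  have hl : Tendsto (fun η : ℝ => kap k * (max (v x) 0 - 3*η)) (𝓝[>] 0)
      (𝓝 (kap k * (max (v x) 0 - 3*0))) := by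
    apply tendsto_nhdsWithin_of_tendsto_nhds
    exact (by fun_prop : Continuous fun η : ℝ => kap k * (max (v x) 0 - 3*η)).tendsto 0
  rw [mul_zero, sub_zero] at hl
  refine le_of_tendsto hl ?_
  filter_upwards [self_mem_nhdsWithin] with η hη using hmain η hη

end smv

/-- Weak maximum principle. -/
lemma max_princ {n : ℕ} {K : Set (Eucl n)} (hK : IsCompact K) {u : Eucl n → ℝ}
    (hu : ContinuousOn u K)
    (h : ∀ x ∈ K, 0 < u x → K ∈ 𝓝 x ∧ ContDiffAt ℝ 2 u x ∧ 0 < lap u x) :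
    ∀ x ∈ K, u x ≤ 0 := by
  intro x hx
  by_contra hc
  push Not at hc
  obtain ⟨y, hy, hmax⟩ := hK.exists_isMaxOn ⟨x, hx⟩ hu
  have hy0 : 0 < u y := hc.trans_le (hmax hx)
  obtain ⟨h1, h2, h3⟩ := h y hy hy0
  have : IsLocalMax u y := hmax.isLocalMax h1
  exact absurd (lap_local_max this h2) (not_le.2 h3)
end

section
lemma lattice_closed {n : ℕ} {ε : ℝ} (hε : 0 < ε) : IsClosed (latticePts n ε) := by
  have h1 : IsClosed (range fun z : ℤ => ε * (z:ℝ)) := by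
    have h := Int.isClosedEmbedding_coe_real.isClosed_range
    have := (Homeomorph.mulLeft₀ ε hε.ne').isClosedMap _ h
    convert this using 1
    ext x; simp
  have : latticePts n ε = ⋂ i, {m : Eucl n | m i ∈ range fun z : ℤ => ε * (z:ℝ)} := by
    ext m; simp [latticePts, eq_comm]
  rw [this]
  exact isClosed_iInter fun i => h1.preimage (by fun_prop)

lemma holes_closed {n : ℕ} {ε a : ℝ} (hε : 0 < ε) (ha : 0 ≤ a) : IsClosed (holes n ε a) := by
  unfold holes
  rw [← (lattice_closed hε).cthickening_eq_biUnion_closedBall ha]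
  exact isClosed_cthickening

lemma mem_holes {n : ℕ} {ε a : ℝ} {x : Eucl n} :
    x ∈ holes n ε a ↔ ∃ m ∈ latticePts n ε, ‖x - m‖ ≤ a := by
  simp [holes, dist_eq_norm]

/-- The standing hypotheses. -/
structure EV (k : ℕ) (Ω : Set (Eucl (k+2))) (p c₀ C₀ : ℝ) (a : ℝ → ℝ)
    (Φ : ℝ → Eucl (k+2) → ℝ) : Prop where
  hk : 1 ≤ k
  hΩo : IsOpen Ω
  hΩb : Bornology.IsBounded Ω
  hΩs : HasSmoothBoundary Ω
  hp0 : 0 < p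
  hp1 : p < 1
  hc₀ : 0 < c₀
  hC₀ : 0 < C₀
  haε : ∀ ε ∈ Ioo (0:ℝ) 1, c₀ * aStar (k+2) ε ≤ a ε ∧ a ε ≤ C₀ * aStar (k+2) ε
  hΦ : ∀ ε ∈ Ioo (0:ℝ) 1, IsEVSol (k+2) Ω ε (a ε) p (Φ ε)

namespace EV
variable {k : ℕ} {Ω : Set (Eucl (k+2))} {p c₀ C₀ : ℝ} {a : ℝ → ℝ} {Φ : ℝ → Eucl (k+2) → ℝ}
  {ε : ℝ}

lemma a_pos (H : EV k Ω p c₀ C₀ a Φ) (hε : ε ∈ Ioo (0:ℝ) 1) : 0 < a ε := by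
  have h1 : 0 < aStar (k+2) ε := Real.rpow_pos_of_pos hε.1 _
  have := H.hc₀
  exact lt_of_lt_of_le (by positivity) (H.haε ε hε).1

lemma dom_open (H : EV k Ω p c₀ C₀ a Φ) (hε : ε ∈ Ioo (0:ℝ) 1) : IsOpen (Ω \ holes (k+2) ε (a ε)) :=
  H.hΩo.sdiff (holes_closed hε.1 (H.a_pos hε).le)

lemma pos_iff (H : EV k Ω p c₀ C₀ a Φ) (hε : ε ∈ Ioo (0:ℝ) 1) (x : Eucl (k+2)) :
    0 < Φ ε x ↔ x ∈ Ω \ holes (k+2) ε (a ε) := by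
  obtain ⟨_, _, _, h4, h5⟩ := H.hΦ ε hε
  exact ⟨fun h => by by_contra h'; rw [h5 x h'] at h; exact lt_irrefl _ h, h4 x⟩

lemma nonneg (H : EV k Ω p c₀ C₀ a Φ) (hε : ε ∈ Ioo (0:ℝ) 1) (x : Eucl (k+2)) : 0 ≤ Φ ε x := by
  by_cases h : x ∈ Ω \ holes (k+2) ε (a ε)
  · exact ((H.hΦ ε hε).2.2.2.1 x h).le
  · rw [(H.hΦ ε hε).2.2.2.2 x h]

lemma c2 (H : EV k Ω p c₀ C₀ a Φ) (hε : ε ∈ Ioo (0:ℝ) 1) {x : Eucl (k+2)} (hx : 0 < Φ ε x) : ContDiffAt ℝ 2 (Φ ε) x :=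
  ((H.hΦ ε hε).2.1).contDiffAt ((H.dom_open hε).mem_nhds ((H.pos_iff hε x).1 hx))

lemma lapΦ (H : EV k Ω p c₀ C₀ a Φ) (hε : ε ∈ Ioo (0:ℝ) 1) {x : Eucl (k+2)} (hx : 0 < Φ ε x) :
    lap (Φ ε) x = - Φ ε x ^ p := by
  have := (H.hΦ ε hε).2.2.1 x ((H.pos_iff hε x).1 hx)
  linarith

lemma zero_off (H : EV k Ω p c₀ C₀ a Φ) (hε : ε ∈ Ioo (0:ℝ) 1) {x : Eucl (k+2)} (hx : x ∉ Ω) : Φ ε x = 0 :=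
  (H.hΦ ε hε).2.2.2.2 x fun h => hx h.1

lemma zero_hole (H : EV k Ω p c₀ C₀ a Φ) (hε : ε ∈ Ioo (0:ℝ) 1) {x : Eucl (k+2)} (hx : x ∈ holes (k+2) ε (a ε)) :
    Φ ε x = 0 :=
  (H.hΦ ε hε).2.2.2.2 x fun h => h.2 hx

lemma cont (H : EV k Ω p c₀ C₀ a Φ) (hε : ε ∈ Ioo (0:ℝ) 1) : Continuous (Φ ε) := by
  have h1 : ContinuousOn (Φ ε) (closure Ω) := (H.hΦ ε hε).1
  have h2 : ContinuousOn (Φ ε) Ωᶜ := by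
    refine (continuousOn_const (c := (0:ℝ))).congr fun x hx => H.zero_off hε hx
  have h3 := h1.union_of_isClosed h2 isClosed_closure H.hΩo.isClosed_compl
  have : closure Ω ∪ Ωᶜ = univ := by
    rw [eq_univ_iff_forall]; intro x
    by_cases hx : x ∈ Ω
    · exact Or.inl (subset_closure hx)
    · exact Or.inr hx
  rw [this] at h3
  exact continuousOn_univ.1 h3

lemma exists_rho (H : EV k Ω p c₀ C₀ a Φ) : ∃ ρ ≥ (1:ℝ), Ω ⊆ ball 0 ρ := by
  obtain ⟨R, hR⟩ := H.hΩb.subset_ball (0 : Eucl (k+2))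
  exact ⟨max 1 R, le_max_left _ _, hR.trans (ball_subset_ball (le_max_right _ _))⟩

lemma bound (H : EV k Ω p c₀ C₀ a Φ) : ∃ M ≥ (1:ℝ), ∀ ε ∈ Ioo (0:ℝ) 1, ∀ x, Φ ε x ≤ M := by
  obtain ⟨ρ, hρ1, hρ⟩ := H.exists_rho
  refine ⟨(ρ^2)^(1/(1-p)), ?_, ?_⟩
  · apply Real.one_le_rpow (by nlinarith)
    have := H.hp1
    apply div_nonneg <;> linarith
  intro ε hε x
  have hp1 := H.hp1
  have hp0 := H.hp0
  have hcl : closure Ω ⊆ closedBall 0 ρ := closure_minimal (hρ.trans ball_subset_closedBall) isClosed_closedBall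
  have hK : IsCompact (closure Ω) := H.hΩb.isCompact_closure
  by_cases hx : 0 < Φ ε x
  swap
  · push Not at hx
    exact hx.trans (by positivity)
  have hxΩ : x ∈ closure Ω := subset_closure ((H.pos_iff hε x).1 hx).1
  obtain ⟨y, hy, hmax⟩ := hK.exists_isMaxOn ⟨x, hxΩ⟩ (H.cont hε).continuousOn
  set S := Φ ε y
  have hS : 0 < S := hx.trans_le (hmax hxΩ)
  have hSp : 0 < S^p := Real.rpow_pos_of_pos hS p
  set c := 2 * S^p / (2 * (k+2))
  have hc : 0 < c := by positivity
  set u : Eucl (k+2) → ℝ := fun z => Φ ε z + (c * ‖z - 0‖^2 + (- c * ρ^2))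
  have hle := max_princ hK (u := u) ?_ ?_ y hy
  · have hle : S + (c * ‖y - 0‖^2 + (- c * ρ^2)) ≤ 0 := hle
    have h1 : S ≤ S^p * ρ^2 := by
      have : 0 ≤ c * ‖y - 0‖^2 := by positivity
      have h2 : c ≤ S^p := by
        simp only [c]
        rw [div_le_iff₀ (by positivity)]
        have : (0:ℝ) ≤ k := by positivity
        nlinarith
      nlinarith [sq_nonneg ρ]
    have h2 : S^(1-p) ≤ ρ^2 := by
      rw [Real.rpow_sub hS, Real.rpow_one, div_le_iff₀ hSp]; linarith
    calc Φ ε x ≤ S := hmax hxΩ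
      _ = (S^(1-p))^(1/(1-p)) := by
          rw [← Real.rpow_mul hS.le, mul_one_div_cancel (by linarith), Real.rpow_one]
      _ ≤ _ := by
          apply Real.rpow_le_rpow (by positivity) h2
          apply div_nonneg <;> linarith
  · have := H.cont hε
    exact (by fun_prop : Continuous u).continuousOn
  · intro z hz hu
    have hz1 : ‖z‖ ≤ ρ := mem_closedBall_zero_iff.1 (hcl hz)
    have hz2 : 0 < Φ ε z := by
      have hu : 0 < Φ ε z + (c * ‖z - 0‖^2 + (- c * ρ^2)) := hu
      rw [sub_zero] at hu
      have : ‖z‖^2 ≤ ρ^2 := by gcongr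
      nlinarith
    have hzΩ := (H.pos_iff hε z).1 hz2
    have d1 : ContDiffAt ℝ 2 (fun z : Eucl (k+2) => ‖z - 0‖^2) z :=
      (sqd_smooth 0).contDiffAt.of_le two_le_inf
    have d2 : ContDiffAt ℝ 2 (fun z : Eucl (k+2) => c * ‖z - 0‖^2) z := contDiffAt_const.mul d1
    have d3 : ContDiffAt ℝ 2 (fun z : Eucl (k+2) => c * ‖z - 0‖^2 + (- c * ρ^2)) z :=
      d2.add contDiffAt_const
    refine ⟨mem_of_superset (H.hΩo.mem_nhds hzΩ.1) subset_closure, (H.c2 hε hz2).add d3, ?_⟩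
    simp only [u]
    rw [lap_add (H.c2 hε hz2) d3, lap_add d2 contDiffAt_const, lap_const_mul _ d1, lap_sqd,
      lap_const, H.lapΦ hε hz2]
    have e1 : Φ ε z ^ p ≤ S^p := Real.rpow_le_rpow hz2.le (hmax hz) hp0.le
    have e2 : c * (2 * ((k+2 : ℕ):ℝ)) = 2 * S^p := by
      simp only [c]; push_cast; field_simp
    linarith

lemma bdry_pt (H : EV k Ω p c₀ C₀ a Φ) {z : Eucl (k+2)} (hz : z ∈ frontier Ω) {η : ℝ} (hη : 0 < η) :
    ∀ᶠ x in 𝓝 z, ∀ ε ∈ Ioo (0:ℝ) 1, Φ ε x ≤ η := by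
  obtain ⟨M, hM1, hM⟩ := H.bound
  obtain ⟨f, hf, hΩf, hdf⟩ := H.hΩs
  have hp0 := H.hp0
  have hfz : f z = 0 := by
    have h1 : f z ≤ 0 := by
      have : closure Ω ⊆ {x | f x ≤ 0} := by
        refine closure_minimal ?_ (isClosed_le hf.continuous continuous_const)
        rw [hΩf]; exact fun x (hx : f x < 0) => (le_of_lt hx : f x ≤ 0)
      exact this hz.1
    have h2 : ¬ f z < 0 := by
      intro h
      have : z ∈ Ω := by rw [hΩf]; exact h
      rw [H.hΩo.frontier_eq] at hz
      exact hz.2 this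
    linarith
  have hg : 0 < gsq f z := by
    rw [← norm_fderiv_sq]
    have := norm_pos_iff.2 (hdf z hz)
    positivity
  have hf2 : ContDiff ℝ 2 f := hf.of_le two_le_inf
  set g := gsq f z / 2
  have hg0 : 0 < g := by simp only [g]; linarith
  set L := |lap f z| + 1
  -- neighbourhood
  have hev : ∀ᶠ x in 𝓝 z, g < gsq f x ∧ lap f x > - L ∧ -1 < f x := by
    refine ((gsq_cont hf2).continuousAt.eventually_const_lt (by simp only [g]; linarith)).and
      (((lap_cont hf2).continuousAt.eventually_const_lt ?_).and
      (hf.continuous.continuousAt.eventually_const_lt (by linarith)))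
    have := neg_abs_le (lap f z)
    simp only [L]; linarith
  obtain ⟨ρ, hρ, hball⟩ := Metric.nhds_basis_closedBall.eventually_iff.1 hev
  set μ := (L + 1)/g
  have hL : 0 < L := by positivity
  have hμ : 0 < μ := by positivity
  set B := M / ρ^2
  have hB : 0 < B := by positivity
  set N := 2 * ((k+2 : ℕ):ℝ)
  set A := (M + 1 + B * N) / (μ * Real.exp (-μ))
  have hA : 0 < A := by positivity
  set E : ℝ → ℝ := fun t => Real.exp (μ * t)
  have hE : ContDiff ℝ (⊤ : ℕ∞) E := by
    simp only [E]; fun_prop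
  have hE1 : deriv E = fun t => μ * Real.exp (μ * t) := by
    ext t
    have : HasDerivAt (fun t => μ * t) μ t := by simpa using (hasDerivAt_id t).const_mul μ
    rw [this.exp.deriv]; ring
  have hE2 : deriv (deriv E) = fun t => μ * (μ * Real.exp (μ * t)) := by
    rw [hE1]
    ext t
    have : HasDerivAt (fun t => μ * t) μ t := by simpa using (hasDerivAt_id t).const_mul μ
    rw [(this.exp.const_mul μ).deriv]; ring
  set w : Eucl (k+2) → ℝ := fun x => A * (1 - E (f x)) + B * ‖x - z‖^2
  have hwc : Continuous w := by
    have := hf.continuous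
    have := hE.continuous
    fun_prop
  have hwz : w z = 0 := by simp [w, E, hfz]
  have hcomp : ∀ ε ∈ Ioo (0:ℝ) 1, ∀ x ∈ closedBall z ρ, x ∈ Ω → Φ ε x ≤ w x := by
    intro ε hε x hx hxΩ
    have hK : IsCompact (closedBall z ρ ∩ closure Ω) :=
      (isCompact_closedBall z ρ).inter_right isClosed_closure
    set u : Eucl (k+2) → ℝ := fun y => (Φ ε y + A * E (f y)) - (B * ‖y - z‖^2 + A)
    have hu : ∀ y, u y = Φ ε y - w y := fun y => by simp only [u, w]; ring
    have hle := max_princ hK (u := u) ?_ ?_ x ⟨hx, subset_closure hxΩ⟩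
    · rw [hu] at hle; linarith
    · have h1 := H.cont hε
      have h2 := hf.continuous
      have h3 := hE.continuous
      exact (by fun_prop : Continuous u).continuousOn
    · rintro y ⟨hy, hyΩ⟩ huy
      have hfy : f y ≤ 0 := by
        have : closure Ω ⊆ {x | f x ≤ 0} := by
          refine closure_minimal ?_ (isClosed_le hf.continuous continuous_const)
          rw [hΩf]; exact fun x (hx : f x < 0) => (le_of_lt hx : f x ≤ 0)
        exact this hyΩ
      have hEy : E (f y) ≤ 1 := by
        simp only [E]; rw [Real.exp_le_one_iff]; nlinarith
      obtain ⟨b1, b2, b3⟩ := hball hy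
      have huy' := huy
      rw [hu] at huy'
      have hw1 : B * ‖y - z‖^2 ≤ w y := by
        simp only [w]
        have : 0 ≤ A * (1 - E (f y)) := mul_nonneg hA.le (by linarith)
        linarith
      have hΦy : 0 < Φ ε y := by
        have : 0 ≤ B * ‖y - z‖^2 := by positivity
        linarith
      have hyd := (H.pos_iff hε y).1 hΦy
      have hyρ : ‖y - z‖ < ρ := by
        by_contra hcon
        push Not at hcon
        have : M ≤ B * ‖y - z‖^2 := by
          simp only [B]
          rw [div_mul_eq_mul_div, le_div_iff₀ (by positivity)]
          have : ρ^2 ≤ ‖y - z‖^2 := by gcongr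
          nlinarith
        linarith [hM ε hε y]
      have d0 := H.c2 hε hΦy
      have d1 : ContDiffAt ℝ 2 (fun y => E (f y)) y :=
        ((hE.comp hf).of_le two_le_inf).contDiffAt
      have d2 : ContDiffAt ℝ 2 (fun y => A * E (f y)) y := contDiffAt_const.mul d1
      have d3 : ContDiffAt ℝ 2 (fun y : Eucl (k+2) => ‖y - z‖^2) y :=
        ((sqd_smooth z).of_le two_le_inf).contDiffAt
      have d4 : ContDiffAt ℝ 2 (fun y : Eucl (k+2) => B * ‖y - z‖^2) y := contDiffAt_const.mul d3
      have d5 : ContDiffAt ℝ 2 (fun y : Eucl (k+2) => B * ‖y - z‖^2 + A) y := d4.add contDiffAt_const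
      refine ⟨?_, (d0.add d2).sub d5, ?_⟩
      · refine inter_mem ?_ (mem_of_superset (H.hΩo.mem_nhds hyd.1) subset_closure)
        refine mem_of_superset (isOpen_ball.mem_nhds ?_) ball_subset_closedBall
        rw [mem_ball, dist_eq_norm]; exact hyρ
      · simp only [u]
        rw [lap_sub (d0.add d2) d5, lap_add d0 d2, lap_add d4 contDiffAt_const,
          lap_const_mul _ d1, lap_const_mul _ d3, lap_sqd, lap_const, H.lapΦ hε hΦy,
          lap_comp (hE.contDiffAt.of_le two_le_inf) (hf2.contDiffAt), hE2, hE1]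
        have e1 : Φ ε y ^ p ≤ M := by
          calc Φ ε y ^ p ≤ M ^ p := Real.rpow_le_rpow hΦy.le (hM ε hε y) hp0.le
            _ ≤ M ^ (1:ℝ) := Real.rpow_le_rpow_of_exponent_le hM1 H.hp1.le
            _ = M := Real.rpow_one M
        have e2 : Real.exp (-μ) ≤ Real.exp (μ * f y) := by
          apply Real.exp_le_exp.2; nlinarith
        have e3 : 1 ≤ lap f y + μ * gsq f y := by
          have : L + 1 ≤ μ * gsq f y := by
            simp only [μ]
            rw [div_mul_eq_mul_div, le_div_iff₀ hg0]
            nlinarith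
          linarith
        have e4 : M + 1 + B * N ≤ A * (μ * Real.exp (μ * f y) * lap f y
            + μ * (μ * Real.exp (μ * f y)) * gsq f y) := by
          have : A * (μ * Real.exp (μ * f y) * lap f y
            + μ * (μ * Real.exp (μ * f y)) * gsq f y)
            = A * (μ * Real.exp (μ * f y)) * (lap f y + μ * gsq f y) := by ring
          rw [this]
          calc M + 1 + B * N = A * (μ * Real.exp (-μ)) * 1 := by
                simp only [A]; field_simp
            _ ≤ _ := by gcongr
        simp only [N] at e4
        linarith
  have h1 : ∀ᶠ x in 𝓝 z, w x < η := hwc.continuousAt.eventually_lt_const (by rw [hwz]; exact hη)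
  filter_upwards [h1, closedBall_mem_nhds z hρ] with x h2 h3 ε hε
  by_cases hx : x ∈ Ω
  · exact (hcomp ε hε x h3 hx).trans h2.le
  · rw [H.zero_off hε hx]; exact hη.le

lemma bdry (H : EV k Ω p c₀ C₀ a Φ) {η : ℝ} (hη : 0 < η) :
    ∃ r > 0, ∀ ε ∈ Ioo (0:ℝ) 1, ∀ x z, z ∉ Ω → dist x z < r → Φ ε x ≤ η := by
  obtain ⟨ρ, hρ1, hρ⟩ := H.exists_rho
  set S := {x : Eucl (k+2) | ∀ ε ∈ Ioo (0:ℝ) 1, Φ ε x ≤ η}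
  have hS : Ωᶜ ⊆ interior S := by
    intro z hz
    rw [mem_interior_iff_mem_nhds]
    by_cases hzc : z ∈ closure Ω
    · have : z ∈ frontier Ω := by rw [H.hΩo.frontier_eq]; exact ⟨hzc, hz⟩
      exact H.bdry_pt this hη
    · filter_upwards [isClosed_closure.isOpen_compl.mem_nhds hzc] with x hx ε hε
      rw [H.zero_off hε fun h => hx (subset_closure h)]; exact hη.le
  have hK : IsCompact (closedBall (0:Eucl (k+2)) (ρ+1) ∩ Ωᶜ) :=
    (isCompact_closedBall _ _).inter_right H.hΩo.isClosed_compl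
  obtain ⟨r, hr, hr2⟩ := hK.exists_thickening_subset_open isOpen_interior
    (inter_subset_right.trans hS)
  refine ⟨min r 1, lt_min hr one_pos, fun ε hε x z hz hxz => ?_⟩
  by_cases hx : x ∈ Ω
  · have : x ∈ thickening r (closedBall (0:Eucl (k+2)) (ρ+1) ∩ Ωᶜ) := by
      refine mem_thickening_iff.2 ⟨z, ⟨?_, hz⟩, hxz.trans_le (min_le_left _ _)⟩
      rw [mem_closedBall]
      have h1 := mem_ball.1 (hρ hx)
      have h2 := hxz.trans_le (min_le_right _ _)
      linarith [dist_triangle z x 0, dist_comm x z]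
    exact interior_subset (hr2 this) ε hε
  · rw [H.zero_off hε hx]; exact hη.le

/-- bound near a hole -/
lemma near_hole (H : EV k Ω p c₀ C₀ a Φ) {M : ℝ} (hM1 : 1 ≤ M) (hM : ∀ ε ∈ Ioo (0:ℝ) 1, ∀ x, Φ ε x ≤ M)
    (hε : ε ∈ Ioo (0:ℝ) 1) (hsmall : 4 * a ε ≤ ε) {m : Eucl (k+2)} (hm : m ∈ latticePts (k+2) ε)
    {x : Eucl (k+2)} (h1 : a ε ≤ ‖x - m‖) (h2 : ‖x - m‖ ≤ ε/2) :
    Φ ε x ≤ 2 * M * (1 - tau (x - m) * a ε ^ k) + M * ε^2 := by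
  have ha := H.a_pos hε
  have hk := H.hk
  have hε0 := hε.1
  set A := a ε
  set d := M
  set w : Eucl (k+2) → ℝ := fun y => 2 * M * (1 - tau (y - m) * A^k) + d * ((ε/2)^2 - ‖y - m‖^2)
  set K := closedBall m (ε/2) ∩ (ball m A)ᶜ
  have hK : IsCompact K := (isCompact_closedBall _ _).inter_right isOpen_ball.isClosed_compl
  have hKm : ∀ y ∈ K, A ≤ ‖y - m‖ ∧ ‖y - m‖ ≤ ε/2 := by
    rintro y ⟨hy1, hy2⟩
    rw [mem_closedBall, dist_eq_norm] at hy1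
    rw [mem_compl_iff, mem_ball, dist_eq_norm, not_lt] at hy2
    exact ⟨hy2, hy1⟩
  have hne : ∀ y ∈ K, y - m ≠ 0 := fun y hy => norm_pos_iff.1 (ha.trans_le (hKm y hy).1)
  have htau : ∀ y ∈ K, tau (y - m) * A^k ≤ 1 := by
    intro y hy
    have := (tau_le_iff ha hk (hne y hy)).2 (hKm y hy).1
    calc tau (y - m) * A^k ≤ (A⁻¹)^k * A^k := by gcongr
      _ = 1 := by rw [← mul_pow, inv_mul_cancel₀ ha.ne', one_pow]
  have hxK : x ∈ K := by
    refine ⟨?_, ?_⟩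
    · rw [mem_closedBall, dist_eq_norm]; exact h2
    · rw [mem_compl_iff, mem_ball, dist_eq_norm, not_lt]; exact h1
  have dtau : ∀ y ∈ K, ContDiffAt ℝ 2 (fun y : Eucl (k+2) => tau (y - m)) y := by
    intro y hy
    have : ContDiffAt ℝ 2 (tau : Eucl (k+2) → ℝ) (y - m) :=
      (tau_smooth (hne y hy)).of_le two_le_inf
    exact ContDiffAt.comp (g := tau) (f := fun y : Eucl (k+2) => y - m) y this
      (contDiffAt_id.sub contDiffAt_const)
  set u : Eucl (k+2) → ℝ := fun y => (Φ ε y + (2 * M * A^k) * tau (y - m)) +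
    (d * ‖y - m‖^2 + (- 2 * M - d * (ε/2)^2))
  have hu : ∀ y, u y = Φ ε y - w y := fun y => by simp only [u, w]; ring
  have hle := max_princ hK (u := u) ?_ ?_ x hxK
  · rw [hu] at hle
    simp only [w] at hle
    have : d * ((ε/2)^2 - ‖x - m‖^2) ≤ M * ε^2 := by
      simp only [d]
      apply mul_le_mul_of_nonneg_left _ (by linarith)
      nlinarith [sq_nonneg (‖x - m‖)]
    linarith
  · intro y hy
    have h1 := (H.cont hε).continuousAt (x := y)
    have h2 := (dtau y hy).continuousAt
    have h3 : ContinuousAt (fun y : Eucl (k+2) => ‖y - m‖^2) y :=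
      (by fun_prop : Continuous (fun y : Eucl (k+2) => ‖y - m‖^2)).continuousAt
    exact ((h1.add (continuousAt_const.mul h2)).add
      ((continuousAt_const.mul h3).add continuousAt_const)).continuousWithinAt
  · intro y hy huy
    obtain ⟨hy1, hy2⟩ := hKm y hy
    have huy' := huy
    rw [hu] at huy'
    have hd0 : 0 ≤ d * ((ε/2)^2 - ‖y - m‖^2) := by
      apply mul_nonneg (by simp only [d]; linarith)
      have : ‖y - m‖^2 ≤ (ε/2)^2 := by gcongr
      linarith
    have hw0 : 0 ≤ w y := by
      have := htau y hy
      have : 0 ≤ 2 * M * (1 - tau (y - m) * A^k) := mul_nonneg (by linarith) (by linarith)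
      simp only [w]; linarith
    have hΦy : 0 < Φ ε y := by linarith
    have hyd := (H.pos_iff hε y).1 hΦy
    have s1 : A < ‖y - m‖ := by
      by_contra hcon
      exact hyd.2 (mem_holes.2 ⟨m, hm, not_lt.1 hcon⟩)
    have s2 : ‖y - m‖ < ε/2 := by
      by_contra hcon
      have heq : ‖y - m‖ = ε/2 := le_antisymm hy2 (not_lt.1 hcon)
      have : M ≤ w y := by
        have ht : tau (y - m) * A^k ≤ 1/2 := by
          unfold tau
          rw [heq, ← mul_pow]
          have q0 : 0 ≤ (ε/2)⁻¹ * A := by positivity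
          have q : (ε/2)⁻¹ * A ≤ 1/2 := by
            rw [inv_mul_le_iff₀ (by positivity)]; linarith
          calc ((ε/2)⁻¹ * A)^k ≤ (1/2)^k := by gcongr
            _ ≤ (1/2)^1 := pow_le_pow_of_le_one (by norm_num) (by norm_num) hk
            _ = 1/2 := by norm_num
        simp only [w]
        nlinarith
      linarith [hM ε hε y]
    have d0 := H.c2 hε hΦy
    have d1 := dtau y hy
    have d2 : ContDiffAt ℝ 2 (fun y : Eucl (k+2) => (2 * M * A^k) * tau (y - m)) y :=
      contDiffAt_const.mul d1
    have d3 : ContDiffAt ℝ 2 (fun y : Eucl (k+2) => ‖y - m‖^2) y :=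
      ((sqd_smooth m).of_le two_le_inf).contDiffAt
    have d4 : ContDiffAt ℝ 2 (fun y : Eucl (k+2) => d * ‖y - m‖^2) y := contDiffAt_const.mul d3
    have d5 : ContDiffAt ℝ 2 (fun y : Eucl (k+2) => d * ‖y - m‖^2 + (- 2 * M - d * (ε/2)^2)) y :=
      d4.add contDiffAt_const
    refine ⟨?_, (d0.add d2).add d5, ?_⟩
    · have o1 : ball m (ε/2) ∩ (closedBall m A)ᶜ ∈ 𝓝 y := by
        refine (isOpen_ball.inter isClosed_closedBall.isOpen_compl).mem_nhds ⟨?_, ?_⟩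
        · rw [mem_ball, dist_eq_norm]; exact s2
        · rw [mem_compl_iff, mem_closedBall, dist_eq_norm, not_le]; exact s1
      exact mem_of_superset o1 (inter_subset_inter ball_subset_closedBall
        (compl_subset_compl.2 ball_subset_closedBall))
    · simp only [u]
      rw [lap_add (d0.add d2) d5, lap_add d0 d2, lap_add d4 contDiffAt_const,
        lap_const_mul _ d1, lap_const_mul _ d3, lap_sqd, lap_const, H.lapΦ hε hΦy,
        lap_comp_sub, lap_tau (hne y hy)]
      have e1 : Φ ε y ^ p ≤ M := by
        calc Φ ε y ^ p ≤ M ^ p := Real.rpow_le_rpow hΦy.le (hM ε hε y) H.hp0.le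
          _ ≤ M ^ (1:ℝ) := Real.rpow_le_rpow_of_exponent_le hM1 H.hp1.le
          _ = M := Real.rpow_one M
      push_cast
      simp only [d]
      have : (0:ℝ) ≤ k := by positivity
      nlinarith

end EV
end

section
/-- lattice point -/
def lpt {n : ℕ} (ε : ℝ) (z : Fin n → ℤ) : Eucl n := WithLp.toLp 2 (fun i => ε * (z i : ℝ))

/-- finite box of lattice indices, covering the lattice points of norm at most `R` -/
def Zf (n : ℕ) (ε R : ℝ) : Finset (Fin n → ℤ) :=
  Fintype.piFinset fun _ => Finset.Icc (-(⌈R/ε⌉₊ : ℤ)) (⌈R/ε⌉₊ : ℤ)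

lemma lp_mem {n : ℕ} (ε : ℝ) (z : Fin n → ℤ) : lpt ε z ∈ latticePts n ε := fun i => ⟨z i, rfl⟩

lemma exists_lp {n : ℕ} {ε : ℝ} {m : Eucl n} (hm : m ∈ latticePts n ε) : ∃ z, m = lpt ε z := by
  choose z hz using hm
  exact ⟨z, by ext i; exact hz i⟩

lemma coord_le {n : ℕ} (x : Eucl n) (i : Fin n) : |x i| ≤ ‖x‖ := by
  have := PiLp.norm_apply_le x i
  simpa using this

lemma mem_Zf {n : ℕ} {ε R : ℝ} (hε : 0 < ε) {z : Fin n → ℤ} (h : ‖lpt ε z‖ ≤ R) : z ∈ Zf n ε R := by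
  rw [Zf, Fintype.mem_piFinset]
  intro i
  have h1 : |ε * (z i : ℝ)| ≤ R := (coord_le (lpt ε z) i).trans h
  rw [abs_mul, abs_of_pos hε] at h1
  have h2 : |(z i : ℝ)| ≤ R / ε := by rw [le_div_iff₀ hε]; linarith
  have h3 := h2.trans (Nat.le_ceil _)
  rw [abs_le] at h3
  rw [Finset.mem_Icc]
  constructor
  · have := h3.1; exact_mod_cast this
  · exact_mod_cast h3.2

lemma Zf_card {n : ℕ} {ε R : ℝ} (hε : 0 < ε) (hε1 : ε ≤ 1) (hR : 1 ≤ R) :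
    ((Zf n ε R).card : ℝ) ≤ (5*R)^n * (ε⁻¹)^n := by
  rw [Zf, Fintype.card_piFinset]
  simp only [Int.card_Icc, Finset.prod_const, Finset.card_univ, Fintype.card_fin]
  rw [← mul_pow]
  push_cast
  apply pow_le_pow_left₀ (by positivity)
  have h0 : (0:ℝ) ≤ R/ε := by positivity
  have h1 : (⌈R/ε⌉₊ : ℝ) < R/ε + 1 := Nat.ceil_lt_add_one h0
  have h2 : ((((⌈R/ε⌉₊:ℤ) + 1 - -(⌈R/ε⌉₊:ℤ)).toNat : ℕ) : ℝ) = 2 * (⌈R/ε⌉₊:ℝ) + 1 := by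
    have : (((⌈R/ε⌉₊:ℤ) + 1 - -(⌈R/ε⌉₊:ℤ)).toNat : ℕ) = 2 * ⌈R/ε⌉₊ + 1 := by omega
    rw [this]; push_cast; ring
  rw [h2]
  have h3 : 1 ≤ R/ε := by rw [le_div_iff₀ hε]; linarith
  have : 5 * R * ε⁻¹ = 5 * (R/ε) := by rw [div_eq_mul_inv]; ring
  rw [this]; linarith

lemma lp_sep {n : ℕ} {ε : ℝ} (hε : 0 < ε) {z w : Fin n → ℤ} (h : z ≠ w) :
    ε ≤ ‖lpt ε z - lpt ε w‖ := by
  obtain ⟨i, hi⟩ := Function.ne_iff.1 h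
  have h1 := coord_le (lpt ε z - lpt ε w) i
  have h2 : (lpt ε z - lpt ε w) i = ε * ((z i - w i : ℤ) : ℝ) := by
    simp only [lpt, PiLp.sub_apply]; push_cast; ring
  rw [h2, abs_mul, abs_of_pos hε] at h1
  have h3 : (1:ℝ) ≤ |((z i - w i : ℤ) : ℝ)| := by
    exact_mod_cast Int.one_le_abs (sub_ne_zero.2 hi)
  nlinarith

lemma lp_sep' {n : ℕ} {ε : ℝ} (hε : 0 < ε) {z w : Fin n → ℤ} (h : z ≠ w) {x : Eucl n}
    (hx : ‖x - lpt ε w‖ < ε/2) : ε/2 < ‖x - lpt ε z‖ := by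
  have h1 := lp_sep hε h
  have h2 : ‖lpt ε z - lpt ε w‖ ≤ ‖x - lpt ε z‖ + ‖x - lpt ε w‖ := by
    rw [norm_sub_rev x (lpt ε z)]
    have := norm_add_le (lpt ε z - x) (x - lpt ε w)
    simpa using this
  linarith

lemma cell_sum {n : ℕ} {ε : ℝ} (hε : 0 < ε) (Z : Finset (Fin n → ℤ)) (f : Eucl n → ℝ)
    (hf : ∀ y, ε/2 ≤ ‖y‖ → f y = 0) (x : Eucl n) :
    (∃ z0 ∈ Z, ‖x - lpt ε z0‖ < ε/2 ∧ ∑ z ∈ Z, f (x - lpt ε z) = f (x - lpt ε z0)) ∨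
    ((∀ z ∈ Z, ε/2 ≤ ‖x - lpt ε z‖) ∧ ∑ z ∈ Z, f (x - lpt ε z) = 0) := by
  by_cases h : ∃ z0 ∈ Z, ‖x - lpt ε z0‖ < ε/2
  · obtain ⟨z0, hz0, h0⟩ := h
    refine Or.inl ⟨z0, hz0, h0, ?_⟩
    refine Finset.sum_eq_single z0 ?_ (fun h => absurd hz0 h)
    intro z hz hne
    exact hf _ (lp_sep' hε hne h0).le
  · push Not at h
    exact Or.inr ⟨h, Finset.sum_eq_zero fun z hz => hf _ (h z hz)⟩

lemma Gf_deriv2_bound : ∃ C ≥ (0:ℝ), ∀ α β : ℝ, α < β → ∀ t, deriv (deriv (Gf α β)) t ≤ C / (β - α) := by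
  have hs : ContDiff ℝ 1 Real.smoothTransition := Real.smoothTransition.contDiff
  have hc : Continuous (deriv Real.smoothTransition) := hs.continuous_deriv le_rfl
  obtain ⟨C, hC⟩ := (isCompact_Icc (a := (0:ℝ)) (b := 1)).exists_bound_of_continuousOn hc.continuousOn
  refine ⟨max C 0, le_max_right _ _, ?_⟩
  intro α β h t
  have e : deriv (Gf α β) = fun t => Real.smoothTransition ((t - α) / (β - α)) :=
    funext fun t => (Gf_hasDeriv t).deriv
  by_cases ht : t < α
  · rw [Gf_deriv2_zero_low h ht]; exact div_nonneg (le_max_right _ _) (by linarith)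
  by_cases ht2 : β < t
  · rw [Gf_deriv2_zero_high h ht2]; exact div_nonneg (le_max_right _ _) (by linarith)
  push Not at ht ht2
  have hd : HasDerivAt (fun t => Real.smoothTransition ((t - α) / (β - α)))
      (deriv Real.smoothTransition ((t - α) / (β - α)) * (1 / (β - α))) t := by
    have h1 : HasDerivAt (fun t => (t - α) / (β - α)) (1 / (β - α)) t :=
      ((hasDerivAt_id t).sub_const α).div_const _
    exact ((hs.differentiable (by simp) _).hasDerivAt).comp t h1
  rw [e, hd.deriv]
  have hb : 0 < β - α := by linarith
  have h3 : deriv Real.smoothTransition ((t - α) / (β - α)) ≤ max C 0 := by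
    refine (le_abs_self _).trans ((hC _ ⟨div_nonneg (by linarith) hb.le, ?_⟩).trans (le_max_left _ _))
    rw [div_le_one hb]; linarith
  rw [div_eq_mul_one_div (max C 0)]
  gcongr

section corr
variable {k : ℕ}

/-- pointwise bound on the kernel -/
lemma kern_bound (hk : 1 ≤ k) : ∃ C ≥ (0:ℝ), ∀ r > (0:ℝ), ∀ x : Eucl (k+2),
    kern r x ≤ C * (r⁻¹)^(k+2) := by
  obtain ⟨C, hC0, hC⟩ := Gf_deriv2_bound
  refine ⟨C * k^2 * 2^(2*k+2), by positivity, ?_⟩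
  intro r hr x
  by_cases hx : r/2 ≤ ‖x‖
  · have hx0 : 0 < ‖x‖ := lt_of_lt_of_le (by positivity) hx
    unfold kern gt
    have h1 := hC _ _ (rk_lt (k := k) hr) (tau x)
    have h2 : ‖x‖⁻¹ ≤ 2 * r⁻¹ := by
      rw [show 2 * r⁻¹ = (r/2)⁻¹ by field_simp]
      gcongr
    have h3 : 2 * (r⁻¹)^k - (r⁻¹)^k = (r⁻¹)^k := by ring
    rw [h3] at h1
    calc _ ≤ C / (r⁻¹)^k * ((k:ℝ)^2 * (2*r⁻¹)^(2*k+2)) := by gcongr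
      _ = _ := by
        rw [mul_pow, show 2*k+2 = k + (k+2) by ring, pow_add (r⁻¹)]
        have : (r⁻¹)^k ≠ 0 := by positivity
        field_simp
  · push Not at hx
    have : kern r x = 0 := by
      by_cases h0 : x = 0
      · simp [kern, gt, h0]
      unfold kern
      rw [Gf_deriv2_zero_high (rk_lt hr), zero_mul]
      have h1 : 0 < ‖x‖ := norm_pos_iff.2 h0
      have h2 : 2 * r⁻¹ < ‖x‖⁻¹ := by
        rw [show 2 * r⁻¹ = (r/2)⁻¹ by field_simp]
        gcongr
      have : (2 * r⁻¹)^k < tau x := by unfold tau; exact pow_lt_pow_left₀ h2 (by positivity) (by omega)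
      refine lt_of_le_of_lt ?_ this
      rw [mul_pow]
      gcongr
      exact le_self_pow₀ (by norm_num) (by omega)
    rw [this]; positivity

/-- the kernel vanishes near the centre -/
lemma kern_zero_near (hk : 1 ≤ k) {r : ℝ} (hr : 0 < r) {x : Eucl (k+2)} (hx : ‖x‖ < r/2) :
    kern r x = 0 := by
  by_cases h0 : x = 0
  · simp [kern, gt, h0]
  unfold kern
  rw [Gf_deriv2_zero_high (rk_lt hr), zero_mul]
  have h1 : 0 < ‖x‖ := norm_pos_iff.2 h0
  have h2 : 2 * r⁻¹ < ‖x‖⁻¹ := by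
    rw [show 2 * r⁻¹ = (r/2)⁻¹ by field_simp]
    gcongr
  have : (2 * r⁻¹)^k < tau x := by unfold tau; exact pow_lt_pow_left₀ h2 (by positivity) (by omega)
  refine lt_of_le_of_lt ?_ this
  rw [mul_pow]
  gcongr
  exact le_self_pow₀ (by norm_num) (by omega)

/-- parameters -/
structure Good (k : ℕ) (ε A s : ℝ) : Prop where
  hk : 1 ≤ k
  hε : 0 < ε
  hA : 0 < A
  hs : 0 < s
  hs2 : s ≤ 1/4
  h8 : 8 * A ≤ ε
  hsm : 4 * ((ε/4)⁻¹)^k ≤ (1 - 2*s) * (A⁻¹)^k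

/-- radial profile -/
def JJ (k : ℕ) (ε A s : ℝ) : ℝ → ℝ :=
  Jt (((ε/4)⁻¹)^k) (2 * ((ε/4)⁻¹)^k) ((1 - 2*s) * (A⁻¹)^k) ((1 - s) * (A⁻¹)^k)

/-- top value of the profile -/
def JT (k : ℕ) (ε A s : ℝ) : ℝ := JJ k ε A s ((1 - s) * (A⁻¹)^k)

/-- one bump -/
def bump1 (k : ℕ) (ε A s : ℝ) : Eucl (k+2) → ℝ := rad (JT k ε A s) (JJ k ε A s)

/-- corrector -/
def HH (k : ℕ) (ε A s R : ℝ) (x : Eucl (k+2)) : ℝ :=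
  1 - (JT k ε A s)⁻¹ * ∑ z ∈ Zf (k+2) ε R, bump1 k ε A s (x - lpt ε z)

namespace Good
variable {ε A s R : ℝ}

lemma h1 (G : Good k ε A s) : ((ε/4)⁻¹)^k < 2 * ((ε/4)⁻¹)^k := rk_lt (by linarith [G.hε])
lemma h2 (G : Good k ε A s) : 2 * ((ε/4)⁻¹)^k ≤ (1 - 2*s) * (A⁻¹)^k := by
  have := G.hε
  have h : 0 < ((ε/4)⁻¹)^k := by positivity
  linarith [G.hsm]
lemma h3 (G : Good k ε A s) : (1 - 2*s) * (A⁻¹)^k < (1 - s) * (A⁻¹)^k := by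
  have := G.hA; have := G.hs
  have h : 0 < (A⁻¹)^k := by positivity
  nlinarith

lemma hJtop (G : Good k ε A s) : ∀ t ≥ (1 - s) * (A⁻¹)^k, JJ k ε A s t = JT k ε A s :=
  fun t ht => Jt_const G.h1 G.h2 G.h3 ht

lemma JT_ge (G : Good k ε A s) : (1 - 2*s) * (A⁻¹)^k - 2 * ((ε/4)⁻¹)^k ≤ JT k ε A s :=
  Jt_top_ge G.h1 G.h2 G.h3

lemma JT_le (G : Good k ε A s) : JT k ε A s ≤ (A⁻¹)^k := by
  have := Jt_top_le G.h1 G.h2 G.h3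
  have := G.hA; have := G.hε; have := G.hs
  have h : 0 < (A⁻¹)^k := by positivity
  have h' : 0 < ((ε/4)⁻¹)^k := by positivity
  unfold JT JJ
  nlinarith

lemma JT_ge4 (G : Good k ε A s) : (A⁻¹)^k / 4 ≤ JT k ε A s := by
  have := G.JT_ge
  have := G.hsm
  have := G.hs2; have := G.hA
  have h : 0 < (A⁻¹)^k := by positivity
  nlinarith

lemma JT_pos (G : Good k ε A s) : 0 < JT k ε A s := by
  have := G.JT_ge4
  have := G.hA
  have h : 0 < (A⁻¹)^k := by positivity
  linarith

lemma JTinv_le (G : Good k ε A s) : (JT k ε A s)⁻¹ ≤ 4 * A^k := by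
  have := G.hA
  have h : 4 * A^k = ((A⁻¹)^k / 4)⁻¹ := by rw [inv_pow]; field_simp
  rw [h]
  exact inv_anti₀ (by positivity) G.JT_ge4

lemma bump_smooth (G : Good k ε A s) : ContDiff ℝ (⊤ : ℕ∞) (bump1 k ε A s) :=
  rad_smooth G.hk Jt_smooth G.hJtop

lemma bump_zero (G : Good k ε A s) {x : Eucl (k+2)} (hx : ε/4 ≤ ‖x‖) : bump1 k ε A s x = 0 :=
  rad_eq_zero G.hk (by linarith [G.hε]) (fun t ht => Jt_zero G.h1 G.h2 G.h3 ht) hx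

lemma bump_nonneg (G : Good k ε A s) (x : Eucl (k+2)) : 0 ≤ bump1 k ε A s x := by
  unfold bump1 rad
  split_ifs
  · exact G.JT_pos.le
  · exact Jt_nonneg G.h1 G.h2 G.h3 _

lemma bump_le (G : Good k ε A s) (x : Eucl (k+2)) : bump1 k ε A s x ≤ JT k ε A s := by
  unfold bump1 rad
  split_ifs
  · exact le_rfl
  · exact Jt_le G.h1 G.h2 G.h3 _

lemma bump_le_tau (G : Good k ε A s) {x : Eucl (k+2)} (hx : x ≠ 0) : bump1 k ε A s x ≤ tau x := by
  unfold bump1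
  rw [rad_ne hx]
  have := G.hε
  exact Jt_le_self G.h1 G.h2 G.h3 (by positivity) (tau_nonneg x)

lemma bump_top (G : Good k ε A s) {x : Eucl (k+2)} (hx : x ≠ 0 → (1 - s) * (A⁻¹)^k ≤ tau x) :
    bump1 k ε A s x = JT k ε A s := by
  unfold bump1 rad
  split_ifs with h
  · rfl
  · exact G.hJtop _ (hx h)

/-- layer kernel -/
def lay (k : ℕ) (A s : ℝ) (x : Eucl (k+2)) : ℝ :=
  deriv (deriv (Gf ((1 - 2*s) * (A⁻¹)^k) ((1 - s) * (A⁻¹)^k))) (tau x) * gt x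

lemma lay_nonneg (G : Good k ε A s) (x : Eucl (k+2)) : 0 ≤ lay k A s x :=
  mul_nonneg (Gf_deriv2_nonneg G.h3 _) (gt_nonneg x)

lemma lap_bump (G : Good k ε A s) (x : Eucl (k+2)) :
    lap (bump1 k ε A s) x = kern (ε/4) x - lay k A s x := by
  unfold bump1
  rw [lap_rad (J := JJ k ε A s) G.hk Jt_smooth G.hJtop]
  unfold JJ kern lay
  rw [Jt_deriv2]; ring

lemma HH_smooth (G : Good k ε A s) : ContDiff ℝ (⊤ : ℕ∞) (HH k ε A s R) := by
  unfold HH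
  refine contDiff_const.sub (contDiff_const.mul (ContDiff.sum fun z _ => ?_))
  exact G.bump_smooth.comp (contDiff_id.sub contDiff_const)

lemma lap_HH (G : Good k ε A s) (x : Eucl (k+2)) :
    lap (HH k ε A s R) x = - (JT k ε A s)⁻¹ *
      ∑ z ∈ Zf (k+2) ε R, (kern (ε/4) (x - lpt ε z) - lay k A s (x - lpt ε z)) := by
  have hb : ∀ z : Fin (k+2) → ℤ, ContDiffAt ℝ 2 (fun y => bump1 k ε A s (y - lpt ε z)) x := fun z =>
    ((G.bump_smooth.comp (contDiff_id.sub contDiff_const)).of_le two_le_inf).contDiffAt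
  have hs : ContDiffAt ℝ 2 (fun y => ∑ z ∈ Zf (k+2) ε R, bump1 k ε A s (y - lpt ε z)) x :=
    ContDiffAt.sum fun z _ => hb z
  unfold HH
  rw [lap_sub contDiffAt_const (contDiffAt_const.mul hs), lap_const, lap_const_mul _ hs,
    lap_sum _ _ fun z _ => hb z]
  simp only [lap_comp_sub, G.lap_bump]
  ring

lemma HH_cases (G : Good k ε A s) (x : Eucl (k+2)) :
    (∃ z ∈ Zf (k+2) ε R, ‖x - lpt ε z‖ < ε/2 ∧
      HH k ε A s R x = 1 - (JT k ε A s)⁻¹ * bump1 k ε A s (x - lpt ε z)) ∨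
    ((∀ z ∈ Zf (k+2) ε R, ε/2 ≤ ‖x - lpt ε z‖) ∧ HH k ε A s R x = 1) := by
  rcases cell_sum G.hε (Zf (k+2) ε R) (bump1 k ε A s)
    (fun y hy => G.bump_zero (by linarith [G.hε])) x with ⟨z, hz, h, e⟩ | ⟨h, e⟩
  · exact Or.inl ⟨z, hz, h, by rw [HH, e]⟩
  · exact Or.inr ⟨h, by rw [HH, e]; ring⟩

lemma HH_le (G : Good k ε A s) (x : Eucl (k+2)) : HH k ε A s R x ≤ 1 := by
  have := G.JT_pos
  rcases G.HH_cases (R := R) x with ⟨z, _, _, e⟩ | ⟨_, e⟩ <;> rw [e]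
  have := G.bump_nonneg (x - lpt ε z)
  have : 0 ≤ (JT k ε A s)⁻¹ * bump1 k ε A s (x - lpt ε z) := by positivity
  linarith

lemma HH_nonneg (G : Good k ε A s) (x : Eucl (k+2)) : 0 ≤ HH k ε A s R x := by
  have hJ := G.JT_pos
  rcases G.HH_cases (R := R) x with ⟨z, _, _, e⟩ | ⟨_, e⟩ <;> rw [e]
  · have := G.bump_le (x - lpt ε z)
    have : (JT k ε A s)⁻¹ * bump1 k ε A s (x - lpt ε z) ≤ 1 := by
      rw [inv_mul_le_iff₀ hJ]; linarith
    linarith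
  · norm_num

lemma HH_zero (G : Good k ε A s) {x : Eucl (k+2)} {z : Fin (k+2) → ℤ} (hz : z ∈ Zf (k+2) ε R)
    (hx : ‖x - lpt ε z‖ < ε/2)
    (ht : x - lpt ε z ≠ 0 → (1 - s) * (A⁻¹)^k ≤ tau (x - lpt ε z)) : HH k ε A s R x = 0 := by
  have hJ := G.JT_pos
  rcases G.HH_cases (R := R) x with ⟨w, _, h, e⟩ | ⟨h, e⟩
  · have : w = z := by
      by_contra hne
      have := lp_sep' G.hε hne hx
      linarith
    rw [e, this, G.bump_top ht, inv_mul_cancel₀ hJ.ne']; ring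
  · linarith [h z hz]

end Good
end corr
end

section
/-- intermediate scale -/
def bb (k : ℕ) (ε : ℝ) : ℝ := ε ^ (((k:ℝ) + 1) / k)

lemma bb_pos {k : ℕ} {ε : ℝ} (hε : 0 < ε) : 0 < bb k ε := Real.rpow_pos_of_pos hε _

lemma bb_pow {k : ℕ} (hk : 1 ≤ k) {ε : ℝ} (hε : 0 < ε) : bb k ε ^ k = ε^(k+1) := by
  have hk' : (k:ℝ) ≠ 0 := by exact_mod_cast (by omega : k ≠ 0)
  rw [bb, ← Real.rpow_natCast, ← Real.rpow_mul hε.le, div_mul_cancel₀ _ hk', ← Real.rpow_natCast]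
  push_cast; rfl

lemma aStar_pow {k : ℕ} (hk : 1 ≤ k) {ε : ℝ} (hε : 0 < ε) : aStar (k+2) ε ^ k = ε^(k+2) := by
  have hk' : (k:ℝ) ≠ 0 := by exact_mod_cast (by omega : k ≠ 0)
  rw [aStar, ← Real.rpow_natCast, ← Real.rpow_mul hε.le, ← Real.rpow_natCast]
  congr 1
  push_cast
  rw [show (k:ℝ) + 2 - 2 = k by ring, div_mul_cancel₀ _ hk']

lemma le_of_pow {k : ℕ} (hk : 1 ≤ k) {x y : ℝ} (hy : 0 ≤ y) (h : x^k ≤ y^k) : x ≤ y :=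
  le_of_pow_le_pow_left₀ (by omega) hy h

lemma bb_small {k : ℕ} (hk : 1 ≤ k) {ε L : ℝ} (hε : 0 < ε) (hL : 0 < L) (h : L^k * ε ≤ 1) :
    L * bb k ε ≤ ε := by
  apply le_of_pow hk hε.le
  rw [mul_pow, bb_pow hk hε, pow_succ]
  have : 0 < ε^k := by positivity
  nlinarith

namespace EV
variable {k : ℕ} {Ω : Set (Eucl (k+2))} {p c₀ C₀ : ℝ} {a : ℝ → ℝ} {Φ : ℝ → Eucl (k+2) → ℝ}
  {ε : ℝ}

lemma a_pow (H : EV k Ω p c₀ C₀ a Φ) (hε : ε ∈ Ioo (0:ℝ) 1) : a ε ^ k ≤ C₀^k * ε^(k+2) := by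
  have h := H.hC₀
  calc a ε ^ k ≤ (C₀ * aStar (k+2) ε)^k :=
      pow_le_pow_left₀ (H.a_pos hε).le (H.haε ε hε).2 k
    _ = _ := by rw [mul_pow, aStar_pow H.hk hε.1]

/-- all smallness conditions on `ε` -/
lemma good_ev (H : EV k Ω p c₀ C₀ a Φ) : ∃ ε₀ > (0:ℝ), ε₀ ≤ 1 ∧ ∀ ε ∈ Ioo (0:ℝ) ε₀, ∀ s > (0:ℝ), s ≤ 1/4 →
    Good k ε (a ε) s := by
  set D := 8 * 8^k * C₀^k
  have hC := H.hC₀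
  have hk := H.hk
  have hD : 0 < D := by positivity
  refine ⟨1/(D+1), by positivity, by rw [div_le_one (by positivity)]; linarith, ?_⟩
  rintro ε ⟨h0, h1⟩ s hs hs4
  rw [lt_div_iff₀ (by positivity)] at h1
  have hε1 : ε < 1 := by nlinarith
  have hε : ε ∈ Ioo (0:ℝ) 1 := ⟨h0, hε1⟩
  have hDε : D * ε^2 ≤ 1 := by nlinarith
  have ha := H.a_pos hε
  have hap := H.a_pow hε
  have key : 8 * 8^k * a ε ^ k ≤ ε^k := by
    calc 8 * 8^k * a ε ^ k ≤ 8 * 8^k * (C₀^k * ε^(k+2)) := by gcongr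
      _ = (D * ε^2) * ε^k := by simp only [D]; rw [pow_add]; ring
      _ ≤ 1 * ε^k := by gcongr
      _ = ε^k := one_mul _
  refine ⟨hk, h0, ha, hs, hs4, ?_, ?_⟩
  · apply le_of_pow hk h0.le
    rw [mul_pow]
    have : 0 < 8^k * a ε ^ k := by positivity
    linarith
  · have h5 : (1/2:ℝ) ≤ 1 - 2*s := by linarith
    have h6 : 4 * ((ε/4)⁻¹)^k ≤ (1/2) * ((a ε)⁻¹)^k := by
      rw [inv_pow, inv_pow, div_pow, inv_div]
      rw [← sub_nonneg]
      have e : 1 / 2 * (a ε ^ k)⁻¹ - 4 * (4 ^ k / ε ^ k) = (ε^k - 8 * 4^k * a ε ^k) / (2 * a ε ^ k * ε^k) := by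
        field_simp; ring
      rw [e]
      apply div_nonneg _ (by positivity)
      have : (4:ℝ)^k ≤ 8^k := by gcongr; norm_num
      have : 8 * 4^k * a ε ^ k ≤ 8 * 8^k * a ε ^ k := by gcongr
      linarith
    exact h6.trans (by gcongr)

/-- corrector is close to one off the intermediate holes -/
lemma HH_off (H : EV k Ω p c₀ C₀ a Φ) (hε : ε ∈ Ioo (0:ℝ) 1) {s R : ℝ} (G : Good k ε (a ε) s) {x : Eucl (k+2)}
    (hx : x ∉ holes (k+2) ε (bb k ε)) : 1 - 4 * C₀^k * ε ≤ HH k ε (a ε) s R x := by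
  have hC := H.hC₀
  have h0 := hε.1
  have hJ := G.JT_pos
  rcases G.HH_cases (R := R) x with ⟨z, hz, h, e⟩ | ⟨h, e⟩ <;> rw [e]
  · have hb : bb k ε < ‖x - lpt ε z‖ := by
      by_contra hcon
      exact hx (mem_holes.2 ⟨_, lp_mem ε z, not_lt.1 hcon⟩)
    have hbp := bb_pos (k := k) h0
    have hne : x - lpt ε z ≠ 0 := norm_pos_iff.1 (hbp.trans hb)
    have h1 := G.bump_le_tau hne
    have h2 := (tau_le_iff hbp G.hk hne).2 hb.le
    have h3 := G.JTinv_le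
    have h4 := H.a_pow hε
    have h5 : (JT k ε (a ε) s)⁻¹ * bump1 k ε (a ε) s (x - lpt ε z) ≤ 4 * (C₀^k * ε^(k+2)) * ((bb k ε)⁻¹)^k := by
      have := G.bump_nonneg (x - lpt ε z)
      apply mul_le_mul (h3.trans (by linarith)) (h1.trans h2) this (by positivity)
    have h6 : 4 * (C₀^k * ε^(k+2)) * ((bb k ε)⁻¹)^k = 4 * C₀^k * ε := by
      rw [inv_pow, bb_pow G.hk h0, pow_succ ε (k+1)]
      field_simp
    linarith
  · have : 0 < 4 * C₀^k * ε := by positivity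
    linarith

lemma lap_HH_ge (H : EV k Ω p c₀ C₀ a Φ) : ∃ C ≥ (0:ℝ), ∀ ε ∈ Ioo (0:ℝ) 1, ∀ s R, Good k ε (a ε) s →
    (∀ x, - C ≤ lap (HH k ε (a ε) s R) x) ∧
    ∀ x, (JT k ε (a ε) s)⁻¹ * ∑ z ∈ Zf (k+2) ε R, kern (ε/4) (x - lpt ε z) ≤ C := by
  obtain ⟨C, hC0, hC⟩ := kern_bound H.hk
  have hCC := H.hC₀
  set CL := 4 * C₀^k * C * 4^(k+2)
  refine ⟨CL, by positivity, ?_⟩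
  intro ε hε s R G
  have h0 := hε.1
  have hJ := G.JT_pos
  have key : ∀ x, (JT k ε (a ε) s)⁻¹ * ∑ z ∈ Zf (k+2) ε R, kern (ε/4) (x - lpt ε z) ≤ CL := by
    intro x
    have h1 : ∑ z ∈ Zf (k+2) ε R, kern (ε/4) (x - lpt ε z) ≤ C * ((ε/4)⁻¹)^(k+2) := by
      rcases cell_sum h0 (Zf (k+2) ε R) (kern (ε/4))
        (fun y hy => ker_zero H.hk (by linarith) (by linarith)) x with ⟨z, hz, h, e⟩ | ⟨h, e⟩ <;> rw [e]
      · exact hC _ (by linarith) _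
      · positivity
    have h2 : 0 ≤ ∑ z ∈ Zf (k+2) ε R, kern (ε/4) (x - lpt ε z) :=
      Finset.sum_nonneg fun z _ => ker_nonneg (by linarith) _
    have h3 := G.JTinv_le
    have h4 := H.a_pow hε
    calc _ ≤ (4 * (C₀^k * ε^(k+2))) * (C * ((ε/4)⁻¹)^(k+2)) := by
          apply mul_le_mul (h3.trans (by linarith)) h1 h2 (by positivity)
      _ = CL := by
        simp only [CL]; rw [inv_pow, div_pow, inv_div]; field_simp
  refine ⟨fun x => ?_, key⟩
  rw [G.lap_HH]
  have h1 := key x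
  have h2 : 0 ≤ (JT k ε (a ε) s)⁻¹ * ∑ z ∈ Zf (k+2) ε R, Good.lay k (a ε) s (x - lpt ε z) :=
    mul_nonneg (by positivity) (Finset.sum_nonneg fun z _ => G.lay_nonneg _)
  rw [Finset.sum_sub_distrib]
  linarith

/-- the corrector vanishes in a neighbourhood of the holes -/
lemma HH_hole (H : EV k Ω p c₀ C₀ a Φ) (hε : ε ∈ Ioo (0:ℝ) 1) {s R : ℝ} (G : Good k ε (a ε) s) {x : Eucl (k+2)}
    (hx : x ∈ holes (k+2) ε (a ε)) (hR : ‖x‖ + 1 ≤ R) : ∀ᶠ y in 𝓝 x, HH k ε (a ε) s R y = 0 := by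
  obtain ⟨m, hm, hxm⟩ := mem_holes.1 hx
  obtain ⟨z, rfl⟩ := exists_lp hm
  have ha := G.hA
  have h8 := G.h8
  have h0 := hε.1
  have h1 := hε.2
  have hz : z ∈ Zf (k+2) ε R := by
    apply mem_Zf h0
    have : ‖lpt ε z‖ ≤ ‖x‖ + ‖x - lpt ε z‖ := by
      rw [norm_sub_rev]
      have := norm_add_le x (lpt ε z - x)
      simpa using this
    linarith
  have hap : 0 < ((a ε)⁻¹)^k := by positivity
  have hs := G.hs
  have hlt : (1 - s) * ((a ε)⁻¹)^k < ((a ε)⁻¹)^k := by nlinarith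
  have e1 : ∀ᶠ y in 𝓝 x, ‖y - lpt ε z‖ < ε/2 := by
    have : Continuous fun y => ‖y - lpt ε z‖ := by fun_prop
    exact this.continuousAt.eventually_lt_const (by linarith)
  have e2 : ∀ᶠ y in 𝓝 x, y - lpt ε z ≠ 0 → (1 - s) * ((a ε)⁻¹)^k ≤ tau (y - lpt ε z) := by
    have hc : Tendsto (fun y => y - lpt ε z) (𝓝 x) (𝓝 (x - lpt ε z)) :=
      (by fun_prop : Continuous fun y => y - lpt ε z).continuousAt
    by_cases hxz : x - lpt ε z = 0
    · rw [hxz] at hc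
      exact hc.eventually (tau_tendsto G.hk _)
    · have h2 := (tau_ge_iff ha G.hk hxz).2 hxm
      have h3 : ContinuousAt tau (x - lpt ε z) := (tau_smooth hxz).continuousAt
      have h4 : Tendsto (fun y => tau (y - lpt ε z)) (𝓝 x) (𝓝 (tau (x - lpt ε z))) := h3.tendsto.comp hc
      filter_upwards [h4.eventually_const_lt (hlt.trans_le h2)] with y hy _ using hy.le
  filter_upwards [e1, e2] with y h1 h2 using G.HH_zero hz h1 h2

/-- locally uniform lower bound -/
lemma lower (H : EV k Ω p c₀ C₀ a Φ) {x0 : Eucl (k+2)} (hx0 : x0 ∈ Ω) :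
    ∃ c > (0:ℝ), ∃ r > (0:ℝ), ∃ ε₀ > (0:ℝ), ∀ ε ∈ Ioo (0:ℝ) ε₀, ∀ x, ‖x - x0‖ < r →
      x ∉ holes (k+2) ε (bb k ε) → c ≤ Φ ε x := by
  obtain ⟨ε₀, hε₀, hε₀1, hG⟩ := H.good_ev
  obtain ⟨CL, hCL, hlap⟩ := H.lap_HH_ge
  obtain ⟨ρ, hρ1, hρ⟩ := H.exists_rho
  obtain ⟨r, hr, hball⟩ := Metric.isOpen_iff.1 H.hΩo x0 hx0
  have hCC := H.hC₀
  have hp0 := H.hp0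
  have hp1 := H.hp1
  obtain ⟨j, hj⟩ := exists_nat_ge (1/(1-p))
  rw [div_le_iff₀ (by linarith)] at hj
  have hj1 : 1 ≤ j := by
    by_contra h
    have : j = 0 := by omega
    rw [this] at hj; norm_num at hj
  set r' := r/2
  have hr' : 0 < r' := by positivity
  set C := CL + 2 * (k+2) / r'^2
  have hC : 0 < C := by
    have : 0 < 2 * ((k:ℝ)+2) / r'^2 := by positivity
    linarith
  set T := (j * C)^(1/(1-p))
  have hjp : (0:ℝ) < j := by exact_mod_cast hj1
  have hT : 0 < T := by positivity
  refine ⟨(1/4)^j / T, by positivity, r'/2, by positivity, min ε₀ (1/(16*C₀^k)), by positivity, ?_⟩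
  rintro ε ⟨h0, hlt⟩ x hx hxb
  have hε : ε ∈ Ioo (0:ℝ) 1 := ⟨h0, by linarith [min_le_left ε₀ (1/(16*C₀^k))]⟩
  have G : Good k ε (a ε) (1/4) :=
    hG ε ⟨h0, hlt.trans_le (min_le_left _ _)⟩ _ (by norm_num) le_rfl
  have hCε : C₀^k * ε ≤ 1/16 := by
    have := (hlt.trans_le (min_le_right _ _)).le
    rw [le_div_iff₀ (by positivity)] at this
    linarith
  set R := ρ + 1
  set h := HH k ε (a ε) (1/4) R
  have hhs : ContDiff ℝ 2 h := G.HH_smooth.of_le two_le_inf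
  set w : Eucl (k+2) → ℝ := fun y => (h y - 1/4) - (1/r'^2) * ‖y - x0‖^2
  have hsq : ContDiff ℝ 2 (fun y : Eucl (k+2) => ‖y - x0‖^2) := (sqd_smooth x0).of_le two_le_inf
  have hws : ContDiff ℝ 2 w := (hhs.sub contDiff_const).sub (contDiff_const.mul hsq)
  have hw1 : ∀ y, w y ≤ 1 := by
    intro y
    have : 0 ≤ (1/r'^2) * ‖y - x0‖^2 := by positivity
    have := G.HH_le (R := R) y
    simp only [w]; linarith
  have hlapw : ∀ y, - C ≤ lap w y := by
    intro y
    have h1 := (hlap ε hε (1/4) R G).1 y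
    simp only [w]
    rw [lap_sub (hhs.sub contDiff_const).contDiffAt (contDiff_const.mul hsq).contDiffAt,
      lap_sub hhs.contDiffAt contDiffAt_const, lap_const, lap_const_mul _ hsq.contDiffAt, lap_sqd]
    simp only [C]
    push_cast
    have : 1 / r' ^ 2 * (2 * ((k:ℝ) + 2)) = 2 * (k+2) / r'^2 := by ring
    linarith
  have hwball : ∀ y, 0 ≤ w y → ‖y - x0‖ < r' := by
    intro y hy
    by_contra hcon
    push Not at hcon
    have : 1 ≤ (1/r'^2) * ‖y - x0‖^2 := by
      rw [one_div, ← div_eq_inv_mul, le_div_iff₀ (by positivity)]; nlinarith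
    have := G.HH_le (R := R) y
    simp only [w, h] at hy; linarith
  set K := {y | 0 ≤ w y}
  have hKc : IsCompact K := by
    refine (isCompact_closedBall x0 r').of_isClosed_subset (isClosed_le continuous_const hws.continuous) ?_
    intro y hy
    rw [mem_closedBall, dist_eq_norm]
    exact (hwball y hy).le
  have hKΦ : ∀ y ∈ K, 0 < Φ ε y := by
    intro y hy
    rw [H.pos_iff hε]
    have hyΩ : y ∈ Ω := hball (by
      rw [mem_ball, dist_eq_norm]; have := hwball y hy; simp only [r'] at this; linarith)
    refine ⟨hyΩ, fun hyh => ?_⟩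
    have h1 : ‖y‖ + 1 ≤ R := by
      have := mem_ball_zero_iff.1 (hρ hyΩ)
      simp only [R]; linarith
    have h2 := (H.HH_hole hε G hyh h1).self_of_nhds
    have : 0 ≤ (1/r'^2) * ‖y - x0‖^2 := by positivity
    have hy' : 0 ≤ w y := hy
    simp only [w, h, h2] at hy'
    linarith
  have hwx : 1/4 ≤ w x := by
    have h1 := H.HH_off (R := R) hε G hxb
    have h2 : (1/r'^2) * ‖x - x0‖^2 ≤ 1/4 := by
      rw [one_div, ← div_eq_inv_mul, div_le_iff₀ (by positivity)]
      have := norm_nonneg (x - x0)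
      nlinarith
    simp only [w, h]
    linarith
  have hxK : x ∈ K := by show 0 ≤ w x; linarith
  obtain ⟨y, hyK, hymax⟩ := hKc.exists_isMaxOn ⟨x, hxK⟩
    (f := fun y => w y ^ j / Φ ε y)
    ((hws.continuous.pow j).continuousOn.div (H.cont hε).continuousOn fun y hy => (hKΦ y hy).ne')
  set t := w y ^ j / Φ ε y
  have hty : w x ^ j / Φ ε x ≤ t := hymax hxK
  have ht : 0 < t := lt_of_lt_of_le (div_pos (by positivity) (hKΦ x hxK)) hty
  have hΦy := hKΦ y hyK
  have hwy : 0 < w y := by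
    have h1 : 0 ≤ w y := hyK
    rcases h1.lt_or_eq with h | h
    · exact h
    · exfalso
      simp only [t, ← h] at ht
      rw [zero_pow (by omega), zero_div] at ht
      exact lt_irrefl _ ht
  set u : Eucl (k+2) → ℝ := fun y' => w y' ^ j - t * Φ ε y'
  have huy : u y = 0 := by simp only [u, t]; field_simp; ring
  have hlm : IsLocalMax u y := by
    have : ∀ᶠ y' in 𝓝 y, 0 < w y' := hws.continuous.continuousAt.eventually_const_lt hwy
    filter_upwards [this] with y' hy'
    have h1 : w y' ^ j / Φ ε y' ≤ t := hymax (show y' ∈ K from hy'.le)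
    rw [div_le_iff₀ (hKΦ y' hy'.le)] at h1
    rw [huy]; simp only [u]; linarith
  have hc2 := H.c2 hε hΦy
  have hpw : ContDiff ℝ 2 (fun y' => w y' ^ j) := hws.pow j
  have hl := lap_local_max hlm (hpw.contDiffAt.sub (contDiffAt_const.mul hc2))
  simp only [u] at hl
  rw [lap_sub hpw.contDiffAt (contDiffAt_const.mul hc2), lap_const_mul _ hc2, H.lapΦ hε hΦy,
    lap_comp (g := fun t => t^j) (contDiff_id.pow j).contDiffAt hws.contDiffAt] at hl
  have hd1 : deriv (fun t : ℝ => t^j) = fun t => (j:ℝ) * t^(j-1) := by ext t; simp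
  have hd2 : 0 ≤ deriv (deriv (fun t : ℝ => t^j)) (w y) := by
    rw [hd1]
    rw [deriv_const_mul _ (by fun_prop)]
    simp only [deriv_pow_field]
    positivity
  have hg := mul_nonneg hd2 (gsq_nonneg w y)
  rw [hd1] at hl
  rw [hd1] at hg
  have h3 : (j:ℝ) * w y^(j-1) * (-C) ≤ (j:ℝ) * w y^(j-1) * lap w y :=
    mul_le_mul_of_nonneg_left (hlapw y) (by positivity)
  have h4 : t * Φ ε y ^ p ≤ j * C * w y ^ (j-1) := by linarith
  have hΦe : Φ ε y = w y ^ j / t := by simp only [t]; field_simp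
  rw [hΦe, Real.div_rpow (by positivity) ht.le] at h4
  have h5 : w y ^ (j-1) ≤ (w y ^ j)^p := by
    rw [← Real.rpow_natCast, ← Real.rpow_natCast, ← Real.rpow_mul hwy.le]
    apply Real.rpow_le_rpow_of_exponent_ge hwy (hw1 y)
    rw [Nat.cast_sub hj1]; push_cast; linarith
  have h6 : t * ((w y ^ j)^p / t^p) = t^(1-p) * (w y ^ j)^p := by
    rw [Real.rpow_sub ht, Real.rpow_one]; field_simp
  rw [h6] at h4
  have h7 : t^(1-p) ≤ j * C := by
    have hq : 0 < (w y ^ j)^p := by positivity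
    have : t^(1-p) * (w y ^ j)^p ≤ (j * C) * (w y ^ j)^p :=
      h4.trans (mul_le_mul_of_nonneg_left h5 (by positivity))
    exact le_of_mul_le_mul_right this hq
  have h8 : t ≤ T := by
    have := Real.rpow_le_rpow (by positivity) h7 (by apply div_nonneg <;> linarith : 0 ≤ 1/(1-p))
    rwa [← Real.rpow_mul ht.le, mul_one_div_cancel (by linarith), Real.rpow_one] at this
  have h9 := hty.trans h8
  have hΦx := hKΦ x hxK
  rw [div_le_iff₀ hΦx] at h9
  rw [div_le_iff₀ hT]
  have : (1/4:ℝ)^j ≤ w x ^ j := by gcongr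
  linarith
end EV
end

section
namespace EV
variable {k : ℕ} {Ω : Set (Eucl (k+2))} {p c₀ C₀ : ℝ} {a : ℝ → ℝ} {Φ : ℝ → Eucl (k+2) → ℝ}
  {ε : ℝ}

lemma int_kern (H : EV k Ω p c₀ C₀ a Φ) (hε : ε ∈ Ioo (0:ℝ) 1) {r : ℝ} (hr : 0 < r) (x : Eucl (k+2)) :
    Integrable fun y => Φ ε y * kern r (y - x) :=
  int_mul_supp (ker_sub_cont H.hk hr x) (ker_hcs H.hk hr x) fun y _ => (H.cont hε).continuousAt

lemma rpow_le_M (H : EV k Ω p c₀ C₀ a Φ) {M t : ℝ} (hM1 : 1 ≤ M) (h0 : 0 ≤ t) (ht : t ≤ M) : t ^ p ≤ M :=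
  calc t^p ≤ M^p := Real.rpow_le_rpow h0 ht H.hp0.le
    _ ≤ M^(1:ℝ) := Real.rpow_le_rpow_of_exponent_le hM1 H.hp1.le
    _ = M := Real.rpow_one M

lemma mean_upper (H : EV k Ω p c₀ C₀ a Φ) {M : ℝ} (hM1 : 1 ≤ M) (hM : ∀ ε ∈ Ioo (0:ℝ) 1, ∀ x, Φ ε x ≤ M)
    (hε : ε ∈ Ioo (0:ℝ) 1) {r : ℝ} (hr : 0 < r) (x : Eucl (k+2)) :
    kap k * Φ ε x ≤ (∫ y, Φ ε y * kern r (y - x)) + M * (Cb k * r^2) := by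
  have := smv H.hk hr (by linarith : 0 ≤ M) (v := Φ ε) (x := x)
    (fun y _ => (H.cont hε).continuousAt) (fun y _ hy => ⟨H.c2 hε hy, by
      rw [H.lapΦ hε hy]
      linarith [H.rpow_le_M hM1 hy.le (hM ε hε y)]⟩)
  simpa [max_eq_left (H.nonneg hε _)] using this

lemma mean_lower (H : EV k Ω p c₀ C₀ a Φ) {M : ℝ} (hM1 : 1 ≤ M) (hM : ∀ ε ∈ Ioo (0:ℝ) 1, ∀ x, Φ ε x ≤ M) :
    ∃ C ≥ (0:ℝ), ∃ ε₀ > (0:ℝ), ∀ ε ∈ Ioo (0:ℝ) ε₀, ∀ r > (0:ℝ), ∀ x, closedBall x r ⊆ Ω →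
      x ∉ holes (k+2) ε (bb k ε) →
      (∫ y, Φ ε y * kern r (y - x)) - C * (r^2 + ε) ≤ kap k * Φ ε x := by
  obtain ⟨ε₀, hε₀, hε₀1, hG⟩ := H.good_ev
  obtain ⟨CL, hCL, hlap⟩ := H.lap_HH_ge
  obtain ⟨ρ, hρ1, hρ⟩ := H.exists_rho
  have hC := H.hC₀
  have hkp := kap_pos H.hk
  have hCb := Cb_nonneg (k := k)
  refine ⟨M * CL * Cb k + kap k * M * (4 * C₀^k), by positivity, ε₀, hε₀, ?_⟩
  rintro ε ⟨h0, hlt⟩ r hr x hball hxb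
  have hε : ε ∈ Ioo (0:ℝ) 1 := ⟨h0, by linarith⟩
  have G : Good k ε (a ε) (1/4) := hG ε ⟨h0, hlt⟩ _ (by norm_num) le_rfl
  set h := HH k ε (a ε) (1/4) (ρ+1)
  have hhs : ContDiff ℝ 2 h := G.HH_smooth.of_le two_le_inf
  set v : Eucl (k+2) → ℝ := fun y => M * h y - Φ ε y
  have hvc : Continuous v := (continuous_const.mul hhs.continuous).sub (H.cont hε)
  have key := smv H.hk hr (by positivity : 0 ≤ M * CL) (v := v) (x := x)
    (fun y _ => hvc.continuousAt) (fun y hy hvy => by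
      have hyΩ := hball hy
      have hyh : y ∉ holes (k+2) ε (a ε) := by
        intro hyh
        have h1 : ‖y‖ + 1 ≤ ρ + 1 := by
          have := mem_ball_zero_iff.1 (hρ hyΩ); linarith
        have h2 := (H.HH_hole hε G hyh h1).self_of_nhds
        have h3 := H.zero_hole hε hyh
        simp only [v, h, h2, h3] at hvy
        norm_num at hvy
      have hΦy := (H.pos_iff hε y).2 ⟨hyΩ, hyh⟩
      have hc2 := H.c2 hε hΦy
      refine ⟨(contDiff_const.mul hhs).contDiffAt.sub hc2, ?_⟩
      simp only [v]
      rw [lap_sub (contDiff_const.mul hhs).contDiffAt hc2, lap_const_mul _ hhs.contDiffAt,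
        H.lapΦ hε hΦy]
      have h1 := (hlap ε hε (1/4) (ρ+1) G).1 y
      have h2 : 0 ≤ Φ ε y ^ p := by positivity
      have h3 : M * (-CL) ≤ M * lap h y := mul_le_mul_of_nonneg_left h1 (by linarith)
      linarith)
  have hintg : ∫ y, max (v y) 0 * kern r (y - x) ≤ ∫ y, (M - Φ ε y) * kern r (y - x) := by
    refine integral_mono ?_ ?_ fun y => ?_
    · exact int_mul_supp (ker_sub_cont H.hk hr x) (ker_hcs H.hk hr x) fun y _ =>
        (hvc.max continuous_const).continuousAt
    · exact int_mul_supp (f := fun y => M - Φ ε y) (ker_sub_cont H.hk hr x) (ker_hcs H.hk hr x) fun y _ =>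
        (continuous_const.sub (H.cont hε)).continuousAt
    · refine mul_le_mul_of_nonneg_right (max_le ?_ ?_) (ker_nonneg hr _)
      · have := G.HH_le (R := ρ+1) y
        simp only [v, h]; nlinarith
      · linarith [hM ε hε y]
  have hint2 : ∫ y, (M - Φ ε y) * kern r (y - x) = M * kap k - ∫ y, Φ ε y * kern r (y - x) := by
    simp only [sub_mul]
    rw [integral_sub (int_mul_supp (ker_sub_cont H.hk hr x) (ker_hcs H.hk hr x) fun y _ => continuousAt_const) (H.int_kern hε hr x), integral_const_mul, ker_integral H.hk hr]
  have h1 : kap k * v x ≤ kap k * max (v x) 0 := mul_le_mul_of_nonneg_left (le_max_left _ _) hkp.le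
  have h2 := H.HH_off (R := ρ+1) hε G hxb
  have h3 : kap k * M * (1 - 4 * C₀^k * ε) ≤ kap k * M * h x := mul_le_mul_of_nonneg_left h2 (by positivity)
  have h4 : kap k * v x = kap k * M * h x - kap k * Φ ε x := by simp only [v]; ring
  have h5 : 0 ≤ kap k * M * (4 * C₀^k) * r^2 := by positivity
  have h6 : 0 ≤ M * CL * Cb k * ε := by positivity
  linarith

/-- equicontinuity of the averages -/
lemma mean_equi (H : EV k Ω p c₀ C₀ a Φ) {M : ℝ} (hM1 : 1 ≤ M) (hM : ∀ ε ∈ Ioo (0:ℝ) 1, ∀ x, Φ ε x ≤ M)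
    {r : ℝ} (hr : 0 < r) {η : ℝ} (hη : 0 < η) : ∃ d > (0:ℝ), ∀ ε ∈ Ioo (0:ℝ) 1, ∀ x x' : Eucl (k+2),
      ‖x - x'‖ < d → |(∫ y, Φ ε y * kern r (y - x)) - ∫ y, Φ ε y * kern r (y - x')| ≤ η := by
  have huc : UniformContinuous (kern r : Eucl (k+2) → ℝ) := by
    have h := ker_hcs H.hk hr (0 : Eucl (k+2))
    simp only [sub_zero] at h
    exact h.uniformContinuous_of_continuous (ker_cont H.hk hr)
  set V := volume.real (closedBall (0 : Eucl (k+2)) (r+1))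
  have hV : 0 ≤ V := measureReal_nonneg
  set η' := η / (M * V + 1)
  have hη' : 0 < η' := by positivity
  obtain ⟨d, hd, hdk⟩ := Metric.uniformContinuous_iff.1 huc η' hη'
  refine ⟨min d 1, by positivity, ?_⟩
  intro ε hε x x' hx
  rw [← integral_sub (H.int_kern hε hr x) (H.int_kern hε hr x')]
  have hz : ∀ y ∉ closedBall x (r+1), Φ ε y * kern r (y - x) - Φ ε y * kern r (y - x') = 0 := by
    intro y hy
    rw [mem_closedBall, dist_eq_norm, not_le] at hy
    have h1 : ‖y - x‖ ≤ ‖y - x'‖ + ‖x - x'‖ := by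
      rw [norm_sub_rev x x']
      have := norm_add_le (y - x') (x' - x); simpa using this
    have h2 := hx.trans_le (min_le_right _ _)
    rw [ker_zero H.hk hr (by linarith), ker_zero H.hk hr (by linarith)]; ring
  rw [← setIntegral_eq_integral_of_forall_compl_eq_zero hz]
  have := norm_setIntegral_le_of_norm_le_const (μ := volume) (s := closedBall x (r+1)) (C := M * η')
    (f := fun y => Φ ε y * kern r (y - x) - Φ ε y * kern r (y - x'))
    (isCompact_closedBall _ _).measure_lt_top (fun y _ => by
      rw [← mul_sub, norm_mul, Real.norm_eq_abs, abs_of_nonneg (H.nonneg hε y)]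
      have h3 : dist (kern r (y - x)) (kern r (y - x')) < η' := by
        apply hdk
        rw [dist_eq_norm]
        have : y - x - (y - x') = x' - x := by abel
        rw [this, norm_sub_rev]
        exact hx.trans_le (min_le_left _ _)
      rw [dist_eq_norm] at h3
      exact mul_le_mul (hM ε hε y) h3.le (norm_nonneg _) (by linarith))
  rw [Real.norm_eq_abs] at this
  refine this.trans ?_
  have hVe : volume.real (closedBall x (r+1)) = V := by
    simp only [V, measureReal_def]
    rw [Measure.addHaar_closedBall_center volume x]
  rw [hVe]
  simp only [η']
  have : M * (η / (M * V + 1)) * V = η * (M * V / (M * V + 1)) := by ring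
  rw [this]
  have h4 : M * V / (M * V + 1) ≤ 1 := by
    rw [div_le_one (by positivity)]; linarith
  nlinarith

lemma equi (H : EV k Ω p c₀ C₀ a Φ) {η : ℝ} (hη : 0 < η) : ∃ d > (0:ℝ), ∃ ε₁ > (0:ℝ), ε₁ ≤ 1 ∧ 
    ∀ ε ∈ Ioo (0:ℝ) ε₁, ∀ x x' : Eucl (k+2), x ∉ holes (k+2) ε (bb k ε) → x' ∉ holes (k+2) ε (bb k ε) →
      ‖x - x'‖ < d → |Φ ε x - Φ ε x'| ≤ η := by
  obtain ⟨M, hM1, hM⟩ := H.bound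
  obtain ⟨C, hC, ε₀, hε₀, hlow⟩ := H.mean_lower hM1 hM
  obtain ⟨rb, hrb, hb⟩ := H.bdry hη
  have hkp := kap_pos H.hk
  have hCb := Cb_nonneg (k := k)
  set η' := kap k * η / 8
  have hη' : 0 < η' := by positivity
  set C' := C + M * Cb k + 1
  have hC' : 0 < C' := by positivity
  set r := min (rb/4) (min 1 (η'/C'))
  have hr : 0 < r := by positivity
  have hr2 : C' * r^2 ≤ η' := by
    have h1 : r ≤ 1 := (min_le_right _ _).trans (min_le_left _ _)
    have h2 : r ≤ η'/C' := (min_le_right _ _).trans (min_le_right _ _)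
    rw [le_div_iff₀ hC'] at h2
    nlinarith
  obtain ⟨d, hd, hdm⟩ := H.mean_equi hM1 hM hr hη'
  refine ⟨min d r, by positivity, min (min ε₀ 1) (η'/C'), by positivity,
    (min_le_left _ _).trans (min_le_right _ _), ?_⟩
  rintro ε ⟨h0, hlt⟩ x x' hx hx' hxx
  have hε : ε ∈ Ioo (0:ℝ) 1 := ⟨h0, hlt.trans_le ((min_le_left _ _).trans (min_le_right _ _))⟩
  have hε0 : ε ∈ Ioo (0:ℝ) ε₀ := ⟨h0, hlt.trans_le ((min_le_left _ _).trans (min_le_left _ _))⟩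
  have hCε : C' * ε ≤ η' := by
    have := (hlt.trans_le (min_le_right _ _)).le
    rw [le_div_iff₀ hC'] at this
    linarith
  have hdr : ‖x - x'‖ < r := hxx.trans_le (min_le_right _ _)
  have hrr : r ≤ rb/4 := min_le_left _ _
  have hbd : ∀ z ∉ Ω, dist x z ≤ 2 * r → dist x' z ≤ 2 * r → |Φ ε x - Φ ε x'| ≤ η := by
    intro z hz h1 h2
    have e1 := hb ε hε x z hz (by linarith)
    have e2 := hb ε hε x' z hz (by linarith)
    have e3 := H.nonneg hε x
    have e4 := H.nonneg hε x'
    rw [abs_le]; constructor <;> linarith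
  by_cases c1 : closedBall x r ⊆ Ω
  · by_cases c2 : closedBall x' r ⊆ Ω
    · have l1 := hlow ε hε0 r hr x c1 hx
      have l2 := hlow ε hε0 r hr x' c2 hx'
      have u1 := H.mean_upper hM1 hM hε hr x
      have u2 := H.mean_upper hM1 hM hε hr x'
      have m := abs_le.1 (hdm ε hε x x' (hxx.trans_le (min_le_left _ _)))
      have q1 : C * (r^2 + ε) + M * (Cb k * r^2) ≤ 2 * η' := by
        have z1 : C * ε ≤ C' * ε := by
          apply mul_le_mul_of_nonneg_right _ h0.le
          have : 0 ≤ M * Cb k := by positivity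
          simp only [C']; linarith
        have z2 : C' * r^2 = C * r^2 + M * Cb k * r^2 + r^2 := by simp only [C']; ring
        have z3 : 0 ≤ r^2 := by positivity
        linarith
      have q2 : kap k * |Φ ε x - Φ ε x'| ≤ kap k * η := by
        rw [← abs_of_pos hkp, ← abs_mul, abs_of_pos hkp, abs_le]
        constructor <;> simp only [η'] at * <;> linarith
      exact le_of_mul_le_mul_left q2 hkp
    · obtain ⟨z, hz1, hz2⟩ := not_subset.1 c2
      rw [mem_closedBall] at hz1
      refine hbd z hz2 ?_ ?_
      · have := dist_triangle x x' z
        rw [dist_eq_norm x x'] at this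
        rw [dist_comm] at hz1
        linarith
      · rw [dist_comm] at hz1; linarith
  · obtain ⟨z, hz1, hz2⟩ := not_subset.1 c1
    rw [mem_closedBall] at hz1
    refine hbd z hz2 ?_ ?_
    · rw [dist_comm] at hz1; linarith
    · have := dist_triangle x' x z
      rw [dist_eq_norm x' x, norm_sub_rev] at this
      rw [dist_comm] at hz1
      linarith

/-- uniform convergence off the intermediate holes -/
def IsLim (k : ℕ) (Φ : ℝ → Eucl (k+2) → ℝ) (U : Filter ℝ) (φ : Eucl (k+2) → ℝ) : Prop :=
  ∀ η > (0:ℝ), ∀ᶠ ε in U, ∀ x ∉ holes (k+2) ε (bb k ε), |Φ ε x - φ x| ≤ η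

/-- cell centre -/
def cc {n : ℕ} (ε : ℝ) (x : Eucl n) : Eucl n := WithLp.toLp 2 fun i => ε * ((⌊x i / ε⌋ : ℝ) + 1/2)

lemma cc_off (hk : 1 ≤ k) (h0 : 0 < ε) (hs : 4^k * ε ≤ 1) (x : Eucl (k+2)) : cc ε x ∉ holes (k+2) ε (bb k ε) := by
  intro h
  obtain ⟨m, hm, hd⟩ := mem_holes.1 h
  obtain ⟨z, rfl⟩ := exists_lp hm
  have h1 := coord_le (cc ε x - lpt ε z) 0
  have h2 : (cc ε x - lpt ε z) 0 = ε * (((⌊x 0 / ε⌋ - z 0 : ℤ):ℝ) + 1/2) := by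
    simp only [cc, lpt, PiLp.sub_apply]; push_cast; ring
  rw [h2, abs_mul, abs_of_pos h0] at h1
  have h3 : (1/2:ℝ) ≤ |((⌊x 0 / ε⌋ - z 0 : ℤ):ℝ) + 1/2| := by
    rcases le_or_gt 0 (⌊x 0 / ε⌋ - z 0 : ℤ) with h | h
    · have : (0:ℝ) ≤ ((⌊x 0 / ε⌋ - z 0 : ℤ):ℝ) := by exact_mod_cast h
      rw [abs_of_nonneg (by linarith)]; linarith
    · have : ((⌊x 0 / ε⌋ - z 0 : ℤ):ℝ) ≤ -1 := by exact_mod_cast (by omega : (⌊x 0 / ε⌋ - z 0 : ℤ) ≤ -1)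
      rw [abs_of_nonpos (by linarith)]; linarith
  have h4 := bb_small hk h0 (by norm_num : (0:ℝ) < 4) hs
  nlinarith

lemma cc_dist {n : ℕ} (h0 : 0 < ε) (x : Eucl n) : ‖x - cc ε x‖ ≤ n * ε := by
  have h1 : ‖x - cc ε x‖ ≤ ∑ i, |(x - cc ε x) i| := by
    rw [EuclideanSpace.norm_eq]
    apply Real.sqrt_le_iff.2
    refine ⟨Finset.sum_nonneg fun _ _ => abs_nonneg _, ?_⟩
    simp only [Real.norm_eq_abs]
    exact Finset.sum_sq_le_sq_sum_of_nonneg fun _ _ => abs_nonneg _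
  refine h1.trans ((Finset.sum_le_card_nsmul _ _ ε fun i _ => ?_).trans (by simp))
  simp only [cc, PiLp.sub_apply]
  have h2 := Int.floor_le (x i / ε)
  have h3 := Int.lt_floor_add_one (x i / ε)
  rw [le_div_iff₀ h0] at h2
  rw [div_lt_iff₀ h0] at h3
  rw [abs_le]; constructor <;> nlinarith

lemma exists_lim (H : EV k Ω p c₀ C₀ a Φ) (U : Ultrafilter ℝ) (hU : (U : Filter ℝ) ≤ 𝓝[>] 0) :
    ∃ φ : Eucl (k+2) → ℝ, Continuous φ ∧ (∀ x ∉ Ω, φ x = 0) ∧ IsLim k Φ U φ := by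
  obtain ⟨M, hM1, hM⟩ := H.bound
  have hk := H.hk
  have ev : ∀ e > (0:ℝ), ∀ᶠ ε in (U : Filter ℝ), ε ∈ Ioo (0:ℝ) e := fun e he => hU (Ioo_mem_nhdsGT he)
  have ev1 : ∀ᶠ ε in (U : Filter ℝ), ε ∈ Ioo (0:ℝ) 1 := ev 1 one_pos
  have hlim : ∀ x, ∃ y, Tendsto (fun ε => Φ ε (cc ε x)) U (𝓝 y) := by
    intro x
    have hc : IsCompact (Icc (0:ℝ) M) := isCompact_Icc
    obtain ⟨y, _, hy⟩ := hc.ultrafilter_le_nhds (U.map fun ε => Φ ε (cc ε x)) (by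
      rw [Ultrafilter.coe_map, le_principal_iff, mem_map]
      filter_upwards [ev1] with ε hε using ⟨H.nonneg hε _, hM ε hε _⟩)
    exact ⟨y, hy⟩
  choose φ hφ using hlim
  have evoff : ∀ᶠ ε in (U : Filter ℝ), ∀ x : Eucl (k+2), cc ε x ∉ holes (k+2) ε (bb k ε) := by
    filter_upwards [ev (1/4^k) (by positivity)] with ε hε x
    refine cc_off hk hε.1 ?_ x
    have := hε.2.le
    rw [le_div_iff₀ (by positivity)] at this
    linarith
  have evd : ∀ e > (0:ℝ), ∀ᶠ ε in (U : Filter ℝ), ∀ x : Eucl (k+2), ‖x - cc ε x‖ < e := by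
    intro e he
    filter_upwards [ev (e/(k+2)) (by positivity)] with ε hε x
    have h1 := cc_dist hε.1 x
    have h2 := hε.2
    rw [lt_div_iff₀ (by positivity)] at h2
    push_cast at h1
    linarith
  have hequi : ∀ η > (0:ℝ), ∃ d > (0:ℝ), ∀ x x', ‖x - x'‖ < d → |φ x - φ x'| ≤ η := by
    intro η hη
    obtain ⟨d, hd, ε₁, hε₁, hε₁1, he⟩ := H.equi hη
    refine ⟨d/3, by positivity, fun x x' hx => ?_⟩
    refine le_of_tendsto ((hφ x).sub (hφ x')).abs ?_
    filter_upwards [ev ε₁ hε₁, evoff, evd (d/3) (by positivity)] with ε hε h1 h2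
    refine he ε hε _ _ (h1 x) (h1 x') ?_
    have e1 : cc ε x - cc ε x' = -(x - cc ε x) + (x - x') + (x' - cc ε x') := by abel
    rw [e1]
    have := norm_add₃_le (a := -(x - cc ε x)) (b := x - x') (c := x' - cc ε x')
    rw [norm_neg] at this
    linarith [h2 x, h2 x']
  have hzero : ∀ x ∉ Ω, φ x = 0 := by
    intro x hx
    have h0 : 0 ≤ φ x := ge_of_tendsto (hφ x) (by filter_upwards [ev1] with ε hε using H.nonneg hε _)
    refine le_antisymm (le_of_forall_pos_le_add fun η hη => ?_) h0
    obtain ⟨rb, hrb, hb⟩ := H.bdry hη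
    rw [zero_add]
    refine le_of_tendsto (hφ x) ?_
    filter_upwards [ev1, evd rb hrb] with ε hε h1
    refine hb ε hε _ x hx ?_
    rw [dist_eq_norm, norm_sub_rev]; exact h1 x
  refine ⟨φ, ?_, hzero, ?_⟩
  · refine UniformContinuous.continuous (Metric.uniformContinuous_iff.2 fun η hη => ?_)
    obtain ⟨d, hd, h⟩ := hequi (η/2) (by positivity)
    refine ⟨d, hd, fun x x' hx => ?_⟩
    rw [dist_eq_norm] at hx
    have := h x x' hx
    rw [Real.dist_eq]; linarith
  · intro η hη
    obtain ⟨d, hd, hφd⟩ := hequi (η/3) (by positivity)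
    obtain ⟨d', hd', ε₁, hε₁, hε₁1, he⟩ := H.equi (η := η/3) (by positivity)
    set e := min d d' / 2
    have he0 : 0 < e := by positivity
    have hcomp : IsCompact (closure Ω) := H.hΩb.isCompact_closure
    obtain ⟨t, _, htf, hcov⟩ := hcomp.finite_cover_balls he0
    have evt : ∀ᶠ ε in (U : Filter ℝ), ∀ y ∈ t, |Φ ε (cc ε y) - φ y| ≤ η/3 := by
      rw [eventually_all_finite htf]
      intro y _
      have : Tendsto (fun ε => |Φ ε (cc ε y) - φ y|) U (𝓝 0) := by
        have := ((hφ y).sub_const (φ y)).abs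
        simpa using this
      exact (this.eventually_lt_const (by positivity)).mono fun _ h => h.le
    filter_upwards [evt, ev ε₁ hε₁, ev1, evoff, evd e he0] with ε h1 h2 h3 h4 h5 x hx
    by_cases hxΩ : x ∈ Ω
    · have := hcov (subset_closure hxΩ)
      simp only [mem_iUnion, exists_prop, mem_ball, dist_eq_norm] at this
      obtain ⟨y, hyt, hxy⟩ := this
      have q1 := hφd x y (hxy.trans_le (by
        have := min_le_left d d'; simp only [e]; linarith))
      have q2 := he ε h2 x (cc ε y) hx (h4 y) (by
        have r1 := h5 y
        have r2 : ‖x - cc ε y‖ ≤ ‖x - y‖ + ‖y - cc ε y‖ := by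
          have := norm_add_le (x - y) (y - cc ε y); simpa using this
        have := min_le_right d d'
        simp only [e] at *; linarith)
      have q3 := h1 y hyt
      rw [abs_le] at *
      constructor <;> linarith [q1.1, q1.2, q2.1, q2.2, q3.1, q3.2]
    · rw [H.zero_off h3 hxΩ, hzero x hxΩ]; simp [hη.le]

lemma lim_nonneg (H : EV k Ω p c₀ C₀ a Φ) {U : Filter ℝ} [U.NeBot] (hU : U ≤ 𝓝[>] 0)
    {φ : Eucl (k+2) → ℝ} (hc : Continuous φ) (hL : IsLim k Φ U φ) (hz : ∀ x ∉ Ω, φ x = 0) {x : Eucl (k+2)} (hx : x ∈ Ω) :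
    0 < φ x := by
  obtain ⟨c, hcp, r, hr, ε₀, hε₀, hlow⟩ := H.lower hx
  obtain ⟨d, hd, hφd⟩ := Metric.continuousAt_iff.1 (hc.continuousAt (x := x)) (c/4) (by positivity)
  set e := min (min ε₀ (1/4^k)) (min r d / (k+2))
  have he : 0 < e := by positivity
  have hev : ∀ᶠ ε in U, ε ∈ Ioo (0:ℝ) e := hU (Ioo_mem_nhdsGT he)
  obtain ⟨ε, ⟨h0, hlt⟩, hε⟩ := (hev.and (hL (c/4) (by positivity))).exists
  have e1 : ε < 1/4^k := hlt.trans_le ((min_le_left _ _).trans (min_le_right _ _))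
  have e2 : ε < min r d / (k+2) := hlt.trans_le (min_le_right _ _)
  have e3 : ε < ε₀ := hlt.trans_le ((min_le_left _ _).trans (min_le_left _ _))
  have hoff := cc_off (k := k) H.hk h0 (by
    have := e1.le
    rw [le_div_iff₀ (by positivity)] at this; linarith) x
  have hdist : ‖x - cc ε x‖ < min r d := by
    have h1 := cc_dist h0 x
    rw [lt_div_iff₀ (by positivity)] at e2
    push_cast at h1; linarith
  have q1 := hlow ε ⟨h0, e3⟩ (cc ε x) (by rw [norm_sub_rev]; exact hdist.trans_le (min_le_left _ _)) hoff
  have q2 := hε _ hoff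
  have q3 := hφd (x := cc ε x) (by rw [dist_eq_norm, norm_sub_rev]; exact hdist.trans_le (min_le_right _ _))
  rw [Real.dist_eq] at q3
  have := abs_le.1 q2
  have := abs_lt.1 q3
  linarith
end EV
end

section
/-- admissible test functions -/
structure Tst {n : ℕ} (Ω : Set (Eucl n)) (ζ : Eucl n → ℝ) : Prop where
  sm : ContDiff ℝ (⊤ : ℕ∞) ζ
  cs : HasCompactSupport ζ
  sub : tsupport ζ ⊆ Ω

lemma Tst.c2 {n : ℕ} {Ω : Set (Eucl n)} {ζ : Eucl n → ℝ} (T : Tst Ω ζ) : ContDiff ℝ 2 ζ := T.sm.of_le two_le_inf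

lemma Tst.bd {n : ℕ} {Ω : Set (Eucl n)} {ζ : Eucl n → ℝ} (T : Tst Ω ζ) :
    ∃ C ≥ (0:ℝ), ∀ x, |ζ x| ≤ C ∧ |lap ζ x| ≤ C ∧ gsq ζ x ≤ C^2 := by
  obtain ⟨C1, h1⟩ := T.sm.continuous.bounded_above_of_compact_support T.cs
  obtain ⟨C2, h2⟩ := (lap_cont T.c2).bounded_above_of_compact_support (hcs_lap T.cs)
  obtain ⟨C3, h3⟩ := (gsq_cont T.c2).bounded_above_of_compact_support (gsq_hcs T.cs)
  refine ⟨|C1| + |C2| + |C3| + 1, by positivity, fun x => ⟨?_, ?_, ?_⟩⟩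
  · have := h1 x; rw [Real.norm_eq_abs] at this
    linarith [le_abs_self C1, abs_nonneg C2, abs_nonneg C3]
  · have := h2 x; rw [Real.norm_eq_abs] at this
    linarith [le_abs_self C2, abs_nonneg C1, abs_nonneg C3]
  · have := h3 x; rw [Real.norm_eq_abs] at this
    nlinarith [le_abs_self C3, abs_nonneg C1, abs_nonneg C2, abs_nonneg C3, le_abs_self (gsq ζ x),
      mul_nonneg (abs_nonneg C1) (abs_nonneg C3), mul_nonneg (abs_nonneg C2) (abs_nonneg C3)]

lemma gdot_abs {n : ℕ} {u v : Eucl n → ℝ} {x : Eucl n} {C y : ℝ} (hC : 0 ≤ C) (hy : 0 ≤ y)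
    (h1 : gsq u x ≤ C^2) (h2 : gsq v x ≤ y^2) : |gdot u v x| ≤ C * y := by
  apply abs_le_of_sq_le_sq _ (by positivity)
  have h := Finset.sum_mul_sq_le_sq_mul_sq Finset.univ (fun i => pd i u x) (fun i => pd i v x)
  have e1 : gdot u v x ^ 2 ≤ gsq u x * gsq v x := h
  calc gdot u v x ^ 2 ≤ gsq u x * gsq v x := e1
    _ ≤ C^2 * y^2 := mul_le_mul h1 h2 (gsq_nonneg _ _) (by positivity)
    _ = (C*y)^2 := by ring

/-- error integrand -/
def qq {n : ℕ} (F : Eucl n → ℝ) (p : ℝ) (ζ b : Eucl n → ℝ) (x : Eucl n) : ℝ :=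
  F x * (ζ x * lap b x + b x * lap ζ x + 2 * gdot ζ b x) + F x ^ p * (ζ x * b x)

lemma qq_int {n : ℕ} {Ω : Set (Eucl n)} {ζ : Eucl n → ℝ} (T : Tst Ω ζ) {F b : Eucl n → ℝ} {p : ℝ} (hp : 0 < p)
    (hF : Continuous F) (hb : ContDiff ℝ 2 b) : Integrable (qq F p ζ b) := by
  have hc : Continuous (qq F p ζ b) := by
    unfold qq
    have h1 := lap_cont hb
    have h2 := lap_cont T.c2
    have h3 := gdot_cont T.c2 hb
    have h4 := T.sm.continuous
    have h5 := hb.continuous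
    have h6 : Continuous fun x => F x ^ p := hF.rpow_const fun x => Or.inr hp.le
    fun_prop
  refine hc.integrable_of_hasCompactSupport ?_
  refine T.cs.mono' ?_
  intro x hx
  by_contra h
  apply hx
  have e1 : ζ =ᶠ[𝓝 x] fun _ => 0 := notMem_tsupport_iff_eventuallyEq.1 h
  unfold qq
  have e2 : ζ x = 0 := e1.self_of_nhds
  have e3 : lap ζ x = 0 := by rw [lap_congr e1, lap_const]
  have e4 : gdot ζ b x = 0 := by
    unfold gdot
    exact Finset.sum_eq_zero fun i _ => by rw [pd_congr e1, pd_const, zero_mul]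
  rw [e2, e3, e4]; simp

namespace Good
variable {k : ℕ} {ε A s : ℝ}
lemma lay_cont (G : Good k ε A s) : Continuous (lay k A s) :=
  tau_gt_cont G.hk Gf_deriv2_cont (B := (1 - s) * (A⁻¹)^k + 1) fun t ht =>
    Gf_deriv2_zero_high G.h3 (by linarith)

lemma lay_supp (G : Good k ε A s) {x : Eucl (k+2)} (hx : lay k A s x ≠ 0) :
    x ≠ 0 ∧ (1 - 2*s) * (A⁻¹)^k ≤ tau x ∧ tau x ≤ (1 - s) * (A⁻¹)^k := by
  refine ⟨?_, ?_, ?_⟩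
  · rintro rfl; exact hx (by simp [lay, gt])
  · by_contra h; exact hx (by rw [lay, Gf_deriv2_zero_low G.h3 (not_le.1 h), zero_mul])
  · by_contra h; exact hx (by rw [lay, Gf_deriv2_zero_high G.h3 (not_le.1 h), zero_mul])

lemma lay_far (G : Good k ε A s) {x : Eucl (k+2)} (hx : ε/4 < ‖x‖) : lay k A s x = 0 := by
  by_contra h
  obtain ⟨h0, h1, _⟩ := G.lay_supp h
  have := G.h2
  have := G.hε
  have hp : 0 < ((ε/4)⁻¹)^k := by positivity
  exact absurd ((tau_ge_iff (r := ε/4) (by positivity) G.hk h0).1 (by linarith)) (not_le.2 hx)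

lemma lay_integrable (G : Good k ε A s) : Integrable (lay k A s) := by
  refine G.lay_cont.integrable_of_hasCompactSupport ?_
  refine HasCompactSupport.of_support_subset_isCompact (isCompact_closedBall 0 (ε/4)) ?_
  intro x hx
  rw [mem_closedBall, dist_zero_right]
  by_contra h
  exact hx (G.lay_far (not_le.1 h))

lemma lay_integral (G : Good k ε A s) : ∫ x, lay k A s x = kap k := by
  unfold lay
  have := G.hA; have := G.hs2; have := G.hs
  rw [polar_tau G.hk (deriv (deriv (Gf ((1 - 2*s) * (A⁻¹)^k) ((1 - s) * (A⁻¹)^k)))),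
    Gf_deriv2_integral _ G.h3, mul_one]
  have : 0 < 1 - 2*s := by linarith
  positivity

lemma bump_gsq (G : Good k ε A s) (x : Eucl (k+2)) :
    gsq (bump1 k ε A s) x ≤ ((ball (0:Eucl (k+2)) ε).indicator (fun x => k * (‖x‖⁻¹)^(k+1)) x)^2 := by
  by_cases hx : x ∈ ball (0:Eucl (k+2)) ε
  · rw [indicator_of_mem hx]
    unfold bump1
    rw [gsq_rad (J := JJ k ε A s) G.hk Jt_smooth G.hJtop]
    have h1 : 0 ≤ deriv (JJ k ε A s) (tau x) := Jt_deriv_nonneg G.h1 G.h2 G.h3 _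
    have h2 : deriv (JJ k ε A s) (tau x) ≤ 1 := Jt_deriv_le_one _
    have h3 : deriv (JJ k ε A s) (tau x)^2 ≤ 1 := by nlinarith
    have h4 : gt x = (k * (‖x‖⁻¹)^(k+1))^2 := by unfold gt; ring
    rw [h4]
    nlinarith [sq_nonneg (k * (‖x‖⁻¹)^(k+1))]
  · rw [indicator_of_notMem hx]
    rw [mem_ball, dist_zero_right, not_lt] at hx
    have : bump1 k ε A s =ᶠ[𝓝 x] fun _ => 0 := by
      have hε := G.hε
      have : {y : Eucl (k+2) | ε/4 < ‖y‖} ∈ 𝓝 x :=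
        (isOpen_lt continuous_const continuous_norm).mem_nhds (by simp only [mem_ofPred_eq]; linarith)
      filter_upwards [this] with y hy using G.bump_zero (le_of_lt hy)
    rw [gsq_congr this]
    simp [gsq, pd_const]

lemma bump_bd (G : Good k ε A s) {x : Eucl (k+2)} (hx : x ≠ 0) :
    bump1 k ε A s x ≤ (ball (0:Eucl (k+2)) ε).indicator (fun x => (‖x‖⁻¹)^k) x := by
  by_cases h : x ∈ ball (0:Eucl (k+2)) ε
  · rw [indicator_of_mem h]; exact G.bump_le_tau hx
  · rw [indicator_of_notMem h, G.bump_zero]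
    rw [mem_ball, dist_zero_right, not_lt] at h
    linarith [G.hε]
end Good

namespace EV
variable {k : ℕ} {Ω : Set (Eucl (k+2))} {p c₀ C₀ : ℝ} {a : ℝ → ℝ} {Φ : ℝ → Eucl (k+2) → ℝ} {ε : ℝ}

lemma test_id (H : EV k Ω p c₀ C₀ a Φ) (hε : ε ∈ Ioo (0:ℝ) 1) {s R ρ : ℝ} (G : Good k ε (a ε) s)
    (hρ : Ω ⊆ ball 0 ρ) (hR : ρ + 1 ≤ R) {ζ : Eucl (k+2) → ℝ} (T : Tst Ω ζ) :
    ∫ x, (Φ ε x * lap ζ x + Φ ε x ^ p * ζ x) =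
      (JT k ε (a ε) s)⁻¹ * ∑ z ∈ Zf (k+2) ε R, ∫ x, qq (Φ ε) p ζ (fun y => bump1 k ε (a ε) s (y - lpt ε z)) x := by
  have hHs : ContDiff ℝ 2 (HH k ε (a ε) s R) := G.HH_smooth.of_le two_le_inf
  have hv : ContDiff ℝ 2 (fun x => ζ x * HH k ε (a ε) s R x) := T.c2.mul hHs
  have hcv : HasCompactSupport (fun x => ζ x * HH k ε (a ε) s R x) := T.cs.mul_right
  have hpos : ∀ x ∈ tsupport (fun x => ζ x * HH k ε (a ε) s R x), 0 < Φ ε x := by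
    intro x hx
    have h1 : x ∈ Ω := T.sub (closure_mono (by
      intro y hy h
      exact hy (by simp [h])) hx)
    rw [H.pos_iff hε]
    refine ⟨h1, fun h2 => ?_⟩
    have h3 : ‖x‖ < ρ := by have := hρ h1; rwa [mem_ball, dist_zero_right] at this
    have h4 := H.HH_hole hε G h2 (R := R) (by linarith)
    exact absurd hx (notMem_tsupport_iff_eventuallyEq.2 (by
      filter_upwards [h4] with y hy; simp [hy]))
  have hg := green (u := Φ ε) hv hcv (fun x hx => H.c2 hε (hpos x hx))
  have hb : ∀ z : Fin (k+2) → ℤ, ContDiff ℝ 2 (fun y => bump1 k ε (a ε) s (y - lpt ε z)) := fun z =>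
    (G.bump_smooth.comp (contDiff_id.sub contDiff_const)).of_le two_le_inf
  have hΦc := H.cont hε
  have hΦp : Continuous fun x => Φ ε x ^ p := hΦc.rpow_const fun x => Or.inr H.hp0.le
  have i1 : Integrable fun x => Φ ε x * lap (fun x => ζ x * HH k ε (a ε) s R x) x :=
    int_mul_supp (lap_cont hv) (hcs_lap hcv) fun x _ => hΦc.continuousAt
  have i2 : Integrable fun x => Φ ε x ^ p * (ζ x * HH k ε (a ε) s R x) :=
    int_mul_supp hv.continuous hcv fun x _ => hΦp.continuousAt
  have e0 : ∫ x, (Φ ε x * lap (fun x => ζ x * HH k ε (a ε) s R x) x + Φ ε x ^ p * (ζ x * HH k ε (a ε) s R x)) = 0 := by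
    rw [integral_add i1 i2, hg, ← integral_add _ i2]
    · rw [integral_eq_zero_of_ae]
      refine Eventually.of_forall fun x => ?_
      by_cases hx : x ∈ tsupport (fun x => ζ x * HH k ε (a ε) s R x)
      · simp only [H.lapΦ hε (hpos x hx), Pi.zero_apply]; ring
      · have := image_eq_zero_of_notMem_tsupport hx
        simp [this]
    · refine i2.neg.congr (Eventually.of_forall fun x => ?_)
      by_cases hx : x ∈ tsupport (fun x => ζ x * HH k ε (a ε) s R x)
      · simp only [H.lapΦ hε (hpos x hx), Pi.neg_apply]; ring
      · have := image_eq_zero_of_notMem_tsupport hx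
        simp [this]
  have i3 : Integrable fun x => Φ ε x * lap ζ x + Φ ε x ^ p * ζ x :=
    (int_mul_supp (lap_cont T.c2) (hcs_lap T.cs) fun x _ => hΦc.continuousAt).add
      (int_mul_supp T.sm.continuous T.cs fun x _ => hΦp.continuousAt)
  have hq : ∀ z ∈ Zf (k+2) ε R, Integrable (fun x => qq (Φ ε) p ζ (fun y => bump1 k ε (a ε) s (y - lpt ε z)) x) :=
    fun z _ => qq_int T H.hp0 hΦc (hb z)
  have e1 : ∀ x, Φ ε x * lap (fun x => ζ x * HH k ε (a ε) s R x) x + Φ ε x ^ p * (ζ x * HH k ε (a ε) s R x)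
      = (Φ ε x * lap ζ x + Φ ε x ^ p * ζ x) - (JT k ε (a ε) s)⁻¹ *
        ∑ z ∈ Zf (k+2) ε R, qq (Φ ε) p ζ (fun y => bump1 k ε (a ε) s (y - lpt ε z)) x := by
    intro x
    have h1 : (fun x => ζ x * HH k ε (a ε) s R x) = fun x => ζ x + (-(JT k ε (a ε) s)⁻¹) *
        ∑ z ∈ Zf (k+2) ε R, ζ x * bump1 k ε (a ε) s (x - lpt ε z) := by
      funext y; rw [HH, ← Finset.mul_sum]; ring
    have hm : ∀ z : Fin (k+2) → ℤ, ContDiff ℝ 2 (fun y => ζ y * bump1 k ε (a ε) s (y - lpt ε z)) :=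
      fun z => T.c2.mul (hb z)
    have hsum : ContDiffAt ℝ 2 (fun x => ∑ z ∈ Zf (k+2) ε R, ζ x * bump1 k ε (a ε) s (x - lpt ε z)) x :=
      ContDiffAt.sum fun z _ => (hm z).contDiffAt
    rw [congrFun h1 x, h1, lap_add T.c2.contDiffAt (contDiffAt_const.mul hsum), lap_const_mul _ hsum,
      lap_sum _ (fun z x => ζ x * bump1 k ε (a ε) s (x - lpt ε z)) (fun z _ => (hm z).contDiffAt)]
    simp only [qq, Finset.sum_add_distrib, ← Finset.mul_sum]
    have h2 : ∀ z ∈ Zf (k+2) ε R, lap (fun x => ζ x * bump1 k ε (a ε) s (x - lpt ε z)) x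
      = ζ x * lap (fun y => bump1 k ε (a ε) s (y - lpt ε z)) x + bump1 k ε (a ε) s (x - lpt ε z) * lap ζ x
        + 2 * gdot ζ (fun y => bump1 k ε (a ε) s (y - lpt ε z)) x :=
      fun z _ => lap_mul T.c2.contDiffAt (hb z).contDiffAt
    rw [Finset.sum_congr rfl h2]
    simp only [Finset.sum_add_distrib, ← Finset.mul_sum, ← Finset.sum_mul]
    ring
  rw [integral_congr_ae (Eventually.of_forall e1), integral_sub i3 ((integrable_finsetSum _ hq).const_mul _),
    integral_const_mul, integral_finsetSum _ hq] at e0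
  linarith

lemma q_est (H : EV k Ω p c₀ C₀ a Φ) {ζ : Eucl (k+2) → ℝ} (T : Tst Ω ζ) : ∃ C ≥ (0:ℝ), ∀ ε ∈ Ioo (0:ℝ) 1,
    Good k ε (a ε) ε → ∀ z : Fin (k+2) → ℤ,
    |(∫ x, qq (Φ ε) p ζ (fun y => bump1 k ε (a ε) ε (y - lpt ε z)) x) -
      ∫ x, Φ ε x * ζ x * kern (ε/4) (x - lpt ε z)| ≤ C * ε := by
  obtain ⟨M, hM1, hM⟩ := H.bound
  obtain ⟨C, hC0, hC⟩ := T.bd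
  have hkp := kap_pos H.hk
  have hCb := Cb_nonneg (k := k)
  refine ⟨5*M*C*kap k + 2*M*C*Cb k + 2*M*C*k*Cb k, by positivity, ?_⟩
  intro ε hε G z
  have hb : ContDiff ℝ 2 (fun y => bump1 k ε (a ε) ε (y - lpt ε z)) :=
    (G.bump_smooth.comp (contDiff_id.sub contDiff_const)).of_le two_le_inf
  have hΦc := H.cont hε
  have i1 := qq_int (p := p) T H.hp0 hΦc hb
  have i2 : Integrable fun x => Φ ε x * ζ x * kern (ε/4) (x - lpt ε z) :=
    int_mul_supp (ker_sub_cont H.hk (by linarith [hε.1]) _) (ker_hcs H.hk (by linarith [hε.1]) _)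
      fun x _ => (hΦc.mul T.sm.continuous).continuousAt
  rw [← integral_sub i1 i2]
  set D : Eucl (k+2) → ℝ := fun y => 5*M*C*ε * Good.lay k (a ε) ε y
    + (2*M*C) * (ball (0:Eucl (k+2)) ε).indicator (fun x => (‖x‖⁻¹)^k) y
    + (2*M*C*k) * (ball (0:Eucl (k+2)) ε).indicator (fun x => (‖x‖⁻¹)^(k+1)) y with hD
  obtain ⟨j1, j2⟩ := polar_ball (k := k) k (by omega) hε.1.le
  obtain ⟨j3, j4⟩ := polar_ball (k := k) (k+1) (by omega) hε.1.le
  have j1' := (integrable_indicator_iff measurableSet_ball).2 j1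
  have j3' := (integrable_indicator_iff measurableSet_ball).2 j3
  have d1 : Integrable (fun y => 5*M*C*ε * Good.lay k (a ε) ε y) := G.lay_integrable.const_mul _
  have d2 := j1'.const_mul (2*M*C)
  have d3 := j3'.const_mul (2*M*C*k)
  have dint : Integrable D := (d1.add d2).add d3
  have hDI : ∫ y, D y ≤ (5*M*C*kap k + 2*M*C*Cb k + 2*M*C*k*Cb k) * ε := by
    have d12 : Integrable (fun y => 5*M*C*ε * Good.lay k (a ε) ε y
      + (2*M*C) * (ball (0:Eucl (k+2)) ε).indicator (fun x => (‖x‖⁻¹)^k) y) := d1.add d2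
    simp only [hD]
    rw [integral_add d12 d3, integral_add d1 d2, integral_const_mul, integral_const_mul, integral_const_mul,
      G.lay_integral, integral_indicator measurableSet_ball, integral_indicator measurableSet_ball]
    have q1 : ∫ x in ball (0:Eucl (k+2)) ε, (‖x‖⁻¹)^k ≤ Cb k * ε := by
      refine j2.trans ?_
      rw [show k + 2 - k = 2 by omega]
      refine mul_le_mul_of_nonneg_left ?_ hCb
      nlinarith [hε.1, hε.2]
    have q2 : ∫ x in ball (0:Eucl (k+2)) ε, (‖x‖⁻¹)^(k+1) ≤ Cb k * ε := by
      refine j4.trans ?_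
      rw [show k + 2 - (k+1) = 1 by omega, pow_one]
      exact le_rfl
    have r1 := mul_le_mul_of_nonneg_left q1 (by positivity : 0 ≤ 2*M*C)
    have r2 := mul_le_mul_of_nonneg_left q2 (by positivity : 0 ≤ 2*M*C*k)
    linarith
  have key : |∫ x, (qq (Φ ε) p ζ (fun y => bump1 k ε (a ε) ε (y - lpt ε z)) x
      - Φ ε x * ζ x * kern (ε/4) (x - lpt ε z))| ≤ ∫ x, D (x - lpt ε z) := by
    rw [← Real.norm_eq_abs]
    refine norm_integral_le_of_norm_le (dint.comp_sub_right (lpt ε z)) ?_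
    have hne : ∀ᵐ x : Eucl (k+2), x ≠ lpt ε z := by
      rw [ae_iff]; simp
    filter_upwards [hne] with x hx
    have hy : x - lpt ε z ≠ 0 := sub_ne_zero.2 hx
    set y := x - lpt ε z with hydef
    have hΦ0 := H.nonneg hε x
    have hΦM := hM ε hε x
    have hΦp : Φ ε x ^ p ≤ M := H.rpow_le_M hM1 hΦ0 hΦM
    have hΦp0 : 0 ≤ Φ ε x ^ p := Real.rpow_nonneg hΦ0 p
    obtain ⟨c1, c2, c3⟩ := hC x
    have hlb : lap (fun y => bump1 k ε (a ε) ε (y - lpt ε z)) x = kern (ε/4) y - Good.lay k (a ε) ε y := by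
      rw [lap_comp_sub (bump1 k ε (a ε) ε), G.lap_bump]
    have hl0 := G.lay_nonneg y
    have t1 : |Φ ε x * ζ x * Good.lay k (a ε) ε y| ≤ 5*M*C*ε * Good.lay k (a ε) ε y := by
      rw [abs_mul, abs_of_nonneg hl0]
      by_cases h0 : Good.lay k (a ε) ε y = 0
      · simp [h0]
      · refine mul_le_mul_of_nonneg_right ?_ hl0
        obtain ⟨l0, l1, l2⟩ := G.lay_supp h0
        have hA := G.hA
        have hAk : 0 < ((a ε)⁻¹)^k := by positivity
        have m1 : a ε ≤ ‖y‖ := (tau_le_iff hA H.hk l0).1 (l2.trans (by nlinarith [hε.1]))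
        have m2 : ‖y‖ ≤ ε/2 := by
          by_contra h
          exact h0 (G.lay_far (by linarith [not_le.1 h, hε.1]))
        have := H.near_hole hM1 hM hε (by linarith [G.h8]) (lp_mem ε z) m1 m2
        have m3 : 1 - 2*ε ≤ tau y * a ε ^ k := by
          have := mul_le_mul_of_nonneg_right l1 (by positivity : 0 ≤ a ε ^k)
          have e : (1 - 2*ε) * ((a ε)⁻¹)^k * a ε^k = 1 - 2*ε := by
            rw [inv_pow]; field_simp
          linarith
        have m4 : Φ ε x ≤ 5*M*ε := by
          have e1 : 2 * M * (1 - tau y * a ε ^ k) ≤ 2*M*(2*ε) := mul_le_mul_of_nonneg_left (by linarith) (by positivity)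
          have e2 : M * ε^2 ≤ M * ε := mul_le_mul_of_nonneg_left (by nlinarith [hε.1, hε.2]) (by positivity)
          linarith
        rw [abs_mul, abs_of_nonneg hΦ0]
        calc Φ ε x * |ζ x| ≤ (5*M*ε) * C := mul_le_mul m4 c1 (abs_nonneg _) (by have := hε.1; positivity)
          _ = _ := by ring
    have b0 := G.bump_nonneg y
    have b1 := G.bump_bd hy
    have t2 : |bump1 k ε (a ε) ε y * (Φ ε x * lap ζ x + Φ ε x ^ p * ζ x)|
        ≤ (2*M*C) * (ball (0:Eucl (k+2)) ε).indicator (fun x => (‖x‖⁻¹)^k) y := by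
      rw [abs_mul, abs_of_nonneg b0, mul_comm]
      refine mul_le_mul ?_ b1 b0 (by positivity)
      calc |Φ ε x * lap ζ x + Φ ε x ^ p * ζ x| ≤ |Φ ε x * lap ζ x| + |Φ ε x ^ p * ζ x| := abs_add_le _ _
        _ ≤ M * C + M * C := by
            rw [abs_mul, abs_mul, abs_of_nonneg hΦ0, abs_of_nonneg hΦp0]
            exact add_le_add (mul_le_mul hΦM c2 (abs_nonneg _) (by positivity)) (mul_le_mul hΦp c1 (abs_nonneg _) (by positivity))
        _ = _ := by ring
    have t3 : |2 * Φ ε x * gdot ζ (fun y => bump1 k ε (a ε) ε (y - lpt ε z)) x|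
        ≤ (2*M*C*k) * (ball (0:Eucl (k+2)) ε).indicator (fun x => (‖x‖⁻¹)^(k+1)) y := by
      have g1 := G.bump_gsq y
      rw [hydef, ← gsq_comp_sub (bump1 k ε (a ε) ε), ← hydef] at g1
      have g0 : 0 ≤ (ball (0:Eucl (k+2)) ε).indicator (fun x => k * (‖x‖⁻¹)^(k+1)) y :=
        indicator_nonneg (fun x _ => by positivity) y
      have g2 := gdot_abs hC0 g0 c3 g1
      rw [abs_mul, abs_of_nonneg (by positivity)]
      have e : (ball (0:Eucl (k+2)) ε).indicator (fun x => k * (‖x‖⁻¹)^(k+1)) y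
        = k * (ball (0:Eucl (k+2)) ε).indicator (fun x => (‖x‖⁻¹)^(k+1)) y := by
        by_cases h : y ∈ ball (0:Eucl (k+2)) ε <;> simp [h]
      rw [e] at g2 g0
      calc _ ≤ (2*M) * (C * (k * (ball (0:Eucl (k+2)) ε).indicator (fun x => (‖x‖⁻¹)^(k+1)) y)) :=
            mul_le_mul (by linarith) g2 (abs_nonneg _) (by positivity)
        _ = _ := by ring
    have e : qq (Φ ε) p ζ (fun y => bump1 k ε (a ε) ε (y - lpt ε z)) x - Φ ε x * ζ x * kern (ε/4) y
      = - (Φ ε x * ζ x * Good.lay k (a ε) ε y) + bump1 k ε (a ε) ε y * (Φ ε x * lap ζ x + Φ ε x ^ p * ζ x)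
       + 2 * Φ ε x * gdot ζ (fun y => bump1 k ε (a ε) ε (y - lpt ε z)) x := by
      unfold qq; rw [hlb]; simp only [hydef]; ring
    rw [Real.norm_eq_abs, e]
    refine (abs_add_le _ _).trans ((add_le_add_left (abs_add_le _ _) _).trans ?_)
    rw [abs_neg]
    simp only [hD]
    linarith
  rw [integral_sub_right_eq_self D] at key
  exact key.trans hDI

lemma JT_card (H : EV k Ω p c₀ C₀ a Φ) (hε : ε ∈ Ioo (0:ℝ) 1) {s R : ℝ} (G : Good k ε (a ε) s) (hR : 1 ≤ R) :
    (JT k ε (a ε) s)⁻¹ * (Zf (k+2) ε R).card ≤ 4 * C₀^k * (5*R)^(k+2) := by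
  have h1 := Zf_card (n := k+2) hε.1 hε.2.le hR
  have h2 := H.a_pow hε
  have h3 : (JT k ε (a ε) s)⁻¹ ≤ 4 * (C₀^k * ε^(k+2)) := G.JTinv_le.trans (by linarith)
  have := H.hC₀; have := hε.1
  calc _ ≤ 4 * (C₀^k * ε^(k+2)) * ((5*R)^(k+2) * (ε⁻¹)^(k+2)) :=
        mul_le_mul h3 h1 (by positivity) (by positivity)
    _ = _ := by rw [inv_pow]; field_simp

end EV
end

section
/-- half open cell -/
def cube {n : ℕ} (ε : ℝ) (z : Fin n → ℤ) : Set (Eucl n) :=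
  (fun x : Eucl n => WithLp.ofLp x) ⁻¹' (Set.pi univ fun i => Ico (ε * (z i : ℝ)) (ε * (z i : ℝ) + ε))

lemma cube_meas {n : ℕ} (ε : ℝ) (z : Fin n → ℤ) : MeasurableSet (cube ε z) := by
  unfold cube
  refine MeasurableSet.preimage (MeasurableSet.univ_pi fun i => measurableSet_Ico) ?_
  exact (PiLp.continuous_ofLp 2 (fun _ : Fin n => ℝ)).measurable

lemma cube_vol {n : ℕ} {ε : ℝ} (hε : 0 < ε) (z : Fin n → ℤ) : volume (cube ε z) = ENNReal.ofReal (ε^n) := by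
  unfold cube
  have h := (PiLp.volume_preserving_ofLp (Fin n)).measure_preimage
    (s := Set.pi univ fun i => Ico (ε * (z i : ℝ)) (ε * (z i : ℝ) + ε))
    (MeasurableSet.univ_pi fun i => measurableSet_Ico).nullMeasurableSet
  refine h.trans ?_
  rw [Real.volume_pi_Ico]
  simp [ENNReal.ofReal_pow hε.le]

lemma mem_cube {n : ℕ} {ε : ℝ} (hε : 0 < ε) (z : Fin n → ℤ) (x : Eucl n) :
    x ∈ cube ε z ↔ z = fun i => ⌊x i / ε⌋ := by
  unfold cube
  simp only [mem_preimage, Set.mem_pi, mem_univ, true_implies, mem_Ico]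
  constructor
  · intro h
    funext i
    symm
    rw [Int.floor_eq_iff, le_div_iff₀ hε, div_lt_iff₀ hε]
    obtain ⟨h1, h2⟩ := h i
    constructor <;> nlinarith
  · rintro rfl i
    have h1 := Int.floor_le (x i / ε)
    have h2 := Int.lt_floor_add_one (x i / ε)
    rw [le_div_iff₀ hε] at h1
    rw [div_lt_iff₀ hε] at h2
    constructor <;> nlinarith

lemma cube_dist {n : ℕ} {ε : ℝ} (hε : 0 < ε) (x : Eucl n) :
    ‖x - lpt ε (fun i => ⌊x i / ε⌋)‖ ≤ n * ε := by
  have h : ∀ i, |(x - lpt ε (fun i => ⌊x i / ε⌋)) i| ≤ ε := by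
    intro i
    have e : (x - lpt ε (fun i => ⌊x i / ε⌋)) i = x i - ε * (⌊x i / ε⌋ : ℝ) := by
      simp [lpt]
    rw [e]
    have h1 := Int.floor_le (x i / ε)
    have h2 := Int.lt_floor_add_one (x i / ε)
    rw [le_div_iff₀ hε] at h1
    rw [div_lt_iff₀ hε] at h2
    rw [abs_le]; constructor <;> nlinarith
  set y := x - lpt ε (fun i => ⌊x i / ε⌋)
  rw [EuclideanSpace.norm_eq]
  apply Real.sqrt_le_iff.2 ⟨by positivity, ?_⟩
  calc ∑ i, ‖y i‖^2 ≤ ∑ i : Fin n, ε^2 := by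
        refine Finset.sum_le_sum fun i _ => ?_
        rw [Real.norm_eq_abs]
        exact pow_le_pow_left₀ (abs_nonneg _) (h i) 2
    _ = n * ε^2 := by simp
    _ ≤ (n*ε)^2 := by
        rw [mul_pow]
        refine mul_le_mul_of_nonneg_right ?_ (by positivity)
        rcases Nat.eq_zero_or_pos n with h | h
        · simp [h]
        · have : (1:ℝ) ≤ n := by exact_mod_cast h
          nlinarith

lemma riemann_bd {n : ℕ} {g : Eucl n → ℝ} (hg : Continuous g) {R : ℝ} (hR : 0 ≤ R)
    (hs : ∀ x, R ≤ ‖x‖ → g x = 0) {η d : ℝ} (hη : 0 ≤ η) (hd : ∀ x y, ‖x - y‖ < d → |g x - g y| ≤ η)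
    {ε : ℝ} (hε : 0 < ε) (hd1 : n * ε < d) (h1 : n * ε ≤ 1) :
    |ε^n * ∑ z ∈ Zf n ε R, g (lpt ε z) - ∫ x, g x| ≤ η * volume.real (ball (0:Eucl n) (R+1)) := by
  have hgc : HasCompactSupport g := HasCompactSupport.of_support_subset_isCompact
    (isCompact_closedBall 0 R) (by
      intro x hx
      rw [mem_closedBall, dist_zero_right]
      by_contra h
      exact hx (hs x (le_of_lt (not_le.1 h))))
  have hgi : Integrable g := hg.integrable_of_hasCompactSupport hgc
  set gε : Eucl n → ℝ := fun x => ∑ z ∈ Zf n ε R, (cube ε z).indicator (fun _ => g (lpt ε z)) x with hgε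
  have hfin : ∀ z : Fin n → ℤ, volume (cube ε z) ≠ ⊤ := fun z => by rw [cube_vol hε]; simp
  have i0 : ∀ z ∈ Zf n ε R, Integrable ((cube ε z).indicator (fun _ => g (lpt ε z))) := fun z _ =>
    (integrable_indicator_iff (cube_meas ε z)).2 (integrableOn_const (hfin z))
  have i1 : Integrable gε := integrable_finsetSum _ i0
  have e1 : ∫ x, gε x = ε^n * ∑ z ∈ Zf n ε R, g (lpt ε z) := by
    rw [hgε, integral_finsetSum _ i0, Finset.mul_sum]
    refine Finset.sum_congr rfl fun z _ => ?_
    rw [integral_indicator (cube_meas ε z), setIntegral_const, Measure.real, cube_vol hε,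
      ENNReal.toReal_ofReal (by positivity), smul_eq_mul]
  have e2 : ∀ x, gε x = g (lpt ε (fun i => ⌊x i / ε⌋)) := by
    intro x
    simp only [hgε]
    rw [Finset.sum_eq_single (fun i => ⌊x i / ε⌋)]
    · rw [indicator_of_mem ((mem_cube hε _ x).2 rfl)]
    · intro z _ hz
      rw [indicator_of_notMem]
      rw [mem_cube hε]; exact hz
    · intro h
      have : g (lpt ε (fun i => ⌊x i / ε⌋)) = 0 := by
        apply hs
        by_contra h'
        exact h (mem_Zf hε (le_of_lt (not_le.1 h')))
      rw [this]; simp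
  rw [← e1, ← integral_sub i1 hgi, ← Real.norm_eq_abs]
  have e3 : ∫ x, (gε x - g x) = ∫ x in ball (0:Eucl n) (R+1), (gε x - g x) := by
    rw [setIntegral_eq_integral_of_forall_compl_eq_zero]
    intro x hx
    rw [mem_ball, dist_zero_right, not_lt] at hx
    have := cube_dist hε x
    have h3 : ‖x‖ ≤ ‖x - lpt ε (fun i => ⌊x i / ε⌋)‖ + ‖lpt ε (fun i => ⌊x i / ε⌋)‖ := by
      simpa using norm_add_le (x - lpt ε (fun i => ⌊x i / ε⌋)) (lpt ε (fun i => ⌊x i / ε⌋))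
    rw [e2, hs x (by linarith), hs _ (by linarith)]; simp
  rw [e3]
  refine norm_setIntegral_le_of_norm_le_const measure_ball_lt_top (fun x _ => ?_)
  rw [Real.norm_eq_abs, e2]
  refine hd _ _ ?_
  rw [norm_sub_rev]
  exact (cube_dist hε x).trans_lt hd1

lemma riemann {n : ℕ} {g : Eucl n → ℝ} (hg : Continuous g) {R : ℝ} (hR : 0 ≤ R)
    (hs : ∀ x, R ≤ ‖x‖ → g x = 0) :
    Tendsto (fun ε => ε^n * ∑ z ∈ Zf n ε R, g (lpt ε z)) (𝓝[>] 0) (𝓝 (∫ x, g x)) := by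
  have hgc : HasCompactSupport g := HasCompactSupport.of_support_subset_isCompact
    (isCompact_closedBall 0 R) (by
      intro x hx
      rw [mem_closedBall, dist_zero_right]
      by_contra h
      exact hx (hs x (le_of_lt (not_le.1 h))))
  have huc := hg.uniformContinuous_of_tendsto_cocompact (x := 0) hgc.is_zero_at_infty
  rw [Metric.tendsto_nhds]
  intro η hη
  set V := volume.real (ball (0:Eucl n) (R+1)) + 1
  have hV : 0 < V := by positivity
  obtain ⟨d, hd, hdd⟩ := Metric.uniformContinuous_iff.1 huc (η / (2*V)) (by positivity)
  have he : 0 < min d 1 / (n+1) := by positivity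
  filter_upwards [Ioo_mem_nhdsGT he] with ε hε
  have h1 : (n+1) * ε < min d 1 := by have := hε.2; rw [lt_div_iff₀ (by positivity)] at this; linarith
  have h2 : n * ε < min d 1 := by nlinarith [hε.1]
  have := riemann_bd hg hR hs (η := η/(2*V)) (by positivity) (d := d) (fun x y hxy => by
    have := hdd (a := x) (b := y) (by rwa [dist_eq_norm])
    rw [Real.dist_eq] at this; exact this.le) hε.1 (h2.trans_le (min_le_left _ _)) ((h2.trans_le (min_le_right _ _)).le)
  rw [Real.dist_eq]
  refine this.trans_lt ?_
  have h3 : η/(2*V) * volume.real (ball (0:Eucl n) (R+1)) ≤ η/(2*V) * V :=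
    mul_le_mul_of_nonneg_left (by simp only [V]; linarith) (by positivity)
  have h4 : η/(2*V) * V = η/2 := by field_simp
  linarith
end

section
lemma rpow_diff {p t s : ℝ} (hp0 : 0 < p) (hp1 : p < 1) (ht : 0 ≤ t) (hs : 0 ≤ s) : |t^p - s^p| ≤ |t - s|^p := by
  have key : ∀ t s : ℝ, 0 ≤ s → s ≤ t → |t^p - s^p| ≤ |t-s|^p := by
    intro t s hs hst
    have h := Real.rpow_add_le_add_rpow hs (by linarith : 0 ≤ t - s) hp0.le hp1.le
    rw [show s + (t - s) = t by ring] at h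
    have h2 := Real.rpow_le_rpow hs hst hp0.le
    rw [abs_of_nonneg (by linarith), abs_of_nonneg (by linarith)]
    linarith
  rcases le_total s t with h | h
  · exact key t s hs h
  · rw [abs_sub_comm, abs_sub_comm t s]; exact key s t ht h

lemma hole_cover {n : ℕ} {ε b ρ : ℝ} (hε : 0 < ε) (hb : b ≤ 1) :
    holes n ε b ∩ ball 0 ρ ⊆ ⋃ z ∈ Zf n ε (ρ+1), closedBall (lpt ε z) b := by
  rintro x ⟨h1, h2⟩
  obtain ⟨m, hm, hd⟩ := mem_holes.1 h1
  obtain ⟨z, rfl⟩ := exists_lp hm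
  rw [mem_ball, dist_zero_right] at h2
  simp only [mem_iUnion, exists_prop]
  refine ⟨z, mem_Zf hε ?_, by rwa [mem_closedBall, dist_eq_norm]⟩
  have := norm_sub_norm_le (lpt ε z) x
  rw [norm_sub_rev] at this
  linarith

lemma cover_vol {n : ℕ} {ε b R : ℝ} (hε : 0 < ε) (hε1 : ε ≤ 1) (hb0 : 0 ≤ b) (hR : 1 ≤ R) :
    volume (⋃ z ∈ Zf n ε R, closedBall (lpt ε z) b) ≤
      ENNReal.ofReal ((5*R)^n * volume.real (ball (0:Eucl n) 1) * (b/ε)^n) := by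
  refine (measure_biUnion_finset_le _ _).trans ?_
  have h : ∀ z ∈ Zf n ε R, volume (closedBall (lpt ε z) b) = ENNReal.ofReal (b^n * volume.real (ball (0:Eucl n) 1)) := by
    intro z _
    rw [Measure.addHaar_closedBall _ _ hb0, ENNReal.ofReal_mul (by positivity), finrank_euclideanSpace_fin, Measure.real,
      ENNReal.ofReal_toReal measure_ball_lt_top.ne]
  rw [Finset.sum_congr rfl h, Finset.sum_const, nsmul_eq_mul, ← ENNReal.ofReal_natCast, ← ENNReal.ofReal_mul (by positivity)]
  apply ENNReal.ofReal_le_ofReal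
  have := Zf_card (n := n) hε hε1 hR
  calc _ ≤ ((5*R)^n * (ε⁻¹)^n) * (b^n * volume.real (ball (0:Eucl n) 1)) :=
        mul_le_mul_of_nonneg_right this (by positivity)
    _ = _ := by rw [div_eq_mul_inv, mul_pow]; ring

lemma bhole_small {k : ℕ} (hk : 1 ≤ k) {ρ : ℝ} (hρ : 1 ≤ ρ) {η : ℝ} (hη : 0 < η) :
    ∀ᶠ ε in 𝓝[>] (0:ℝ), volume.real (holes (k+2) ε (bb k ε) ∩ ball 0 ρ) ≤ η := by
  set K := (5*(ρ+1))^(k+2) * volume.real (ball (0:Eucl (k+2)) 1) + 1 with hK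
  have hK1 : 0 < K := by positivity
  set L := K/η + 1 with hL
  have hL1 : 1 ≤ L := by have : 0 < K/η := by positivity
                         linarith
  have he : (0:ℝ) < min 1 (1/L^k) := by positivity
  filter_upwards [Ioo_mem_nhdsGT he] with ε hε
  have e1 : ε < 1 := hε.2.trans_le (min_le_left _ _)
  have e2 : ε < 1/L^k := hε.2.trans_le (min_le_right _ _)
  rw [lt_div_iff₀ (by positivity)] at e2
  have hb := bb_small hk hε.1 (by linarith : 0 < L) (by linarith)
  have hb0 := bb_pos (k := k) hε.1
  have hb1 : bb k ε ≤ 1 := by nlinarith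
  have h1 := (measure_mono (hole_cover (n := k+2) (ρ := ρ) hε.1 hb1)).trans (cover_vol (n := k+2) hε.1 e1.le hb0.le (by linarith : 1 ≤ ρ + 1))
  have h2 := ENNReal.toReal_mono ENNReal.ofReal_ne_top h1
  rw [ENNReal.toReal_ofReal (by have := hε.1; positivity)] at h2
  refine h2.trans ?_
  have h3 : bb k ε / ε ≤ 1/L := by
    rw [div_le_div_iff₀ hε.1 (by linarith)]; linarith
  have h4 : (bb k ε / ε)^(k+2) ≤ 1/L := by
    have h0 : 0 ≤ bb k ε / ε := by have := hε.1; positivity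
    have h5 : (1:ℝ)/L ≤ 1 := by rw [div_le_one (by linarith)]; exact hL1
    calc (bb k ε / ε)^(k+2) ≤ (bb k ε / ε)^1 := pow_le_pow_of_le_one h0 (h3.trans h5) (by omega)
      _ ≤ _ := by rw [pow_one]; exact h3
  calc (5*(ρ+1))^(k+2) * volume.real (ball (0:Eucl (k+2)) 1) * (bb k ε / ε)^(k+2) ≤ K * (1/L) :=
        mul_le_mul (by rw [hK]; linarith) h4 (by have := hε.1; positivity) hK1.le
    _ ≤ η := by
        rw [mul_one_div, div_le_iff₀ (by linarith), hL, mul_add, mul_div_cancel₀ _ hη.ne']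
        linarith

lemma l1conv {k : ℕ} (hk : 1 ≤ k) {U : Filter ℝ} (hU : U ≤ 𝓝[>] 0) {F : ℝ → Eucl (k+2) → ℝ} {f w : Eucl (k+2) → ℝ}
    {M : ℝ} (hM : 0 ≤ M) (hF : ∀ ε ∈ Ioo (0:ℝ) 1, Continuous (F ε) ∧ ∀ x, |F ε x| ≤ M)
    (hf : Continuous f) (hfM : ∀ x, |f x| ≤ M)
    (hL : ∀ η > (0:ℝ), ∀ᶠ ε in U, ∀ x ∉ holes (k+2) ε (bb k ε), |F ε x - f x| ≤ η)
    (hw : Continuous w) (hwc : HasCompactSupport w) :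
    Tendsto (fun ε => ∫ x, F ε x * w x) U (𝓝 (∫ x, f x * w x)) := by
  obtain ⟨C, hC⟩ := hw.bounded_above_of_compact_support hwc
  have hC0 : 0 ≤ C := (norm_nonneg _).trans (hC 0)
  obtain ⟨ρ, hρ1, hρ⟩ : ∃ ρ ≥ (1:ℝ), ∀ x, x ∉ ball (0:Eucl (k+2)) ρ → w x = 0 := by
    obtain ⟨r, hr⟩ := hwc.isBounded.subset_ball (0:Eucl (k+2))
    refine ⟨max r 1, le_max_right _ _, fun x hx => ?_⟩
    by_contra h
    exact hx (ball_subset_ball (le_max_left _ _) (hr (subset_tsupport w h)))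
  rw [Metric.tendsto_nhds]
  intro η hη
  set V := volume.real (ball (0:Eucl (k+2)) ρ)
  have hV : 0 ≤ V := measureReal_nonneg
  set η1 := η / (2 * (C+1) * (V + 2*M + 1)) with hη1
  have hηpos : 0 < η1 := by positivity
  have hev : ∀ᶠ ε in U, ε ∈ Ioo (0:ℝ) 1 := hU (Ioo_mem_nhdsGT one_pos)
  filter_upwards [hev, hL η1 hηpos, hU (bhole_small hk hρ1 hηpos)] with ε hε h1 h2
  obtain ⟨hFc, hFM⟩ := hF ε hε
  have i1 : Integrable fun x => F ε x * w x := int_mul_supp hw hwc fun x _ => hFc.continuousAt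
  have i2 : Integrable fun x => f x * w x := int_mul_supp hw hwc fun x _ => hf.continuousAt
  have hm : MeasurableSet (holes (k+2) ε (bb k ε) ∩ ball 0 ρ) :=
    (holes_closed hε.1 (bb_pos hε.1).le).measurableSet.inter measurableSet_ball
  set D : Eucl (k+2) → ℝ := fun x => C * η1 * (ball (0:Eucl (k+2)) ρ).indicator (fun _ => 1) x
    + C * (2*M) * (holes (k+2) ε (bb k ε) ∩ ball 0 ρ).indicator (fun _ => 1) x with hD
  have j1 : Integrable ((ball (0:Eucl (k+2)) ρ).indicator (fun _ => (1:ℝ))) :=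
    (integrable_indicator_iff measurableSet_ball).2 (integrableOn_const measure_ball_lt_top.ne)
  have j2 : Integrable ((holes (k+2) ε (bb k ε) ∩ ball 0 ρ).indicator (fun _ => (1:ℝ))) :=
    (integrable_indicator_iff hm).2 (integrableOn_const ((measure_mono inter_subset_right).trans_lt measure_ball_lt_top).ne)
  have dint : Integrable D := (j1.const_mul _).add (j2.const_mul _)
  rw [Real.dist_eq, ← integral_sub i1 i2, ← Real.norm_eq_abs]
  have hle : ‖∫ x, (F ε x * w x - f x * w x)‖ ≤ ∫ x, D x := by
    refine norm_integral_le_of_norm_le dint (Eventually.of_forall fun x => ?_)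
    have hwx := hC x
    rw [← sub_mul, norm_mul, Real.norm_eq_abs]
    by_cases hx : x ∈ ball (0:Eucl (k+2)) ρ
    · by_cases hh : x ∈ holes (k+2) ε (bb k ε)
      · have : x ∈ holes (k+2) ε (bb k ε) ∩ ball 0 ρ := ⟨hh, hx⟩
        simp only [hD, indicator_of_mem hx, indicator_of_mem this]
        have hd : |F ε x - f x| ≤ 2*M := by
          have := abs_sub (F ε x) (f x)
          linarith [hFM x, hfM x]
        have := mul_le_mul hd hwx (norm_nonneg _) (by positivity)
        have : 0 ≤ C * η1 := by positivity
        linarith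
      · have hn : x ∉ holes (k+2) ε (bb k ε) ∩ ball 0 ρ := fun h => hh h.1
        simp only [hD, indicator_of_mem hx, indicator_of_notMem hn]
        have := mul_le_mul (h1 x hh) hwx (norm_nonneg _) hηpos.le
        linarith
    · have hn : x ∉ holes (k+2) ε (bb k ε) ∩ ball 0 ρ := fun h => hx h.2
      simp only [hD, indicator_of_notMem hx, indicator_of_notMem hn, hρ x hx]
      simp
  have hDI : ∫ x, D x = C * η1 * V + C * (2*M) * volume.real (holes (k+2) ε (bb k ε) ∩ ball 0 ρ) := by
    simp only [hD]
    rw [integral_add (j1.const_mul _) (j2.const_mul _), integral_const_mul, integral_const_mul,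
      integral_indicator measurableSet_ball, integral_indicator hm]
    simp [V, Measure.real]
  rw [hDI] at hle
  refine hle.trans_lt ?_
  have h3 : C * (2*M) * volume.real (holes (k+2) ε (bb k ε) ∩ ball 0 ρ) ≤ C * (2*M) * η1 :=
    mul_le_mul_of_nonneg_left h2 (by positivity)
  have h4 : C * η1 * V + C * (2*M) * η1 ≤ (C+1) * (V + 2*M + 1) * η1 := by
    have : 0 ≤ η1 * (V + 2*M + 1 + C) := by positivity
    nlinarith
  have h5 : (C+1) * (V + 2*M + 1) * η1 = η/2 := by
    rw [hη1]; field_simp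
  linarith

lemma JT_lim {k : ℕ} (hk : 1 ≤ k) {a : ℝ → ℝ} {r₀ : ℝ} (hr : 0 < r₀)
    (ha : ∀ᶠ ε in 𝓝[>] (0:ℝ), 0 < a ε)
    (hG : ∀ᶠ ε in 𝓝[>] (0:ℝ), Good k ε (a ε) ε)
    (hr₀ : Tendsto (fun ε => a ε / aStar (k+2) ε) (𝓝[>] (0:ℝ)) (𝓝 r₀)) :
    Tendsto (fun ε => (JT k ε (a ε) ε)⁻¹ * (ε⁻¹)^(k+2)) (𝓝[>] (0:ℝ)) (𝓝 (r₀^k)) := by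
  have h0 : Tendsto (fun ε : ℝ => ε) (𝓝[>] (0:ℝ)) (𝓝 0) := tendsto_nhdsWithin_of_tendsto_nhds tendsto_id
  have ht : Tendsto (fun ε => ((a ε / aStar (k+2) ε)^k)⁻¹) (𝓝[>] (0:ℝ)) (𝓝 ((r₀^k)⁻¹)) :=
    (hr₀.pow k).inv₀ (by positivity)
  have key : Tendsto (fun ε => JT k ε (a ε) ε * ε^(k+2)) (𝓝[>] (0:ℝ)) (𝓝 ((r₀^k)⁻¹)) := by
    have hlow : Tendsto (fun ε => (1 - 2*ε) * ((a ε / aStar (k+2) ε)^k)⁻¹ - 2 * 4^k * ε^2) (𝓝[>] (0:ℝ)) (𝓝 ((r₀^k)⁻¹)) := by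
      have := ((tendsto_const_nhds (x := (1:ℝ))).sub (h0.const_mul 2)).mul ht
      have := this.sub ((h0.pow 2).const_mul (2*4^k))
      simpa using this
    have hpt : ∀ᶠ ε in 𝓝[>] (0:ℝ), ((a ε)⁻¹)^k * ε^(k+2) = ((a ε / aStar (k+2) ε)^k)⁻¹ := by
      filter_upwards [self_mem_nhdsWithin, ha] with ε hε hae
      rw [mem_Ioi] at hε
      rw [div_pow, aStar_pow hk hε, inv_pow]
      field_simp
    refine tendsto_of_tendsto_of_tendsto_of_le_of_le' hlow ht ?_ ?_
    · filter_upwards [hpt, hG, self_mem_nhdsWithin] with ε h1 h2 hε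
      rw [mem_Ioi] at hε
      rw [← h1]
      have := mul_le_mul_of_nonneg_right h2.JT_ge (by positivity : 0 ≤ ε^(k+2))
      have e : ((ε/4)⁻¹)^k * ε^(k+2) = 4^k * ε^2 := by
        rw [inv_div, div_pow, pow_add]; field_simp
      nlinarith
    · filter_upwards [hpt, hG, self_mem_nhdsWithin] with ε h1 h2 hε
      rw [mem_Ioi] at hε
      rw [← h1]
      exact mul_le_mul_of_nonneg_right h2.JT_le (by positivity)
  have := key.inv₀ (by positivity)
  rw [inv_inv] at this
  refine this.congr fun ε => ?_
  rw [mul_inv, inv_pow]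

namespace EV
variable {k : ℕ} {Ω : Set (Eucl (k+2))} {p c₀ C₀ : ℝ} {a : ℝ → ℝ} {Φ : ℝ → Eucl (k+2) → ℝ} {ε : ℝ}

lemma kern_off (hk : 1 ≤ k) (hε : 0 < ε) (hb : 9 * bb k ε ≤ ε) {x : Eucl (k+2)} {z : Fin (k+2) → ℤ}
    (hx : kern (ε/4) (x - lpt ε z) ≠ 0) : x ∉ holes (k+2) ε (bb k ε) ∧ ‖x - lpt ε z‖ ≤ ε/4 := by
  have hb0 := bb_pos (k := k) hε
  have h1 : ‖x - lpt ε z‖ ≤ ε/4 := by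
    by_contra h; exact hx (ker_zero hk (by linarith) (not_le.1 h))
  have h2 : ε/4/2 ≤ ‖x - lpt ε z‖ := by
    by_contra h; exact hx (kern_zero_near hk (by linarith) (not_le.1 h))
  refine ⟨fun hh => ?_, h1⟩
  obtain ⟨m, hm, hd⟩ := mem_holes.1 hh
  obtain ⟨w, rfl⟩ := exists_lp hm
  by_cases hwz : w = z
  · rw [hwz] at hd; linarith
  · have := lp_sep' hε hwz (x := x) (by linarith); linarith

lemma bulk (H : EV k Ω p c₀ C₀ a Φ) {U : Filter ℝ} (hU : U ≤ 𝓝[>] 0)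
    {φ : Eucl (k+2) → ℝ} (hc : Continuous φ) (hL : IsLim k Φ U φ) {ζ : Eucl (k+2) → ℝ} (T : Tst Ω ζ)
    {η : ℝ} (hη : 0 < η) : ∀ᶠ ε in U, ∀ z : Fin (k+2) → ℤ,
      |(∫ x, Φ ε x * ζ x * kern (ε/4) (x - lpt ε z)) - kap k * (φ (lpt ε z) * ζ (lpt ε z))| ≤ η := by
  obtain ⟨C, hC0, hC⟩ := T.bd
  have hkp := kap_pos H.hk
  have hgc : HasCompactSupport (fun x => φ x * ζ x) := T.cs.mul_left
  have huc := (hc.mul T.sm.continuous).uniformContinuous_of_tendsto_cocompact (x := 0) hgc.is_zero_at_infty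
  set η1 := η / (kap k * (C + 1)) with hη1
  have hηpos : 0 < η1 := by positivity
  obtain ⟨d, hd, hdd⟩ := Metric.uniformContinuous_iff.1 huc η1 hηpos
  have he : (0:ℝ) < min (min 1 d) (1/9^k) := by positivity
  have hev : ∀ᶠ ε in U, ε ∈ Ioo (0:ℝ) (min (min 1 d) (1/9^k)) := hU (Ioo_mem_nhdsGT he)
  filter_upwards [hev, hL η1 hηpos] with ε hε h1 z
  have e1 : ε < 1 := hε.2.trans_le ((min_le_left _ _).trans (min_le_left _ _))
  have e2 : ε < d := hε.2.trans_le ((min_le_left _ _).trans (min_le_right _ _))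
  have e3 : ε < 1/9^k := hε.2.trans_le (min_le_right _ _)
  rw [lt_div_iff₀ (by positivity)] at e3
  have hb := bb_small H.hk hε.1 (by norm_num : (0:ℝ) < 9) (by linarith)
  have hr : 0 < ε/4 := by linarith [hε.1]
  have hΦc := H.cont ⟨hε.1, e1⟩
  have i2 : Integrable fun x => Φ ε x * ζ x * kern (ε/4) (x - lpt ε z) :=
    int_mul_supp (ker_sub_cont H.hk hr _) (ker_hcs H.hk hr _)
      fun x _ => (hΦc.mul T.sm.continuous).continuousAt
  have i3 : Integrable fun x => kern (ε/4) (x - lpt ε z) :=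
    (ker_sub_cont H.hk hr _).integrable_of_hasCompactSupport (ker_hcs H.hk hr _)
  have e : kap k * (φ (lpt ε z) * ζ (lpt ε z)) = ∫ x, φ (lpt ε z) * ζ (lpt ε z) * kern (ε/4) (x - lpt ε z) := by
    rw [integral_const_mul, ker_integral H.hk hr]; ring
  rw [e, ← integral_sub i2 (i3.const_mul _), ← Real.norm_eq_abs]
  have : ‖∫ x, (Φ ε x * ζ x * kern (ε/4) (x - lpt ε z) - φ (lpt ε z) * ζ (lpt ε z) * kern (ε/4) (x - lpt ε z))‖
      ≤ ∫ x, (η1 * (C+1)) * kern (ε/4) (x - lpt ε z) := by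
    refine norm_integral_le_of_norm_le (i3.const_mul _) (Eventually.of_forall fun x => ?_)
    have hk0 := ker_nonneg hr (x - lpt ε z)
    rw [← sub_mul, norm_mul, Real.norm_eq_abs, Real.norm_eq_abs, abs_of_nonneg hk0]
    by_cases h0 : kern (ε/4) (x - lpt ε z) = 0
    · simp [h0]
    refine mul_le_mul_of_nonneg_right ?_ hk0
    obtain ⟨q1, q2⟩ := kern_off H.hk hε.1 hb h0
    have q3 := h1 x q1
    have q4 := hdd (a := x) (b := lpt ε z) (by rw [dist_eq_norm]; linarith [hε.1])
    rw [Real.dist_eq] at q4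
    simp only [Pi.mul_apply] at q4
    have q5 : Φ ε x * ζ x - φ (lpt ε z) * ζ (lpt ε z) = (Φ ε x - φ x) * ζ x + (φ x * ζ x - φ (lpt ε z) * ζ (lpt ε z)) := by ring
    rw [q5]
    refine (abs_add_le _ _).trans ?_
    rw [abs_mul]
    have := mul_le_mul q3 (hC x).1 (abs_nonneg _) hηpos.le
    linarith
  refine this.trans ?_
  rw [integral_const_mul, ker_integral H.hk hr, hη1]
  apply le_of_eq
  field_simp

lemma distrib (H : EV k Ω p c₀ C₀ a Φ) {r₀ : ℝ} (hr : 0 < r₀)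
    (hr₀ : Tendsto (fun ε => a ε / aStar (k+2) ε) (𝓝[>] (0:ℝ)) (𝓝 r₀)) {U : Filter ℝ} [U.NeBot] (hU : U ≤ 𝓝[>] 0)
    {φ : Eucl (k+2) → ℝ} (hc : Continuous φ) (hL : IsLim k Φ U φ) (hz : ∀ x ∉ Ω, φ x = 0)
    {ζ : Eucl (k+2) → ℝ} (T : Tst Ω ζ) :
    (∫ x, φ x * lap ζ x) + (∫ x, φ x ^ p * ζ x) = kap k * r₀^k * ∫ x, φ x * ζ x := by
  obtain ⟨M, hM1, hM⟩ := H.bound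
  obtain ⟨ρ, hρ1, hρ⟩ := H.exists_rho
  have hφ0 : ∀ x, 0 ≤ φ x := fun x => by
    by_cases h : x ∈ Ω
    · exact (H.lim_nonneg hU hc hL hz h).le
    · rw [hz x h]
  have hφcs : HasCompactSupport φ := HasCompactSupport.of_support_subset_isCompact
    (isCompact_closedBall 0 ρ) (by
      intro x hx
      have : x ∈ Ω := by by_contra h; exact hx (hz x h)
      exact ball_subset_closedBall (hρ this))
  obtain ⟨M', hM'⟩ := hc.bounded_above_of_compact_support hφcs
  set N := max M M'
  have hN1 : 1 ≤ N := hM1.trans (le_max_left _ _)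
  have hφN : ∀ x, |φ x| ≤ N := fun x => by
    have := hM' x; rw [Real.norm_eq_abs] at this; exact this.trans (le_max_right _ _)
  have hΦN : ∀ ε ∈ Ioo (0:ℝ) 1, Continuous (Φ ε) ∧ ∀ x, |Φ ε x| ≤ N := fun ε hε =>
    ⟨H.cont hε, fun x => by rw [abs_of_nonneg (H.nonneg hε x)]; exact (hM ε hε x).trans (le_max_left _ _)⟩
  have L1 := l1conv H.hk hU (by linarith : 0 ≤ N) hΦN hc hφN hL (lap_cont T.c2) (hcs_lap T.cs)
  have hpc : ∀ {f : Eucl (k+2) → ℝ}, Continuous f → Continuous fun x => f x ^ p := fun h =>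
    h.rpow_const fun x => Or.inr H.hp0.le
  have hpb : ∀ t : ℝ, 0 ≤ t → |t| ≤ N → |t^p| ≤ N := fun t h0 ht => by
    rw [abs_of_nonneg (Real.rpow_nonneg h0 p)]
    exact H.rpow_le_M hN1 h0 (by rwa [abs_of_nonneg h0] at ht)
  have hev1 : ∀ᶠ ε in U, ε ∈ Ioo (0:ℝ) 1 := hU (Ioo_mem_nhdsGT one_pos)
  have L2 := l1conv (F := fun ε x => Φ ε x ^ p) (f := fun x => φ x ^ p) (w := ζ) H.hk hU (by linarith : 0 ≤ N)
    (fun ε hε => ⟨hpc (H.cont hε), fun x => hpb _ (H.nonneg hε x) ((hΦN ε hε).2 x)⟩) (hpc hc)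
    (fun x => hpb _ (hφ0 x) (hφN x)) (by
      intro η hη
      filter_upwards [hL (η^(1/p)) (by positivity), hev1] with ε h1 hε x hx
      refine (rpow_diff H.hp0 H.hp1 (H.nonneg hε x) (hφ0 x)).trans ?_
      calc |Φ ε x - φ x|^p ≤ (η^(1/p))^p := Real.rpow_le_rpow (abs_nonneg _) (h1 x hx) H.hp0.le
        _ = η := by rw [← Real.rpow_mul hη.le, one_div, inv_mul_cancel₀ H.hp0.ne', Real.rpow_one])
    T.sm.continuous T.cs
  have L12 := L1.add L2
  obtain ⟨ε₀, hε₀, hε₀1, hgood⟩ := H.good_ev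
  have hGev : ∀ᶠ ε in 𝓝[>] (0:ℝ), Good k ε (a ε) ε := by
    filter_upwards [Ioo_mem_nhdsGT (lt_min hε₀ (by norm_num : (0:ℝ) < 1/4))] with ε hε
    exact hgood ε ⟨hε.1, hε.2.trans_le (min_le_left _ _)⟩ ε hε.1 (hε.2.le.trans (min_le_right _ _))
  have hapos : ∀ᶠ ε in 𝓝[>] (0:ℝ), 0 < a ε := by
    filter_upwards [Ioo_mem_nhdsGT one_pos] with ε hε using H.a_pos hε
  have hJ := (JT_lim H.hk hr hapos hGev hr₀).mono_left hU
  have hRie := (riemann (g := fun x => φ x * ζ x) (hc.mul T.sm.continuous) (R := ρ+1) (by linarith) (by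
    intro x hx
    have : x ∉ Ω := fun h => by
      have := hρ h; rw [mem_ball, dist_zero_right] at this; linarith
    simp [hz x this])).mono_left hU
  have hprod := (hJ.mul hRie).const_mul (kap k)
  have hdiff : Tendsto (fun ε => ((∫ x, Φ ε x * lap ζ x) + ∫ x, Φ ε x ^ p * ζ x) -
      kap k * ((JT k ε (a ε) ε)⁻¹ * (ε⁻¹)^(k+2) * (ε^(k+2) * ∑ z ∈ Zf (k+2) ε (ρ+1), φ (lpt ε z) * ζ (lpt ε z)))) U (𝓝 0) := by
    obtain ⟨C, hC0, hq⟩ := H.q_est T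
    rw [Metric.tendsto_nhds]
    intro η hη
    set K := 4 * C₀^k * (5*(ρ+1))^(k+2) with hK
    have hKp : 0 < K := by have := H.hC₀; positivity
    have hev2 : ∀ᶠ ε in U, ε ∈ Ioo (0:ℝ) (η/(3*K*(C+1))) := hU (Ioo_mem_nhdsGT (by positivity))
    filter_upwards [hev1, hev2, hU hGev, H.bulk hU hc hL T (η := η/(3*K)) (by positivity)] with ε hε hε2 G hb
    rw [Real.dist_eq, sub_zero]
    have hΦc := H.cont hε
    have i1 : Integrable fun x => Φ ε x * lap ζ x := int_mul_supp (lap_cont T.c2) (hcs_lap T.cs) fun x _ => hΦc.continuousAt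
    have i2 : Integrable fun x => Φ ε x ^ p * ζ x := int_mul_supp T.sm.continuous T.cs fun x _ => (hpc hΦc).continuousAt
    rw [← integral_add i1 i2, H.test_id hε G hρ le_rfl T]
    have hε0 := hε.1
    have e1 : kap k * ((JT k ε (a ε) ε)⁻¹ * (ε⁻¹)^(k+2) * (ε^(k+2) * ∑ z ∈ Zf (k+2) ε (ρ+1), φ (lpt ε z) * ζ (lpt ε z)))
      = (JT k ε (a ε) ε)⁻¹ * ∑ z ∈ Zf (k+2) ε (ρ+1), kap k * (φ (lpt ε z) * ζ (lpt ε z)) := by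
      rw [← Finset.mul_sum, inv_pow]; field_simp
    rw [e1, ← mul_sub, ← Finset.sum_sub_distrib, abs_mul, abs_of_pos (inv_pos.2 G.JT_pos)]
    have hJ0 := inv_pos.2 G.JT_pos
    have h1 : |∑ z ∈ Zf (k+2) ε (ρ+1), ((∫ x, qq (Φ ε) p ζ (fun y => bump1 k ε (a ε) ε (y - lpt ε z)) x)
        - kap k * (φ (lpt ε z) * ζ (lpt ε z)))| ≤ (Zf (k+2) ε (ρ+1)).card * (C * ε + η/(3*K)) := by
      refine (Finset.abs_sum_le_sum_abs _ _).trans ((Finset.sum_le_card_nsmul _ _ (C * ε + η/(3*K)) fun z _ => ?_).trans ?_)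
      · have := hq ε hε G z
        have := hb z
        calc _ = |((∫ x, qq (Φ ε) p ζ (fun y => bump1 k ε (a ε) ε (y - lpt ε z)) x) -
            ∫ x, Φ ε x * ζ x * kern (ε/4) (x - lpt ε z)) + ((∫ x, Φ ε x * ζ x * kern (ε/4) (x - lpt ε z)) - kap k * (φ (lpt ε z) * ζ (lpt ε z)))| := by
              congr 1; ring
          _ ≤ _ := (abs_add_le _ _).trans (by linarith)
      · rw [nsmul_eq_mul]
    have hJc := H.JT_card hε G (by linarith : 1 ≤ ρ + 1)
    have h2 : C * ε + η/(3*K) ≤ 2 * (η/(3*K)) := by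
      have : C * ε ≤ η/(3*K) := by
        have h3 := hε2.2
        rw [lt_div_iff₀ (by positivity)] at h3
        rw [le_div_iff₀ (by positivity)]
        nlinarith
      linarith
    calc _ ≤ (JT k ε (a ε) ε)⁻¹ * ((Zf (k+2) ε (ρ+1)).card * (C * ε + η/(3*K))) := mul_le_mul_of_nonneg_left h1 hJ0.le
      _ = ((JT k ε (a ε) ε)⁻¹ * (Zf (k+2) ε (ρ+1)).card) * (C * ε + η/(3*K)) := by ring
      _ ≤ K * (2 * (η/(3*K))) := mul_le_mul hJc h2 (by positivity) hKp.le
      _ = 2*η/3 := by field_simp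
      _ < η := by linarith
  have := tendsto_nhds_unique hdiff (L12.sub hprod)
  linarith
end EV
end

section
open scoped Convolution in
lemma pd_conv {n : ℕ} {i : Fin n} {g φ : Eucl n → ℝ} (hg : ContDiff ℝ (⊤ : ℕ∞) g) (hc : HasCompactSupport g)
    (hφ : Continuous φ) :
    pd i (fun x => ∫ t, g t * φ (x - t)) = fun x => ∫ t, pd i g t * φ (x - t) := by
  ext x
  have h := hc.hasFDerivAt_convolution_left (ContinuousLinearMap.mul ℝ ℝ) (μ := volume)
    (hg.of_le (by exact_mod_cast le_top)) hφ.locallyIntegrable x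
  have e : (fun x => ∫ t, g t * φ (x - t)) = g ⋆[ContinuousLinearMap.mul ℝ ℝ, volume] φ := by
    ext y; simp [convolution_def]
  unfold pd
  rw [e, h.fderiv, convolution_def, ContinuousLinearMap.integral_apply]
  · simp
  · have h2 := (hc.fderiv (𝕜 := ℝ)).convolutionExists_left ((ContinuousLinearMap.mul ℝ ℝ).precompL (Eucl n)) (μ := volume)
      (hg.continuous_fderiv (by simp)) hφ.locallyIntegrable x
    exact h2

lemma lap_neg_arg {n : ℕ} {g : Eucl n → ℝ} (hg : ∀ y, g (-y) = g y) (x : Eucl n) : lap g (-x) = lap g x := by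
  rw [lap_eq_pd, lap_eq_pd]
  refine Finset.sum_congr rfl fun i _ => ?_
  have h1 : ∀ u : Eucl n → ℝ, ∀ y, pd i (fun y => u (-y)) y = - pd i u (-y) := fun u y => by
    unfold pd
    have := (ContinuousLinearEquiv.neg ℝ (M := Eucl n)).comp_right_fderiv (f := u) (x := y)
    have e : (fun y => u (-y)) = u ∘ (ContinuousLinearEquiv.neg ℝ (M := Eucl n)) := by ext y; simp
    rw [e, this]; simp
  have e : pd i g = fun y => (-1) * pd i g (-y) := by
    ext y
    have := h1 g y
    simp only [hg] at this
    rw [show (fun y => g y) = g from rfl] at this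
    rw [this]; ring
  have h2 : pd i (fun y => (-1) * pd i g (-y)) x = pd i (pd i g) (-x) := by
    have h3 := h1 (fun y => (-1) * pd i g y) x
    have h4 : pd i (fun y => (-1) * pd i g y) (-x) = - pd i (pd i g) (-x) := by
      unfold pd
      rw [show (fun y => (-1) * (fderiv ℝ g y) (EuclideanSpace.single i 1)) =
        fun y => - (fderiv ℝ g y) (EuclideanSpace.single i 1) by ext; ring, fderiv_fun_neg]; simp
    rw [h3, h4]; ring
  rw [← e] at h2
  exact h2.symm

/-- smooth approximability of a continuous weak solution of `lap φ = f`. -/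
def Appr {n : ℕ} (Ω : Set (Eucl n)) (φ f : Eucl n → ℝ) : Prop :=
  ∀ K : Set (Eucl n), IsCompact K → K ⊆ Ω → ∃ u : ℕ → Eucl n → ℝ, (∀ j, ContDiff ℝ (⊤ : ℕ∞) (u j)) ∧
    ∀ j : ℕ, ∀ x ∈ K, |u j x - φ x| ≤ 1/((j:ℝ)+1) ∧ |lap (u j) x - f x| ≤ 1/((j:ℝ)+1)

open scoped Convolution in
lemma appr_of_weak {n : ℕ} {Ω : Set (Eucl n)} (hΩ : IsOpen Ω) {φ f : Eucl n → ℝ} (hφ : Continuous φ) (hf : Continuous f)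
    (hφc : HasCompactSupport φ) (hfc : HasCompactSupport f)
    (hw : ∀ ζ, Tst Ω ζ → ∫ x, φ x * lap ζ x = ∫ x, f x * ζ x) : Appr Ω φ f := by
  intro K hK hKΩ
  suffices ∀ j : ℕ, ∃ u : Eucl n → ℝ, ContDiff ℝ (⊤ : ℕ∞) u ∧
    ∀ x ∈ K, |u x - φ x| ≤ 1/((j:ℝ)+1) ∧ |lap u x - f x| ≤ 1/((j:ℝ)+1) by
    choose u h1 h2 using this
    exact ⟨u, h1, h2⟩
  intro j
  have hη : (0:ℝ) < 1/((j:ℝ)+1) := by positivity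
  set η := 1/((j:ℝ)+1)
  have u1 := hφ.uniformContinuous_of_tendsto_cocompact (x := 0) hφc.is_zero_at_infty
  have u2 := hf.uniformContinuous_of_tendsto_cocompact (x := 0) hfc.is_zero_at_infty
  obtain ⟨d1, hd1, h1⟩ := Metric.uniformContinuous_iff.1 u1 η hη
  obtain ⟨d2, hd2, h2⟩ := Metric.uniformContinuous_iff.1 u2 η hη
  obtain ⟨d3, hd3, h3⟩ := hK.exists_cthickening_subset_open hΩ hKΩ
  set d := min (min d1 d2) d3
  have hd : 0 < d := lt_min (lt_min hd1 hd2) hd3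
  have hdd1 : d ≤ d1 := (min_le_left _ _).trans (min_le_left _ _)
  have hdd2 : d ≤ d2 := (min_le_left _ _).trans (min_le_right _ _)
  have hdd3 : d ≤ d3 := min_le_right _ _
  let B : ContDiffBump (0 : Eucl n) := ⟨d/2, d, by linarith, by linarith⟩
  set g : Eucl n → ℝ := B.normed volume with hg
  have hgs : ContDiff ℝ (⊤ : ℕ∞) g := B.contDiff_normed
  have hgc : HasCompactSupport g := B.hasCompactSupport_normed
  have hgn : ∀ y, g (-y) = g y := fun y => B.normed_neg (μ := volume) y
  have key : ∀ h : Eucl n → ℝ, Continuous h → ∀ x, (∀ y, dist y x < d → dist (h y) (h x) ≤ η) →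
      |(∫ t, g t * h (x - t)) - h x| ≤ η := by
    intro h hh x hx
    have := B.dist_normed_convolution_le (μ := volume) (g := h) (x₀ := x) (ε := η) hh.aestronglyMeasurable
      (fun y hy => hx y hy)
    rw [Real.dist_eq, convolution_def] at this
    simpa using this
  refine ⟨fun x => ∫ t, g t * φ (x - t), ?_, fun x hx => ⟨?_, ?_⟩⟩
  · have := hgc.contDiff_convolution_left (ContinuousLinearMap.mul ℝ ℝ) (μ := volume) hgs hφ.locallyIntegrable
    have e : (fun x => ∫ t, g t * φ (x - t)) = g ⋆[ContinuousLinearMap.mul ℝ ℝ, volume] φ := by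
      ext y; simp [convolution_def]
    rw [e]; exact this
  · exact key φ hφ x fun y hy => (h1 (hy.trans_le hdd1)).le
  · have e1 : lap (fun x => ∫ t, g t * φ (x - t)) x = ∫ t, lap g t * φ (x - t) := by
      rw [lap_eq_pd]
      have : ∀ i, pd i (pd i (fun x => ∫ t, g t * φ (x - t))) x = ∫ t, pd i (pd i g) t * φ (x - t) := fun i => by
        rw [pd_conv hgs hgc hφ, pd_conv (pd_smooth hgs) (hcs_pd i hgc) hφ]
      simp only [this, lap_eq_pd, Finset.sum_mul]
      rw [integral_finsetSum]
      intro i _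
      refine Continuous.integrable_of_hasCompactSupport ?_ ?_
      · exact (pd_smooth (pd_smooth hgs)).continuous.mul (hφ.comp (by fun_prop))
      · exact (hcs_pd i (hcs_pd i hgc)).mul_right
    have T : Tst Ω (fun y => g (y - x)) := by
      have hts : tsupport (fun y => g (y - x)) ⊆ closedBall x d := by
        refine closure_minimal ?_ isClosed_closedBall
        intro y hy
        have : y - x ∈ Function.support g := hy
        rw [hg, B.support_normed_eq, mem_ball, dist_zero_right] at this
        rw [mem_closedBall, dist_eq_norm]; exact this.le
      refine ⟨hgs.comp (contDiff_id.sub contDiff_const), ?_, hts.trans ?_⟩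
      · exact HasCompactSupport.of_support_subset_isCompact (isCompact_closedBall x d) ((subset_tsupport _).trans hts)
      · refine (closedBall_subset_closedBall hdd3).trans (Subset.trans ?_ h3)
        exact closedBall_subset_cthickening hx _
    have e2 : ∫ t, lap g t * φ (x - t) = ∫ y, φ y * lap (fun y => g (y - x)) y := by
      rw [← integral_sub_left_eq_self (fun t => lap g t * φ (x - t)) volume x]
      congr 1; ext y
      rw [lap_comp_sub, sub_sub_cancel, ← lap_neg_arg hgn, neg_sub, mul_comm]
    have e3 : ∫ y, f y * g (y - x) = ∫ t, g t * f (x - t) := by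
      rw [← integral_sub_left_eq_self (fun t => g t * f (x - t)) volume x]
      congr 1; ext y
      rw [sub_sub_cancel, ← hgn, neg_sub, mul_comm]
    rw [e1, e2, hw _ T, e3]
    exact key f hf x fun y hy => (h2 (hy.trans_le hdd2)).le

lemma Appr.neg {n : ℕ} {Ω : Set (Eucl n)} {φ f : Eucl n → ℝ} (h : Appr Ω φ f) :
    Appr Ω (fun x => - φ x) (fun x => - f x) := by
  intro K hK hKΩ
  obtain ⟨u, hu, h2⟩ := h K hK hKΩ
  refine ⟨fun j x => - u j x, fun j => (hu j).neg, fun j x hx => ?_⟩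
  obtain ⟨q1, q2⟩ := h2 j x hx
  rw [lap_neg ((hu j).contDiffAt.of_le two_le_inf)]
  constructor
  · rw [← abs_neg]; convert q1 using 2; ring
  · rw [← abs_neg]; convert q2 using 2; ring

lemma seq_lim {X : Type*} [TopologicalSpace X] {K : Set X} {v : ℕ → X → ℝ} {φ : X → ℝ} {xs : ℕ → X} {x : X} {s : ℕ → ℕ}
    (hs : Tendsto s atTop atTop) (hv : ∀ j : ℕ, ∀ x ∈ K, |v j x - φ x| ≤ 1/((j:ℝ)+1)) (hφ : Continuous φ) (hx : ∀ j, xs j ∈ K)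
    (hl : Tendsto (xs ∘ s) atTop (𝓝 x)) : Tendsto (fun j => v (s j) (xs (s j))) atTop (𝓝 (φ x)) := by
  have h1 : Tendsto (fun j => φ (xs (s j))) atTop (𝓝 (φ x)) := (hφ.tendsto x).comp hl
  have h2 : Tendsto (fun j => v (s j) (xs (s j)) - φ (xs (s j))) atTop (𝓝 0) := by
    refine squeeze_zero_norm (a := fun j => 1/((s j : ℝ)+1)) (fun j => ?_) ?_
    · exact hv _ _ (hx _)
    · exact tendsto_one_div_add_atTop_nhds_zero_nat.comp hs
  have := h2.add h1
  simpa using this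

lemma visc_core {n : ℕ} {Ω : Set (Eucl n)} (hΩ : IsOpen Ω) {φ f : Eucl n → ℝ} (hφ : Continuous φ) (hf : Continuous f)
    (hA : Appr Ω φ f) {ψ : Eucl n → ℝ} (hψ : ContDiff ℝ (⊤ : ℕ∞) ψ) {x : Eucl n} (hx : x ∈ Ω) (he : ψ x = φ x)
    (hle : ∀ᶠ y in 𝓝 x, φ y ≤ ψ y) : f x ≤ lap ψ x := by
  suffices ∀ δ > (0:ℝ), f x ≤ lap ψ x + δ * (2 * n) by
    have h1 : Tendsto (fun δ : ℝ => lap ψ x + δ * (2 * n)) (𝓝[>] 0) (𝓝 (lap ψ x + 0 * (2*n))) :=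
      (tendsto_nhdsWithin_of_tendsto_nhds ((Continuous.tendsto (by fun_prop) 0)))
    rw [zero_mul, add_zero] at h1
    exact ge_of_tendsto h1 (by filter_upwards [self_mem_nhdsWithin] with δ hδ using this δ hδ)
  intro δ hδ
  obtain ⟨r, hr, hr2⟩ := Metric.nhds_basis_closedBall.mem_iff.1 (Filter.inter_mem (hΩ.mem_nhds hx) hle)
  have hK := isCompact_closedBall x r
  obtain ⟨u, hu, hu2⟩ := hA _ hK fun y hy => (hr2 hy).1
  have hc : ∀ j, Continuous fun y => u j y - ψ y - δ * ‖y - x‖^2 := fun j =>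
    ((hu j).continuous.sub hψ.continuous).sub (by fun_prop)
  have := fun j => hK.exists_isMaxOn ⟨x, mem_closedBall_self hr.le⟩ (hc j).continuousOn
  choose xs hxs hmax using this
  obtain ⟨xl, hxl, s, hs, hlim⟩ := hK.tendsto_subseq hxs
  have hst := hs.tendsto_atTop
  have l1 := seq_lim hst (fun j y hy => (hu2 j y hy).1) hφ hxs hlim
  have l2 := seq_lim hst (v := fun j => lap (u j)) (fun j y hy => (hu2 j y hy).2) hf hxs hlim
  have l3 := seq_lim (xs := fun _ => x) (x := x) hst (fun j y hy => (hu2 j y hy).1) hφ (fun _ => mem_closedBall_self hr.le) tendsto_const_nhds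
  have l4 : Tendsto (fun j => ψ (xs (s j))) atTop (𝓝 (ψ xl)) := (hψ.continuous.tendsto xl).comp hlim
  have l5 : Tendsto (fun j => δ * ‖xs (s j) - x‖^2) atTop (𝓝 (δ * ‖xl - x‖^2)) :=
    (((hlim.sub_const x).norm).pow 2).const_mul δ
  have l6 := le_of_tendsto_of_tendsto (l3.sub_const (ψ x)) ((l1.sub l4).sub l5) (Eventually.of_forall fun j => by
    have := hmax (s j) (mem_closedBall_self hr.le)
    simpa using this)
  have hxx : xl = x := by
    have h1 : φ xl ≤ ψ xl := (hr2 hxl).2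
    have h2 : δ * ‖xl - x‖^2 ≤ 0 := by rw [he] at l6; linarith
    have h3 : ‖xl - x‖^2 ≤ 0 := nonpos_of_mul_nonpos_right h2 hδ
    have h4 : ‖xl - x‖ = 0 := by nlinarith [norm_nonneg (xl - x)]
    exact sub_eq_zero.1 (norm_eq_zero.1 h4)
  subst hxx
  have l7 : Tendsto (fun j => lap ψ (xs (s j))) atTop (𝓝 (lap ψ xl)) :=
    ((lap_cont (hψ.of_le two_le_inf)).tendsto xl).comp hlim
  refine le_of_tendsto_of_tendsto l2 (l7.add_const _) ?_
  have hev : ∀ᶠ j in atTop, xs (s j) ∈ ball xl r := hlim.eventually (ball_mem_nhds xl hr)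
  filter_upwards [hev] with j hj
  have hmx : IsLocalMax (fun y => u (s j) y - ψ y - δ * ‖y - xl‖^2) (xs (s j)) := by
    filter_upwards [isOpen_ball.mem_nhds hj] with y hy
    exact hmax (s j) (ball_subset_closedBall hy)
  have c1 : ContDiffAt ℝ 2 (u (s j)) (xs (s j)) := (hu _).contDiffAt.of_le two_le_inf
  have c2 : ContDiffAt ℝ 2 ψ (xs (s j)) := hψ.contDiffAt.of_le two_le_inf
  have c3 : ContDiffAt ℝ 2 (fun y => ‖y - xl‖^2) (xs (s j)) := (sqd_smooth xl).contDiffAt.of_le two_le_inf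
  have := lap_local_max hmx ((c1.sub c2).sub (contDiffAt_const.mul c3))
  rw [lap_sub (c1.sub c2) (contDiffAt_const.mul c3), lap_sub c1 c2, lap_const_mul δ c3, lap_sqd] at this
  linarith
end

section
lemma rp_d1 {q t : ℝ} (ht : 0 < t) : deriv (fun s : ℝ => s ^ q) t = q * t ^ (q-1) :=
  (Real.hasDerivAt_rpow_const (Or.inl ht.ne')).deriv

lemma rp_d2 {q t : ℝ} (ht : 0 < t) : deriv (deriv (fun s : ℝ => s ^ q)) t = q * ((q-1) * t ^ (q-1-1)) := by
  have : deriv (fun s : ℝ => s ^ q) =ᶠ[𝓝 t] fun s => q * s ^ (q-1) := by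
    filter_upwards [lt_mem_nhds ht] with s hs using rp_d1 hs
  rw [this.deriv_eq]
  exact ((Real.hasDerivAt_rpow_const (Or.inl ht.ne')).const_mul q).deriv

lemma cmp_pt {n : ℕ} {u v : Eucl n → ℝ} {x : Eucl n} {p : ℝ} (hp0 : 0 < p) (hp1 : p < 1)
    (hu : ContDiffAt ℝ 2 u x) (hv : ContDiffAt ℝ 2 v x) (hu0 : 0 < u x) (hv0 : 0 < v x) (hvu : v x ≤ u x)
    (hm : IsLocalMax (fun y => u y ^ (1-p) - v y ^ (1-p)) x) :
    (u x)^(-p) * lap u x ≤ (v x)^(-p) * lap v x := by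
  have gu : ContDiffAt ℝ 2 (fun s : ℝ => s^(1-p)) (u x) := Real.contDiffAt_rpow_const_of_ne hu0.ne'
  have gv : ContDiffAt ℝ 2 (fun s : ℝ => s^(1-p)) (v x) := Real.contDiffAt_rpow_const_of_ne hv0.ne'
  have cu : ContDiffAt ℝ 2 (fun y => u y ^ (1-p)) x := gu.comp x hu
  have cv : ContDiffAt ℝ 2 (fun y => v y ^ (1-p)) x := gv.comp x hv
  have L := lap_local_max hm (cu.sub cv)
  rw [lap_sub cu cv, lap_comp (g := fun s : ℝ => s^(1-p)) gu hu, lap_comp (g := fun s : ℝ => s^(1-p)) gv hv,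
    rp_d1 hu0, rp_d1 hv0, rp_d2 hu0, rp_d2 hv0, show (1 - p - 1 : ℝ) = -p by ring] at L
  have hq : 0 < 1 - p := by linarith
  have P : ∀ i, (u x)^(-p) * pd i u x = (v x)^(-p) * pd i v x := fun i => by
    have h1 := pd_local_max (i := i) hm
    have h2 := pd_add' (i := i) (u := fun y => u y ^ (1-p)) (v := fun y => (-1) * v y ^ (1-p)) (diff_of_c2 cu) ((diff_of_c2 cv).const_mul _)
    rw [show (fun y => u y ^ (1-p) - v y ^ (1-p)) = fun y => u y ^ (1-p) + (-1) * v y ^ (1-p) by ext; ring, h2,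
      pd_const_mul _ (diff_of_c2 cv),
      pd_comp (g := fun s : ℝ => s^(1-p)) (gu.differentiableAt (by norm_num)) (diff_of_c2 hu),
      pd_comp (g := fun s : ℝ => s^(1-p)) (gv.differentiableAt (by norm_num)) (diff_of_c2 hv),
      rp_d1 hu0, rp_d1 hv0, show (1 - p - 1 : ℝ) = -p by ring] at h1
    have : (1-p) * ((u x)^(-p) * pd i u x - (v x)^(-p) * pd i v x) = 0 := by linarith
    rcases mul_eq_zero.1 this with h | h <;> linarith
  have S : ((u x)^(-p))^2 * gsq u x = ((v x)^(-p))^2 * gsq v x := by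
    simp only [gsq, Finset.mul_sum]
    refine Finset.sum_congr rfl fun i _ => ?_
    rw [← mul_pow, ← mul_pow, P i]
  have E : ∀ t : ℝ, 0 < t → t^(-p-1) = (t^(-p))^2 * t^(p-1) := fun t ht => by
    rw [← Real.rpow_natCast, ← Real.rpow_mul ht.le, ← Real.rpow_add ht]; congr 1; push_cast; ring
  have B : (u x)^(p-1) ≤ (v x)^(p-1) := Real.rpow_le_rpow_of_nonpos hv0 hvu (by linarith)
  have S0 : 0 ≤ ((v x)^(-p))^2 * gsq v x := mul_nonneg (sq_nonneg _) (gsq_nonneg _ _)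
  rw [E _ hu0, E _ hv0] at L
  have L2 : (1-p) * (((u x)^(-p) * lap u x - (v x)^(-p) * lap v x)
     - p * (((u x)^(-p))^2 * gsq u x * (u x)^(p-1) - ((v x)^(-p))^2 * gsq v x * (v x)^(p-1))) ≤ 0 := by linarith
  have L3 := nonpos_of_mul_nonpos_right L2 hq
  rw [S, ← mul_sub] at L3
  have : p * (((v x)^(-p))^2 * gsq v x * ((u x)^(p-1) - (v x)^(p-1))) ≤ 0 :=
    mul_nonpos_of_nonneg_of_nonpos hp0.le (mul_nonpos_of_nonneg_of_nonpos S0 (by linarith))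
  linarith

lemma cmp_sol {n : ℕ} {Ω : Set (Eucl n)} (hb : Bornology.IsBounded Ω) {κ p : ℝ} (hκ : 0 < κ) (hp0 : 0 < p) (hp1 : p < 1)
    {φ χ : Eucl n → ℝ} (hφ : Continuous φ) (hχ : Continuous χ) (zφ : ∀ x ∉ Ω, φ x = 0) (zχ : ∀ x ∉ Ω, χ x = 0)
    (pφ : ∀ x ∈ Ω, 0 < φ x) (pχ : ∀ x ∈ Ω, 0 < χ x)
    (Aφ : Appr Ω φ fun x => κ * φ x - φ x ^ p) (Aχ : Appr Ω χ fun x => κ * χ x - χ x ^ p) (x : Eucl n) :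
    φ x ≤ χ x := by
  by_contra! hlt
  have hq : 0 < 1 - p := by linarith
  have nχ : ∀ y, 0 ≤ χ y := fun y => by
    by_cases h : y ∈ Ω
    · exact (pχ y h).le
    · rw [zχ y h]
  have rc : ∀ {h : Eucl n → ℝ}, Continuous h → Continuous fun y => h y ^ (1-p) := fun h =>
    h.rpow_const fun _ => Or.inr hq.le
  have rc' : ∀ {h : Eucl n → ℝ}, Continuous h → Continuous fun y => κ * h y - h y ^ p := fun h =>
    (continuous_const.mul h).sub (h.rpow_const fun _ => Or.inr hp0.le)
  set G : Eucl n → ℝ := fun y => φ y ^ (1-p) - χ y ^ (1-p) with hG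
  have hGc : Continuous G := (rc hφ).sub (rc hχ)
  have hGx : 0 < G x := sub_pos.2 (Real.rpow_lt_rpow (nχ x) hlt hq)
  set K := {y | G x / 2 ≤ G y} with hK
  have hKΩ : K ⊆ Ω := fun y hy => by
    by_contra h
    have : G y = 0 := by simp [hG, zφ y h, zχ y h]
    have h2 : G x / 2 ≤ G y := hy
    linarith
  have hKc : IsCompact K := Metric.isCompact_of_isClosed_isBounded (isClosed_le continuous_const hGc) (hb.subset hKΩ)
  have hxK : x ∈ K := by show G x / 2 ≤ G x; linarith
  obtain ⟨u, hu, hu2⟩ := Aφ K hKc hKΩ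
  obtain ⟨v, hv, hv2⟩ := Aχ K hKc hKΩ
  have := fun j => hKc.exists_isMaxOn ⟨x, hxK⟩ ((rc (hu j).continuous).sub (rc (hv j).continuous)).continuousOn
  choose xs hxs hmax using this
  obtain ⟨y, hy, s, hs, hlim⟩ := hKc.tendsto_subseq hxs
  have hst := hs.tendsto_atTop
  have lu := seq_lim hst (fun j y hy => (hu2 j y hy).1) hφ hxs hlim
  have lv := seq_lim hst (fun j y hy => (hv2 j y hy).1) hχ hxs hlim
  have lu0 := seq_lim (xs := fun _ => x) (x := x) hst (fun j y hy => (hu2 j y hy).1) hφ (fun _ => hxK) tendsto_const_nhds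
  have lv0 := seq_lim (xs := fun _ => x) (x := x) hst (fun j y hy => (hv2 j y hy).1) hχ (fun _ => hxK) tendsto_const_nhds
  have lu2 := seq_lim hst (v := fun j => lap (u j)) (fun j y hy => (hu2 j y hy).2) (rc' hφ) hxs hlim
  have lv2 := seq_lim hst (v := fun j => lap (v j)) (fun j y hy => (hv2 j y hy).2) (rc' hχ) hxs hlim
  have R := fun (f : ℕ → ℝ) (l : ℝ) (h : Tendsto f atTop (𝓝 l)) => h.rpow_const (p := 1-p) (Or.inr hq.le)
  have hGy : G x ≤ G y := le_of_tendsto_of_tendsto ((R _ _ lu0).sub (R _ _ lv0)) ((R _ _ lu).sub (R _ _ lv))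
    (Eventually.of_forall fun j => hmax (s j) hxK)
  have hyΩ := hKΩ hy
  have h1 := pφ y hyΩ
  have h2 := pχ y hyΩ
  have h3 : χ y < φ y := by
    have : χ y ^ (1-p) < φ y ^ (1-p) := by
      have : 0 < G y := by linarith
      exact sub_pos.1 this
    exact (Real.rpow_lt_rpow_iff h2.le h1.le hq).1 this
  have hev : ∀ᶠ j in atTop, xs (s j) ∈ {z | G x / 2 < G z} :=
    hlim.eventually ((isOpen_lt continuous_const hGc).mem_nhds (by show G x / 2 < G y; linarith))
  have F := le_of_tendsto_of_tendsto ((lu.rpow_const (p := -p) (Or.inl h1.ne')).mul lu2)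
    ((lv.rpow_const (p := -p) (Or.inl h2.ne')).mul lv2) (by
      filter_upwards [hev, lu.eventually (lt_mem_nhds h1), lv.eventually (lt_mem_nhds h2), lv.eventually_lt lu h3] with j q1 q2 q3 q4
      refine cmp_pt hp0 hp1 ((hu _).contDiffAt.of_le two_le_inf) ((hv _).contDiffAt.of_le two_le_inf) q2 q3 q4.le ?_
      filter_upwards [(isOpen_lt continuous_const hGc).mem_nhds q1] with z hz
      have hz' : z ∈ K := le_of_lt hz
      exact hmax (s j) hz')
  have E : ∀ t : ℝ, 0 < t → t^(-p) * (κ * t - t^p) = κ * t^(1-p) - 1 := fun t ht => by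
    rw [mul_sub, ← Real.rpow_add ht, neg_add_cancel, Real.rpow_zero, show (1 - p) = (-p) + 1 by ring, Real.rpow_add_one ht.ne']
    ring
  rw [E _ h1, E _ h2] at F
  have : κ * G y ≤ 0 := by simp only [hG]; linarith
  have : 0 < κ * G y := mul_pos hκ (by linarith)
  linarith

namespace EV
variable {k : ℕ} {Ω : Set (Eucl (k+2))} {p c₀ C₀ : ℝ} {a : ℝ → ℝ} {Φ : ℝ → Eucl (k+2) → ℝ}

lemma lim_appr (H : EV k Ω p c₀ C₀ a Φ) {r₀ : ℝ} (hr : 0 < r₀)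
    (hr₀ : Tendsto (fun ε => a ε / aStar (k+2) ε) (𝓝[>] (0:ℝ)) (𝓝 r₀)) {U : Filter ℝ} [U.NeBot] (hU : U ≤ 𝓝[>] 0)
    {φ : Eucl (k+2) → ℝ} (hc : Continuous φ) (hL : IsLim k Φ U φ) (hz : ∀ x ∉ Ω, φ x = 0) :
    Appr Ω φ fun x => (kap k * r₀^k) * φ x - φ x ^ p := by
  obtain ⟨ρ, hρ1, hρ⟩ := H.exists_rho
  have cs : ∀ h : Eucl (k+2) → ℝ, (∀ x ∉ Ω, h x = 0) → HasCompactSupport h := fun h h0 =>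
    HasCompactSupport.of_support_subset_isCompact (isCompact_closedBall 0 ρ) (by
      intro x hx
      have : x ∈ Ω := by by_contra h; exact hx (h0 x h)
      exact ball_subset_closedBall (hρ this))
  have pc : Continuous fun x => φ x ^ p := hc.rpow_const fun _ => Or.inr H.hp0.le
  refine appr_of_weak H.hΩo hc ((continuous_const.mul hc).sub pc) (cs _ hz) (cs _ fun x hx => ?_) ?_
  · simp [hz x hx, Real.zero_rpow H.hp0.ne']
  · intro ζ T
    have := H.distrib hr hr₀ hU hc hL hz T
    have i1 : Integrable fun x => φ x * ζ x := int_mul_supp T.sm.continuous T.cs fun x _ => hc.continuousAt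
    have i2 : Integrable fun x => φ x ^ p * ζ x := int_mul_supp T.sm.continuous T.cs fun x _ => pc.continuousAt
    have e : (fun x => ((kap k * r₀^k) * φ x - φ x ^ p) * ζ x) = fun x => (kap k * r₀^k) * (φ x * ζ x) - φ x ^ p * ζ x := by
      ext; ring
    rw [e, integral_sub (i1.const_mul _) i2, integral_const_mul]
    linarith

lemma main_lim (H : EV k Ω p c₀ C₀ a Φ) {r₀ : ℝ} (hr : 0 < r₀)
    (hr₀ : Tendsto (fun ε => a ε / aStar (k+2) ε) (𝓝[>] (0:ℝ)) (𝓝 r₀)) :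
    ∃ φ : Eucl (k+2) → ℝ, Continuous φ ∧ (∀ x ∉ Ω, φ x = 0) ∧ (∀ x ∈ Ω, 0 < φ x) ∧ IsLim k Φ (𝓝[>] 0) φ ∧
      Appr Ω φ fun x => (kap k * r₀^k) * φ x - φ x ^ p := by
  have hκ : 0 < kap k * r₀^k := mul_pos (kap_pos H.hk) (by positivity)
  have main : ∀ U : Ultrafilter ℝ, (U : Filter ℝ) ≤ 𝓝[>] 0 → ∃ φ : Eucl (k+2) → ℝ, Continuous φ ∧ (∀ x ∉ Ω, φ x = 0) ∧ (∀ x ∈ Ω, 0 < φ x) ∧ IsLim k Φ U φ ∧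
      Appr Ω φ fun x => (kap k * r₀^k) * φ x - φ x ^ p := fun U hU => by
    obtain ⟨φ, hc, hz, hL⟩ := H.exists_lim U hU
    exact ⟨φ, hc, hz, fun x hx => H.lim_nonneg hU hc hL hz hx, hL, H.lim_appr hr hr₀ hU hc hL hz⟩
  obtain ⟨φ, hc, hz, hp, hL, hA⟩ := main (Ultrafilter.of (𝓝[>] 0)) (Ultrafilter.of_le _)
  refine ⟨φ, hc, hz, hp, ?_, hA⟩
  intro η hη
  refine Filter.mem_iff_ultrafilter.2 fun U hU => ?_
  obtain ⟨χ, hc', hz', hp', hL', hA'⟩ := main U hU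
  have e : χ = φ := by
    ext x
    exact le_antisymm (cmp_sol H.hΩb hκ H.hp0 H.hp1 hc' hc hz' hz hp' hp hA' hA x)
      (cmp_sol H.hΩb hκ H.hp0 H.hp1 hc hc' hz hz' hp hp' hA hA' x)
  subst e
  exact hL' η hη
end EV
end

section
/-- discretized scales -/
def ej (k j : ℕ) : ℝ := (j:ℝ) ^ (-((k:ℝ)/(k+1)))

/-- exceptional sets -/
def Ej (k : ℕ) (ρ : ℝ) (j : ℕ) : Set (Eucl (k+2)) :=
  ⋃ z ∈ Zf (k+2) (ej k j) (2*(ρ+1)), closedBall (lpt (ej k j) z) ((ρ+2) / j)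

lemma ej_pos {k j : ℕ} (hj : 1 ≤ j) : 0 < ej k j := Real.rpow_pos_of_pos (by exact_mod_cast hj) _

lemma ej_le_one {k j : ℕ} (hj : 1 ≤ j) : ej k j ≤ 1 :=
  Real.rpow_le_one_of_one_le_of_nonpos (by exact_mod_cast hj) (by have : (0:ℝ) ≤ (k:ℝ)/(k+1) := by positivity
                                                                  linarith)

lemma Ej_vol {k : ℕ} {ρ : ℝ} (hρ : 1 ≤ ρ) {j : ℕ} (hj : 1 ≤ j) :
    volume (Ej k ρ j) ≤ ENNReal.ofReal (((5*(2*(ρ+1)))^(k+2) * volume.real (ball (0:Eucl (k+2)) 1) * (ρ+2)^(k+2)) *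
      (1 / (j:ℝ)^(((k:ℝ)+2)/(k+1)))) := by
  have hj0 : (0:ℝ) < j := by exact_mod_cast hj
  refine (cover_vol (ej_pos hj) (ej_le_one hj) (by positivity) (by linarith)).trans (le_of_eq ?_)
  congr 1
  have : ((ρ+2) / j / ej k j)^(k+2) = (ρ+2)^(k+2) * (1 / (j:ℝ)^(((k:ℝ)+2)/(k+1))) := by
    rw [div_div, div_pow, div_eq_mul_one_div]
    congr 2
    rw [ej]
    nth_rewrite 1 [← Real.rpow_one (j:ℝ)]
    rw [← Real.rpow_add hj0, ← Real.rpow_natCast, ← Real.rpow_mul hj0.le]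
    congr 1
    have : (k:ℝ)+1 ≠ 0 := by positivity
    push_cast
    field_simp
    ring
  rw [this]; ring

lemma ej_cmp {k : ℕ} (hk : 1 ≤ k) {ε : ℝ} (hε : 0 < ε) {j : ℕ} (hj : 1 ≤ j) (h1 : (j:ℝ) * bb k ε ≤ 1)
    (h2 : 1 ≤ ((j:ℝ)+1) * bb k ε) : ε ≤ ej k j ∧ ej k j ≤ (1 + 1/j) * ε := by
  have hj0 : (0:ℝ) < j := by exact_mod_cast hj
  have hb := bb_pos (k := k) hε
  have hk0 : (0:ℝ) < k := by exact_mod_cast hk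
  set s := (k:ℝ)/(k+1) with hs
  have hs0 : 0 ≤ s := by positivity
  have hs1 : s ≤ 1 := by rw [hs, div_le_one (by positivity)]; linarith
  have e1 : ε = (bb k ε)^s := by
    rw [bb, ← Real.rpow_mul hε.le, hs]
    rw [show ((k:ℝ)+1)/k * (k/(k+1)) = 1 by field_simp, Real.rpow_one]
  have e2 : ej k j = (1/(j:ℝ))^s := by
    rw [ej, Real.rpow_neg hj0.le, one_div, Real.inv_rpow hj0.le]
  constructor
  · rw [e2]; nth_rewrite 1 [e1]
    refine Real.rpow_le_rpow hb.le ?_ hs0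
    rw [le_div_iff₀ hj0]; linarith
  · rw [e2]; nth_rewrite 1 [e1]
    have h3 : (1/(j:ℝ)) ≤ (1+1/j) * bb k ε := by
      have : (1+1/(j:ℝ)) * bb k ε = ((j:ℝ)+1) * bb k ε / j := by field_simp
      rw [this]; gcongr
    calc (1/(j:ℝ))^s ≤ ((1+1/j) * bb k ε)^s := Real.rpow_le_rpow (by positivity) h3 hs0
      _ = (1+1/(j:ℝ))^s * (bb k ε)^s := Real.mul_rpow (by positivity) hb.le
      _ ≤ (1+1/(j:ℝ)) * (bb k ε)^s := by
        gcongr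
        refine (Real.rpow_le_rpow_of_exponent_le ?_ hs1).trans (Real.rpow_one _).le
        have : 0 < 1/(j:ℝ) := by positivity
        linarith

lemma lpt_smul {n : ℕ} (ε ε' : ℝ) (hε : 0 < ε) (z : Fin n → ℤ) : lpt ε' z = (ε'/ε) • lpt ε z := by
  ext i
  simp only [lpt, PiLp.smul_apply, smul_eq_mul]
  field_simp

lemma in_Ej {k : ℕ} (hk : 1 ≤ k) {ρ : ℝ} (hρ : 1 ≤ ρ) {ε : ℝ} (hε : 0 < ε) {J : ℕ} (hJ : 1 ≤ J) (h : (J:ℝ) * bb k ε ≤ 1) :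
    holes (k+2) ε (bb k ε) ∩ ball 0 ρ ⊆ ⋃ i, Ej k ρ (i + J) := by
  rintro x ⟨hx, hxρ⟩
  have hb := bb_pos (k := k) hε
  set j := ⌊1/bb k ε⌋₊ with hj
  have hJj : J ≤ j := Nat.le_floor (by rw [le_div_iff₀ hb]; exact h)
  have h1 : (j:ℝ) * bb k ε ≤ 1 := by
    rw [← le_div_iff₀ hb]; exact Nat.floor_le (by positivity)
  have h2 : 1 ≤ ((j:ℝ)+1) * bb k ε := by
    rw [← div_le_iff₀ hb]; exact (Nat.lt_floor_add_one _).le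
  have hj1 : 1 ≤ j := hJ.trans hJj
  have hj0 : (0:ℝ) < j := by exact_mod_cast hj1
  obtain ⟨c1, c2⟩ := ej_cmp hk hε hj1 h1 h2
  obtain ⟨m, hm, hd⟩ := mem_holes.1 hx
  obtain ⟨z, rfl⟩ := exists_lp hm
  rw [mem_ball, dist_zero_right] at hxρ
  have hbj : bb k ε ≤ 1/j := by rw [le_div_iff₀ hj0]; linarith
  have hj11 : 1/(j:ℝ) ≤ 1 := by rw [div_le_one hj0]; exact_mod_cast hj1
  have hz : ‖lpt ε z‖ ≤ ρ + 1 := by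
    have : lpt ε z = x - (x - lpt ε z) := by abel
    rw [this]
    refine (norm_sub_le _ _).trans ?_
    linarith
  set t := ej k j / ε with ht
  have t1 : 1 ≤ t := by rw [ht, le_div_iff₀ hε]; linarith
  have t2 : t ≤ 1 + 1/j := by rw [ht, div_le_iff₀ hε]; exact c2
  have el : lpt (ej k j) z = t • lpt ε z := lpt_smul ε _ hε z
  have n1 : ‖lpt (ej k j) z‖ ≤ 2*(ρ+1) := by
    rw [el, norm_smul, Real.norm_eq_abs, abs_of_pos (by linarith)]
    exact mul_le_mul (by linarith) hz (norm_nonneg _) (by norm_num)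
  have n2 : ‖x - lpt (ej k j) z‖ ≤ (ρ+2)/j := by
    have : x - lpt (ej k j) z = (x - lpt ε z) - (t-1) • lpt ε z := by rw [el, sub_smul, one_smul]; abel
    rw [this]
    refine (norm_sub_le _ _).trans ?_
    rw [norm_smul, Real.norm_eq_abs, abs_of_nonneg (by linarith)]
    have h3 : (t-1) * ‖lpt ε z‖ ≤ (1/j) * (ρ+1) := mul_le_mul (by linarith) hz (norm_nonneg _) (by positivity)
    have h4 : (ρ+2)/(j:ℝ) = 1/j + 1/j*(ρ+1) := by field_simp; ring
    linarith
  refine mem_iUnion.2 ⟨j - J, ?_⟩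
  rw [Nat.sub_add_cancel hJj]
  refine mem_iUnion₂.2 ⟨z, mem_Zf (ej_pos hj1) n1, ?_⟩
  rw [mem_closedBall, dist_eq_norm]; exact n2

lemma tail_small {k : ℕ} {ρ : ℝ} (hρ : 1 ≤ ρ) {δ : ℝ} (hδ : 0 < δ) :
    ∃ J : ℕ, 1 ≤ J ∧ volume (⋃ i, Ej k ρ (i + J)) < ENNReal.ofReal δ := by
  set f : ℕ → ENNReal := fun j => ENNReal.ofReal (((5*(2*(ρ+1)))^(k+2) * volume.real (ball (0:Eucl (k+2)) 1) * (ρ+2)^(k+2)) *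
      (1 / (j:ℝ)^(((k:ℝ)+2)/(k+1)))) with hf
  have hs : Summable fun j : ℕ => (((5*(2*(ρ+1)))^(k+2) * volume.real (ball (0:Eucl (k+2)) 1) * (ρ+2)^(k+2)) *
      (1 / (j:ℝ)^(((k:ℝ)+2)/(k+1)))) := by
    refine Summable.mul_left _ (Real.summable_one_div_nat_rpow.2 ?_)
    rw [lt_div_iff₀ (by positivity)]; linarith
  have hft : ∑' j, f j ≠ ⊤ := hs.tsum_ofReal_ne_top
  have h1 := ENNReal.tendsto_sum_nat_add f hft
  have h2 := h1.eventually (gt_mem_nhds (ENNReal.ofReal_pos.2 hδ))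
  obtain ⟨J, hJ1, hJ2⟩ := ((eventually_ge_atTop 1).and h2).exists
  refine ⟨J, hJ1, lt_of_le_of_lt ((measure_iUnion_le _).trans ?_) hJ2⟩
  exact ENNReal.tsum_le_tsum fun i => Ej_vol hρ (by omega)

namespace EV
variable {k : ℕ} {Ω : Set (Eucl (k+2))} {p c₀ C₀ : ℝ} {a : ℝ → ℝ} {Φ : ℝ → Eucl (k+2) → ℝ}

lemma unif (H : EV k Ω p c₀ C₀ a Φ) {φ : Eucl (k+2) → ℝ} (hL : IsLim k Φ (𝓝[>] 0) φ) {δ : ℝ} (hδ : 0 < δ) :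
    ∃ D ⊆ Ω, volume (Ω \ D) < ENNReal.ofReal δ ∧ TendstoUniformlyOn Φ φ (𝓝[>] (0:ℝ)) D := by
  obtain ⟨ρ, hρ1, hρ⟩ := H.exists_rho
  obtain ⟨J, hJ1, hJ⟩ := tail_small (k := k) hρ1 hδ
  have hJ0 : (0:ℝ) < J := by exact_mod_cast hJ1
  refine ⟨Ω \ ⋃ i, Ej k ρ (i + J), sdiff_subset, lt_of_le_of_lt (measure_mono ?_) hJ, ?_⟩
  · intro x hx
    by_contra h
    exact hx.2 ⟨hx.1, h⟩
  rw [Metric.tendstoUniformlyOn_iff]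
  intro η hη
  have h0 : (0:ℝ) < min 1 (1/(J:ℝ)^k) := by positivity
  filter_upwards [hL (η/2) (by linarith), Ioo_mem_nhdsGT h0] with ε h1 hε x hx
  have e1 : ε < 1 := hε.2.trans_le (min_le_left _ _)
  have e2 : ε < 1/(J:ℝ)^k := hε.2.trans_le (min_le_right _ _)
  rw [lt_div_iff₀ (by positivity)] at e2
  have h3 := bb_small H.hk hε.1 hJ0 (by linarith)
  have h4 := in_Ej H.hk hρ1 hε.1 hJ1 (by linarith)
  have h5 : x ∉ holes (k+2) ε (bb k ε) := fun h => hx.2 (h4 ⟨h, hρ hx.1⟩)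
  have h6 := h1 x h5
  rw [dist_comm, Real.dist_eq]; linarith

lemma lq (H : EV k Ω p c₀ C₀ a Φ) {φ : Eucl (k+2) → ℝ} (hc : Continuous φ) (hz : ∀ x ∉ Ω, φ x = 0)
    (hL : IsLim k Φ (𝓝[>] 0) φ) {q : ℝ} (hq : 0 < q) :
    Tendsto (fun ε => ∫ x in Ω, |Φ ε x - φ x| ^ q) (𝓝[>] (0:ℝ)) (𝓝 0) := by
  obtain ⟨M, hM1, hM⟩ := H.bound
  obtain ⟨ρ, hρ1, hρ⟩ := H.exists_rho
  have hφcs : HasCompactSupport φ := HasCompactSupport.of_support_subset_isCompact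
    (isCompact_closedBall 0 ρ) (by
      intro x hx
      have : x ∈ Ω := by by_contra h; exact hx (hz x h)
      exact ball_subset_closedBall (hρ this))
  obtain ⟨M', hM'⟩ := hc.bounded_above_of_compact_support hφcs
  set N := (M + |M'| + 1)^q with hN
  have hN0 : 0 < N := by positivity
  set V := volume.real Ω with hV
  have hV0 : 0 ≤ V := measureReal_nonneg
  have hΩfin : volume Ω ≠ ⊤ := H.hΩb.measure_lt_top.ne
  rw [Metric.tendsto_nhds]
  intro τ hτ
  set σ := τ/(3*(V+1)) with hσ
  have hσ0 : 0 < σ := by positivity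
  filter_upwards [hL (σ^(1/q)) (by positivity), Ioo_mem_nhdsGT one_pos,
    bhole_small H.hk hρ1 (η := τ/(3*N)) (by positivity)] with ε h1 hε h2
  have hΦc := H.cont hε
  have hgc : Continuous fun x => |Φ ε x - φ x|^q := ((hΦc.sub hc).abs).rpow_const fun _ => Or.inr hq.le
  have hg0 : ∀ x, 0 ≤ |Φ ε x - φ x|^q := fun x => by positivity
  set S := holes (k+2) ε (bb k ε) ∩ ball 0 ρ with hS
  have hSm : MeasurableSet S := (holes_closed hε.1 (bb_pos hε.1).le).measurableSet.inter isOpen_ball.measurableSet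
  have hSf : volume S ≠ ⊤ := ((measure_mono inter_subset_right).trans_lt measure_ball_lt_top).ne
  rw [Real.dist_eq, sub_zero, abs_of_nonneg (integral_nonneg hg0)]
  have hSi : Integrable (S.indicator fun _ => N) := (integrable_indicator_iff hSm).2 (integrableOn_const hSf)
  have i1 : IntegrableOn (fun x => σ + S.indicator (fun _ => N) x) Ω :=
    (integrableOn_const hΩfin).add hSi.integrableOn
  have hle : ∫ x in Ω, |Φ ε x - φ x|^q ≤ ∫ x in Ω, (σ + S.indicator (fun _ => N) x) := by
    refine integral_mono_of_nonneg (Eventually.of_forall hg0) i1 ?_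
    filter_upwards [ae_restrict_mem H.hΩo.measurableSet] with x hx
    by_cases hxS : x ∈ S
    · rw [indicator_of_mem hxS]
      have : |Φ ε x - φ x|^q ≤ N := by
        refine Real.rpow_le_rpow (abs_nonneg _) ?_ hq.le
        have q1 := hM ε hε x
        have q2 := H.nonneg hε x
        have q3 := hM' x
        rw [Real.norm_eq_abs] at q3
        have q4 := abs_sub (Φ ε x) (φ x)
        rw [abs_of_nonneg q2] at q4
        linarith [le_abs_self M']
      linarith
    · rw [indicator_of_notMem hxS, add_zero]
      have hx2 : x ∉ holes (k+2) ε (bb k ε) := fun h => hxS ⟨h, hρ hx⟩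
      calc |Φ ε x - φ x|^q ≤ (σ^(1/q))^q := Real.rpow_le_rpow (abs_nonneg _) (h1 x hx2) hq.le
        _ = σ := by rw [← Real.rpow_mul hσ0.le, one_div, inv_mul_cancel₀ hq.ne', Real.rpow_one]
  have hintg : ∫ x in Ω, (σ + S.indicator (fun _ => N) x) ≤ V * σ + τ/(3*N) * N := by
    have i0 : IntegrableOn (fun _ : Eucl (k+2) => σ) Ω := integrableOn_const hΩfin
    rw [integral_add i0 hSi.integrableOn, setIntegral_const, smul_eq_mul]
    have : ∫ x in Ω, S.indicator (fun _ => N) x ≤ ∫ x, S.indicator (fun _ => N) x :=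
      setIntegral_le_integral hSi (Eventually.of_forall fun x => indicator_nonneg (fun _ _ => hN0.le) x)
    have hI : ∫ x, S.indicator (fun _ => N) x = volume.real S * N := by
      rw [integral_indicator hSm, setIntegral_const, smul_eq_mul]
    rw [hI] at this
    have h3 := mul_le_mul_of_nonneg_right h2 hN0.le
    linarith
  have f1 : V * σ ≤ τ/3 := by
    have : (V+1) * σ = τ/3 := by rw [hσ]; field_simp
    nlinarith
  have f2 : τ/(3*N) * N = τ/3 := by field_simp
  linarith

end EV

end

/-- homogenization of the nonlinear eigenvalue problem at the critical
rate: the eigenfunctions φ_ε converge (in every L^q norm, and uniformly off sets of small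
measure) to a continuous φ which is a positive viscosity solution of
Δφ - κ_{B_{r₀}} φ + φ^p = 0 in Ω with φ = 0 on ∂Ω. -/
theorem ev_homogenization
    (n : ℕ) (hn : 3 ≤ n)
    (Ω : Set (Eucl n)) (hΩo : IsOpen Ω) (hΩb : Bornology.IsBounded Ω)
    (hΩc : IsConnected Ω) (hΩs : HasSmoothBoundary Ω)
    (p : ℝ) (hp0 : 0 < p) (hp1 : p < 1)
    (c₀ C₀ : ℝ) (hc₀ : 0 < c₀) (hC₀ : 0 < C₀)
    (a : ℝ → ℝ)
    (haε : ∀ ε ∈ Ioo (0:ℝ) 1, c₀ * aStar n ε ≤ a ε ∧ a ε ≤ C₀ * aStar n ε)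
    (r₀ : ℝ) (hr₀ : Tendsto (fun ε => a ε / aStar n ε) (𝓝[>] (0:ℝ)) (𝓝 r₀))
    (Φ : ℝ → Eucl n → ℝ)
    (hΦ : ∀ ε ∈ Ioo (0:ℝ) 1, IsEVSol n Ω ε (a ε) p (Φ ε)) :
    ∃ φl : Eucl n → ℝ,
      ContinuousOn φl (closure Ω) ∧
      (∀ q > (0:ℝ),
        Tendsto (fun ε => ∫ x in Ω, |Φ ε x - φl x| ^ q) (𝓝[>] (0:ℝ)) (𝓝 0)) ∧
      (∀ δ > (0:ℝ), ∃ D ⊆ Ω, volume (Ω \ D) < ENNReal.ofReal δ ∧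
        TendstoUniformlyOn Φ φl (𝓝[>] (0:ℝ)) D) ∧
      ViscSubsolE
        (fun ψ x => lap ψ x - capacity n (closedBall 0 r₀) * ψ x + ψ x ^ p) Ω φl ∧
      ViscSupersolE
        (fun ψ x => lap ψ x - capacity n (closedBall 0 r₀) * ψ x + ψ x ^ p) Ω φl ∧
      (∀ x ∈ frontier Ω, φl x = 0) ∧
      (∀ x ∈ Ω, 0 < φl x) := by
  obtain ⟨k, rfl⟩ : ∃ k, n = k + 2 := ⟨n - 2, by omega⟩
  have hk : 1 ≤ k := by omega
  have H : EV k Ω p c₀ C₀ a Φ := ⟨hk, hΩo, hΩb, hΩs, hp0, hp1, hc₀, hC₀, haε, hΦ⟩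
  have hr : 0 < r₀ := by
    refine lt_of_lt_of_le hc₀ (ge_of_tendsto hr₀ ?_)
    filter_upwards [Ioo_mem_nhdsGT one_pos] with ε hε
    have hs : 0 < aStar (k+2) ε := Real.rpow_pos_of_pos hε.1 _
    rw [le_div_iff₀ hs]
    exact (haε ε hε).1
  obtain ⟨φ, hc, hz, hp, hL, hA⟩ := H.main_lim hr hr₀
  have hcf : Continuous fun x => (kap k * r₀^k) * φ x - φ x ^ p :=
    (continuous_const.mul hc).sub (hc.rpow_const fun _ => Or.inr hp0.le)
  refine ⟨φ, hc.continuousOn, fun q hq => H.lq hc hz hL hq, fun δ hδ => H.unif hL hδ, ?_, ?_, ?_, hp⟩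
  · intro ψ hψ x hx he hle
    rw [hΩo.nhdsWithin_eq hx] at hle
    have := visc_core hΩo hc hcf hA hψ hx he hle
    simp only [capacity_eq hk hr, he]
    linarith
  · intro ψ hψ x hx he hle
    rw [hΩo.nhdsWithin_eq hx] at hle
    have := visc_core (ψ := fun y => - ψ y) hΩo hc.neg hcf.neg hA.neg hψ.neg hx (by simp [he])
      (hle.mono fun y hy => by simpa using hy)
    rw [lap_neg (hψ.contDiffAt.of_le two_le_inf)] at this
    simp only [capacity_eq hk hr, he]
    simp only [Pi.neg_apply] at this
    linarith
  · intro x hx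
    refine hz x fun h => ?_
    rw [frontier, hΩo.interior_eq] at hx
    exact hx.2 h
end
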